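/- (Theorem: Bernstein-von Mises limit for the parametric component of the partial linear model) In the partial linear model setup of the context, assume additionally α > p/2. Then sup_F | Π( √n(β − β₀) ∈ F | D_n ) − Φ(F | Δ_n, (E zz^T)^{−1}) | → 0 in P₀-probability as n → ∞, where the supremum is over measurable sets F ⊆ ℝ^q, Φ(· | μ, Σ) is the multivariate normal N(μ, Σ) probability measure on ℝ^q, and Δ_n = n^{−1/2} Σ_{i=1}^n (E zz^T)^{−1} z_i (y_i − η₀(x_i) − z_i^Tβ₀). -/

import Mathlib

open MeasureTheory Filter Real Matrix
open scoped ENNReal NNReal BigOperators Classical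

noncomputable section

namespace KMP

/-- The unit hypercube `[0,1]^p`. -/
def cube (p : ℕ) : Set (Fin p → ℝ) := {x | ∀ j, 0 ≤ x j ∧ x j ≤ 1}

/-- A boxed kernel: continuous, `[0,1]`-valued, supported on the closed unit sup-norm ball,
nonincreasing in the sup-norm (`‖·‖` on `Fin p → ℝ` is the sup-norm). -/
def IsBoxedKernel {p : ℕ} (φ : (Fin p → ℝ) → ℝ) : Prop :=
  Continuous φ ∧ (∀ u, 0 ≤ φ u ∧ φ u ≤ 1) ∧ (∀ u, 1 < ‖u‖ → φ u = 0) ∧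
    ∀ u v, ‖u‖ ≤ ‖v‖ → φ v ≤ φ u

/-- The block `X_K(k) = ∏_j ((k_j-1)/K, k_j/K]`; here `k j : Fin K` encodes `k_j - 1`. -/
def block {p : ℕ} (K : ℕ) (k : Fin p → Fin K) : Set (Fin p → ℝ) :=
  {x | ∀ j, ((k j : ℕ) : ℝ) / K < x j ∧ x j ≤ (((k j : ℕ) : ℝ) + 1) / K}

/-- The closure of the block `X_K(k)`. -/
def blockCl {p : ℕ} (K : ℕ) (k : Fin p → Fin K) : Set (Fin p → ℝ) :=
  {x | ∀ j, ((k j : ℕ) : ℝ) / K ≤ x j ∧ x j ≤ (((k j : ℕ) : ℝ) + 1) / K}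

/-- The center `μ_k^⋆` of the block `X_K(k)`. -/
def center {p : ℕ} (K : ℕ) (k : Fin p → Fin K) : Fin p → ℝ :=
  fun j => (2 * ((k j : ℕ) : ℝ) + 1) / (2 * K)

/-- Multi-indices `s ∈ {0,…,m}^p` with `|s| ≤ m`. -/
def mIdx (p m : ℕ) : Finset (Fin p → Fin (m + 1)) :=
  Finset.univ.filter fun s => (∑ j, (s j : ℕ)) ≤ m

/-- Degree `|s|` of a multi-index. -/
def deg {p m : ℕ} (s : Fin p → Fin (m + 1)) : ℕ := ∑ j, (s j : ℕ)

/-- Kernel mixture weight `w_k(x) = φ_h(x-μ_k) / ∑_l φ_h(x-μ_l)`. -/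
def weight {p : ℕ} (φ : (Fin p → ℝ) → ℝ) (K : ℕ) (h : ℝ)
    (μ : (Fin p → Fin K) → Fin p → ℝ) (k : Fin p → Fin K) (x : Fin p → ℝ) : ℝ :=
  φ (fun j => (x j - μ k j) / h) / ∑ l : Fin p → Fin K, φ (fun j => (x j - μ l j) / h)

/-- Monomial `(x - μ_k^⋆)^s`. -/
def mono {p : ℕ} (K m : ℕ) (k : Fin p → Fin K) (s : Fin p → Fin (m + 1))
    (x : Fin p → ℝ) : ℝ :=
  ∏ j, (x j - center K k j) ^ (s j : ℕ)

/-- A kernel mixture of polynomials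
`f(x) = ∑_k ∑_{|s| ≤ m} ξ_{ks} w_k(x) (x - μ_k^⋆)^s`. -/
def kmpFun {p : ℕ} (φ : (Fin p → ℝ) → ℝ) (K m : ℕ) (h : ℝ)
    (μ : (Fin p → Fin K) → Fin p → ℝ)
    (ξ : (Fin p → Fin K) → (Fin p → Fin (m + 1)) → ℝ) (x : Fin p → ℝ) : ℝ :=
  ∑ k : Fin p → Fin K, ∑ s ∈ mIdx p m, ξ k s * weight φ K h μ k x * mono K m k s x

/-- Partial derivative in the `j`-th coordinate direction. -/
def pderiv1 {p : ℕ} (j : Fin p) (f : (Fin p → ℝ) → ℝ) : (Fin p → ℝ) → ℝ :=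
  fun x => fderiv ℝ f x (Pi.single j 1)

/-- Mixed partial derivative `D^s f`. -/
def mderiv {p : ℕ} (s : Fin p → ℕ) (f : (Fin p → ℝ) → ℝ) : (Fin p → ℝ) → ℝ :=
  (List.finRange p).foldr (fun j g => (pderiv1 j)^[s j] g) f

/-- Degree of an `ℕ`-valued multi-index. -/
def degN {p : ℕ} (s : Fin p → ℕ) : ℕ := ∑ j, s j

/-- Euclidean norm on `Fin p → ℝ`. -/
def eucNorm {p : ℕ} (x : Fin p → ℝ) : ℝ := Real.sqrt (∑ j, (x j) ^ 2)

/-- `⌈α - 1⌉` (as a natural number; it is `0` when `α ≤ 1`). -/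
def hOrder (α : ℝ) : ℕ := ⌈α - 1⌉₊

/-- The α-Hölder class with envelope `B` on `[0,1]^p`: `⌈α-1⌉`-times continuously
differentiable, and the sum of the sup-norm bound on all derivatives of order `≤ ⌈α-1⌉`
and the Hölder constant of the derivatives of order `⌈α-1⌉` is at most `B`. -/
def IsHolder (p : ℕ) (α B : ℝ) (f : (Fin p → ℝ) → ℝ) : Prop :=
  ContDiff ℝ (hOrder α : ℕ∞) f ∧
    ∃ B₁ B₂ : ℝ, 0 ≤ B₁ ∧ 0 ≤ B₂ ∧ B₁ + B₂ ≤ B ∧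
      (∀ s : Fin p → ℕ, degN s ≤ hOrder α → ∀ x ∈ cube p, |mderiv s f x| ≤ B₁) ∧
      (∀ s : Fin p → ℕ, degN s = hOrder α → ∀ x ∈ cube p, ∀ y ∈ cube p, x ≠ y →
        |mderiv s f x - mderiv s f y| ≤ B₂ * eucNorm (x - y) ^ (α - (degN s : ℝ)))

/-- The `N(0, σ²)` density `φ_σ`. -/
def gaussD (σ t : ℝ) : ℝ := (σ * Real.sqrt (2 * π))⁻¹ * Real.exp (-t ^ 2 / (2 * σ ^ 2))

/-- The true data-generating distribution on `[0,1]^p × ℝ` with joint Lebesgue density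
`p₀(x,y) = p_x(x) φ_{σ₀}(y - f₀(x))` (`p_x` supported on the cube). -/
def trueMeas (p : ℕ) (px f₀ : (Fin p → ℝ) → ℝ) (σ₀ : ℝ) :
    Measure ((Fin p → ℝ) × ℝ) :=
  volume.withDensity fun xy =>
    ENNReal.ofReal ((cube p).indicator px xy.1 * gaussD σ₀ (xy.2 - f₀ xy.1))

/-- The conditional prior on the regression function given `K`: push forward the product
prior on the centers (`μ_k = μ_k^⋆ + μ̃_k/(2K)`, `μ̃_k ~ νμ` i.i.d.), the coefficients
(`ξ_{ks} ~ νξ` i.i.d.) and the bandwidth (`h ~ νhK`) through the kernel mixture of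
polynomials parametrization. -/
def priorGivenK {p : ℕ} (φ : (Fin p → ℝ) → ℝ) (m K : ℕ)
    (νμ : Measure (Fin p → ℝ)) (νξ : Measure ℝ) (νhK : Measure ℝ) :
    Measure ((Fin p → ℝ) → ℝ) :=
  Measure.map
    (fun θ : ((Fin p → Fin K) → Fin p → ℝ) ×
        ((Fin p → Fin K) → (Fin p → Fin (m + 1)) → ℝ) × ℝ =>
      kmpFun φ K m θ.2.2 (fun k => center K k + (2 * (K : ℝ))⁻¹ • θ.1 k) θ.2.1)
    ((Measure.pi fun _ : Fin p → Fin K => νμ).prod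
      ((Measure.pi fun _ : Fin p → Fin K =>
          Measure.pi fun _ : Fin p → Fin (m + 1) => νξ).prod νhK))

/-- The full hierarchical kernel mixture of polynomials prior on `(f, σ)`. -/
def kmpPrior {p : ℕ} (φ : (Fin p → ℝ) → ℝ) (m : ℕ) (PK : Measure ℕ)
    (νμ : Measure (Fin p → ℝ)) (νξ : Measure ℝ) (νh : ℕ → Measure ℝ)
    (πσ : Measure ℝ) : Measure (((Fin p → ℝ) → ℝ) × ℝ) :=
  (PK.bind fun K => priorGivenK φ m K νμ νξ (νh K)).prod πσ

/-- Generic posterior probability of a set `A` given likelihood `L` and prior. -/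
def postGen {Θ : Type*} [MeasurableSpace Θ] (prior : Measure Θ) (L : Θ → ℝ)
    (A : Set Θ) : ℝ :=
  (∫ θ in A, L θ ∂prior) / ∫ θ, L θ ∂prior

/-- Gaussian regression likelihood of the data `d = (x_i, y_i)_i`. -/
def lik {p n : ℕ} (f : (Fin p → ℝ) → ℝ) (σ : ℝ) (d : Fin n → (Fin p → ℝ) × ℝ) : ℝ :=
  ∏ i, gaussD σ ((d i).2 - f (d i).1)

/-- The true data-generating distribution for the partial linear model on
`[0,1]^p × ℝ^q × ℝ`, with joint Lebesgue density
`p₀(x,z,y) = p_x(x) p_z(z) φ(y - zᵀβ₀ - η₀(x))`. -/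
def trueMeasPL (p q : ℕ) (px : (Fin p → ℝ) → ℝ) (pz : (Fin q → ℝ) → ℝ)
    (β₀ : Fin q → ℝ) (η₀ : (Fin p → ℝ) → ℝ) :
    Measure ((Fin p → ℝ) × (Fin q → ℝ) × ℝ) :=
  volume.withDensity fun w =>
    ENNReal.ofReal ((cube p).indicator px w.1 * pz w.2.1 *
      gaussD 1 (w.2.2 - (∑ i, w.2.1 i * β₀ i) - η₀ w.1))

/-- The joint prior on `(η, β)` for the partial linear model: the hierarchical kernel
mixture of polynomials prior on `η` and, independently, `β ~ N(0, I_q)`. -/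
def plPrior {p : ℕ} (q : ℕ) (φ : (Fin p → ℝ) → ℝ) (m : ℕ) (PK : Measure ℕ)
    (νμ : Measure (Fin p → ℝ)) (νξ : Measure ℝ) (νh : ℕ → Measure ℝ) :
    Measure (((Fin p → ℝ) → ℝ) × (Fin q → ℝ)) :=
  (PK.bind fun K => priorGivenK φ m K νμ νξ (νh K)).prod
    (Measure.pi fun _ : Fin q => ProbabilityTheory.gaussianReal 0 1)

/-- Partial linear model likelihood of the data `d = (x_i, z_i, y_i)_i`. -/
def likPL {p q n : ℕ} (η : (Fin p → ℝ) → ℝ) (β : Fin q → ℝ)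
    (d : Fin n → (Fin p → ℝ) × (Fin q → ℝ) × ℝ) : ℝ :=
  ∏ i, gaussD 1 ((d i).2.2 - (∑ j, (d i).2.1 j * β j) - η (d i).1)

/-- The `N(μ, A⁻¹)` probability of a set `F ⊆ ℝ^q`, written with precision matrix `A`. -/
def normalProb (q : ℕ) (μv : Fin q → ℝ) (A : Matrix (Fin q) (Fin q) ℝ)
    (F : Set (Fin q → ℝ)) : ℝ :=
  ∫ v in F, Real.sqrt A.det * (2 * π) ^ (-(q : ℝ) / 2) *
    Real.exp (-(1 / 2) * ((v - μv) ⬝ᵥ A.mulVec (v - μv)))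

/-- The recentering sequence
`Δ_n = n^{-1/2} ∑_i (E zzᵀ)⁻¹ z_i (y_i - η₀(x_i) - z_iᵀβ₀)`. -/
def bvmCenter {p q : ℕ} (n : ℕ) (M : Matrix (Fin q) (Fin q) ℝ) (β₀ : Fin q → ℝ)
    (η₀ : (Fin p → ℝ) → ℝ) (d : Fin n → (Fin p → ℝ) × (Fin q → ℝ) × ℝ) :
    Fin q → ℝ :=
  (Real.sqrt n)⁻¹ •
    ∑ i, ((d i).2.2 - η₀ (d i).1 - ∑ j, (d i).2.1 j * β₀ j) • M⁻¹.mulVec ((d i).2.1)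

open ProbabilityTheory in
lemma subG_mono {Ω : Type*} [MeasurableSpace Ω] {μ : Measure Ω} {X : Ω → ℝ} {c c' : ℝ≥0}
    (h : HasSubgaussianMGF X c μ) (hc : c ≤ c') : HasSubgaussianMGF X c' μ :=
  ⟨h.integrable_exp_mul, fun t => (h.mgf_le t).trans (by
    apply Real.exp_le_exp.2
    have : (c : ℝ) ≤ c' := by exact_mod_cast hc
    gcongr)⟩

open ProbabilityTheory in
lemma subG_pi {E : Type*} [MeasurableSpace E] (ν : Measure E) [IsProbabilityMeasure ν]
    {F : E → ℝ} {c : ℝ≥0} (h : HasSubgaussianMGF F c ν) {n : ℕ}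
    (a : Fin n → ℝ) (A : ℝ≥0) (hA : (c : ℝ) * ∑ i, a i ^ 2 ≤ A) :
    HasSubgaussianMGF (fun w : Fin n → E => ∑ i, a i * F (w i)) A
      (Measure.pi fun _ : Fin n => ν) := by
  have h1 : iIndepFun (fun i (w : Fin n → E) => a i * F (w i)) (Measure.pi fun _ : Fin n => ν) :=
    iIndepFun_pi (X := fun i x => a i * F x) (fun i => (h.aemeasurable.const_mul _))
  have h2 : ∀ i ∈ (Finset.univ : Finset (Fin n)),
      HasSubgaussianMGF (fun w : Fin n → E => a i * F (w i)) (⟨a i ^ 2, sq_nonneg _⟩ * c)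
        (Measure.pi fun _ : Fin n => ν) := by
    intro i _
    have := (h.const_mul (a i))
    have hm : (Measure.pi fun _ : Fin n => ν).map (fun w => w i) = ν :=
      (measurePreserving_eval (fun _ : Fin n => ν) i).map_eq
    rw [← hm] at this
    exact HasSubgaussianMGF.of_map (Y := fun w : Fin n → E => w i) (X := fun x => a i * F x)
      (measurable_pi_apply i).aemeasurable this
  refine subG_mono (HasSubgaussianMGF.sum_of_iIndepFun h1 h2) ?_
  rw [← NNReal.coe_le_coe]
  push_cast
  refine le_trans (le_of_eq ?_) hA
  rw [Finset.mul_sum]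
  exact Finset.sum_congr rfl fun i _ => by rw [mul_comm]; rfl

open ProbabilityTheory in
lemma subG_tail {Ω : Type*} [MeasurableSpace Ω] {μ : Measure Ω} [IsFiniteMeasure μ] {X : Ω → ℝ} {A : ℝ≥0}
    (h : HasSubgaussianMGF X A μ) {r : ℝ} (hr : 0 ≤ r) :
    μ {w | r < |X w|} ≤ ENNReal.ofReal (2 * Real.exp (- r ^ 2 / (2 * A))) := by
  have h1 := h.measure_ge_le hr
  have h2 := h.neg.measure_ge_le hr
  have : {w | r < |X w|} ⊆ {w | r ≤ X w} ∪ {w | r ≤ (-X) w} := by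
    intro w hw
    have hw' : r < |X w| := hw
    rcases lt_abs.1 hw' with h | h
    · exact Or.inl h.le
    · exact Or.inr h.le
  calc μ {w | r < |X w|} ≤ μ {w | r ≤ X w} + μ {w | r ≤ (-X) w} :=
        (measure_mono this).trans (measure_union_le _ _)
    _ ≤ ENNReal.ofReal (Real.exp (- r ^ 2 / (2 * A))) + ENNReal.ofReal (Real.exp (- r ^ 2 / (2 * A))) := by
        gcongr
        · rw [← ofReal_measureReal]; exact ENNReal.ofReal_le_ofReal h1
        · rw [← ofReal_measureReal]; exact ENNReal.ofReal_le_ofReal h2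
    _ = _ := by rw [← ENNReal.ofReal_add (by positivity) (by positivity)]; ring_nf

open ProbabilityTheory in
lemma subG_exp_sub_one {Ω : Type*} [MeasurableSpace Ω] {μ : Measure Ω} [IsProbabilityMeasure μ]
    {X : Ω → ℝ} {A : ℝ≥0}
    (h : HasSubgaussianMGF X A μ) {θ : ℝ} (hθ : 0 < θ) :
    ∫⁻ w, ENNReal.ofReal |Real.exp (-X w) - 1| ∂μ ≤
      ENNReal.ofReal (θ / 2 + (Real.exp (2 * A) - 1) / θ) := by
  have hp : ∀ x : ℝ, |Real.exp (-x) - 1| ≤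
      θ / 2 + (Real.exp (2 * x) + Real.exp (-2 * x) - 2) / (2 * θ) := by
    intro x
    have e1 : Real.exp (2 * x) + Real.exp (-2 * x) - 2 = (Real.exp x - Real.exp (-x)) ^ 2 := by
      have : Real.exp x * Real.exp (-x) = 1 := by rw [← Real.exp_add]; simp
      rw [show 2 * x = x + x by ring, show -2 * x = -x + -x by ring, Real.exp_add, Real.exp_add]
      nlinarith
    have e2 : |Real.exp (-x) - 1| ≤ |Real.exp x - Real.exp (-x)| := by
      rcases le_total 0 x with hx | hx
      · have a1 : Real.exp (-x) ≤ 1 := Real.exp_le_one_iff.2 (by linarith)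
        have a2 : 1 ≤ Real.exp x := Real.one_le_exp hx
        rw [abs_of_nonpos (by linarith), abs_of_nonneg (by linarith)]; linarith
      · have a1 : 1 ≤ Real.exp (-x) := Real.one_le_exp (by linarith)
        have a2 : Real.exp x ≤ 1 := Real.exp_le_one_iff.2 hx
        rw [abs_of_nonneg (by linarith), abs_of_nonpos (by linarith)]; linarith
    rw [e1, ← sq_abs]
    set y := |Real.exp x - Real.exp (-x)|
    have : θ / 2 + y ^ 2 / (2 * θ) - y = (y - θ) ^ 2 / (2 * θ) := by field_simp; ring
    have : 0 ≤ (y - θ) ^ 2 / (2 * θ) := by positivity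
    linarith
  have hi1 := h.integrable_exp_mul 2
  have hi2 := h.integrable_exp_mul (-2)
  have m1 := h.mgf_le 2
  have m2 := h.mgf_le (-2)
  have hi : Integrable (fun w => θ / 2 + (Real.exp (2 * X w) + Real.exp (-2 * X w) - 2) / (2 * θ)) μ :=
    (integrable_const _).add (((hi1.add hi2).sub (integrable_const _)).div_const _)
  calc ∫⁻ w, ENNReal.ofReal |Real.exp (-X w) - 1| ∂μ
      ≤ ∫⁻ w, ENNReal.ofReal (θ / 2 + (Real.exp (2 * X w) + Real.exp (-2 * X w) - 2) / (2 * θ)) ∂μ :=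
        lintegral_mono fun w => ENNReal.ofReal_le_ofReal (hp _)
    _ = ENNReal.ofReal (∫ w, (θ / 2 + (Real.exp (2 * X w) + Real.exp (-2 * X w) - 2) / (2 * θ)) ∂μ) :=
        (ofReal_integral_eq_lintegral_ofReal hi
          (Eventually.of_forall fun w => (abs_nonneg _).trans (hp (X w)))).symm
    _ ≤ _ := by
        apply ENNReal.ofReal_le_ofReal
        have i3 : ∫ w, (θ / 2 + (Real.exp (2 * X w) + Real.exp (-2 * X w) - 2) / (2 * θ)) ∂μ
            = θ / 2 + ((∫ w, Real.exp (2 * X w) ∂μ) + (∫ w, Real.exp (-2 * X w) ∂μ) - 2) / (2 * θ) := by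
          have j1 : Integrable (fun w => Real.exp (2 * X w) + Real.exp (-2 * X w)) μ := hi1.add hi2
          have j2 : Integrable (fun w => Real.exp (2 * X w) + Real.exp (-2 * X w) - 2) μ :=
            j1.sub (integrable_const _)
          rw [integral_add (integrable_const _) (j2.div_const _),
            integral_const, integral_div, integral_sub j1 (integrable_const _), integral_add hi1 hi2]
          simp
        rw [i3]
        have e : (A : ℝ) * 2 ^ 2 / 2 = 2 * A := by ring
        have e' : (A : ℝ) * (-2) ^ 2 / 2 = 2 * A := by ring
        rw [e] at m1; rw [e'] at m2
        simp only [mgf] at m1 m2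
        have : (Real.exp (2 * A) - 1) / θ = (Real.exp (2 * A) + Real.exp (2 * A) - 2) / (2 * θ) := by
          field_simp; ring
        rw [this]
        gcongr

/-- standard Gaussian law -/
abbrev gam : Measure ℝ := ProbabilityTheory.gaussianReal 0 1

lemma lint_lr {n : ℕ} (f : Fin n → ℝ) :
    ∫⁻ e : Fin n → ℝ, ENNReal.ofReal (Real.exp (∑ i, (e i * f i - f i ^ 2 / 2)))
      ∂(Measure.pi fun _ : Fin n => gam) = 1 := by
  have key : ∀ t : ℝ, ∫ e, Real.exp (e * t - t ^ 2 / 2) ∂gam = 1 := by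
    intro t
    have := congrFun (ProbabilityTheory.mgf_id_gaussianReal (μ := 0) (v := 1)) t
    simp only [ProbabilityTheory.mgf, id] at this
    have h2 : ∀ e : ℝ, Real.exp (e * t - t ^ 2 / 2) = Real.exp (t * e) * Real.exp (-(t ^ 2 / 2)) := by
      intro e; rw [← Real.exp_add]; ring_nf
    simp_rw [h2]
    rw [integral_mul_const, this, ← Real.exp_add]
    simp
  have hint : ∀ t : ℝ, Integrable (fun e => Real.exp (e * t - t ^ 2 / 2)) gam := by
    intro t
    by_contra h
    have := key t
    rw [integral_undef h] at this
    norm_num at this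
  have h3 : ∀ e : Fin n → ℝ, Real.exp (∑ i, (e i * f i - f i ^ 2 / 2)) =
      ∏ i, Real.exp (e i * f i - f i ^ 2 / 2) := fun e => Real.exp_sum _ _
  simp_rw [h3]
  rw [← ofReal_integral_eq_lintegral_ofReal]
  · rw [integral_fintype_prod_eq_prod (f := fun i x => Real.exp (x * f i - f i ^ 2 / 2))]
    simp [key]
  · exact Integrable.fintype_prod (f := fun i x => Real.exp (x * f i - f i ^ 2 / 2)) (fun i => hint _)
  · exact Eventually.of_forall fun e => Finset.prod_nonneg fun i _ => (Real.exp_pos _).le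

lemma lint_sq (n : ℕ) :
    ∫⁻ e : Fin n → ℝ, ENNReal.ofReal (∑ i, e i ^ 2) ∂(Measure.pi fun _ : Fin n => gam) = n := by
  have h1 : ∫⁻ x, ENNReal.ofReal (x ^ 2) ∂gam = 1 := by
    have hm : MemLp id 2 gam := ProbabilityTheory.memLp_id_gaussianReal 2
    have hi : Integrable (fun x : ℝ => x ^ 2) gam := hm.integrable_sq
    rw [← ofReal_integral_eq_lintegral_ofReal hi (Eventually.of_forall fun x => sq_nonneg x)]
    have hv := ProbabilityTheory.variance_id_gaussianReal (μ := 0) (v := 1)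
    rw [ProbabilityTheory.variance_of_integral_eq_zero aemeasurable_id
      (by simp)] at hv
    simp only [id] at hv
    rw [hv]; simp
  have h2 : ∀ e : Fin n → ℝ, ENNReal.ofReal (∑ i, e i ^ 2) = ∑ i, ENNReal.ofReal (e i ^ 2) :=
    fun e => ENNReal.ofReal_sum_of_nonneg fun i _ => sq_nonneg _
  simp_rw [h2]
  rw [lintegral_finsetSum _ (fun i _ => by fun_prop)]
  have h3 : ∀ i : Fin n, ∫⁻ e : Fin n → ℝ, ENNReal.ofReal (e i ^ 2) ∂(Measure.pi fun _ : Fin n => gam) = 1 := by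
    intro i
    rw [← h1, ← (measurePreserving_eval (fun _ : Fin n => gam) i).lintegral_comp (by fun_prop)]
  simp [h3]

lemma subG_gauss : ProbabilityTheory.HasSubgaussianMGF (fun x : ℝ => x) 1 gam := by
  refine ⟨fun t => ?_, fun t => ?_⟩
  · exact ProbabilityTheory.integrable_exp_mul_gaussianReal t
  · rw [show (fun x : ℝ => x) = id from rfl, ProbabilityTheory.mgf_id_gaussianReal]
    simp

def psi {q : ℕ} (b : Fin q → ℝ) : ℝ := Real.exp (-(∑ j, b j ^ 2) / 2)

def LRf {n q : ℕ} (g : Fin n → ℝ) (z : Fin n → Fin q → ℝ) (e : Fin n → ℝ) (b : Fin q → ℝ) : ℝ :=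
  Real.exp (∑ i, (e i * (z i ⬝ᵥ b + g i) - (z i ⬝ᵥ b + g i) ^ 2 / 2))

def ell {n : ℕ} (g : Fin n → ℝ) (e : Fin n → ℝ) : ℝ :=
  Real.exp (∑ i, (e i * g i - g i ^ 2 / 2))

def Wv {n q : ℕ} (z : Fin n → Fin q → ℝ) (e : Fin n → ℝ) : Fin q → ℝ :=
  (Real.sqrt n)⁻¹ • ∑ i, e i • z i

def uV {n q : ℕ} (g : Fin n → ℝ) (z : Fin n → Fin q → ℝ) (u : Fin q → ℝ) : ℝ :=
  ∑ i, ((Real.sqrt n)⁻¹ * g i) * (z i ⬝ᵥ u)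

def mnq {n q : ℕ} (z : Fin n → Fin q → ℝ) (u : Fin q → ℝ) : ℝ :=
  (n : ℝ)⁻¹ * ∑ i, (z i ⬝ᵥ u) ^ 2

def pU {Ω : Type*} [MeasurableSpace Ω] (Q : Measure Ω) {n q : ℕ} (g : Ω → Fin n → ℝ)
    (z : Fin n → Fin q → ℝ) (e : Fin n → ℝ) (β₀ u : Fin q → ℝ) : ℝ :=
  (∫ ω, LRf (g ω) z e ((Real.sqrt n)⁻¹ • u) ∂Q) * psi (β₀ + (Real.sqrt n)⁻¹ • u)

def ZU {Ω : Type*} [MeasurableSpace Ω] (Q : Measure Ω) {n : ℕ} (g : Ω → Fin n → ℝ)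
    (e : Fin n → ℝ) : ℝ := ∫ ω, ell (g ω) e ∂Q

def qU {n q : ℕ} (M : Matrix (Fin q) (Fin q) ℝ)
    (z : Fin n → Fin q → ℝ) (e : Fin n → ℝ) (β₀ u : Fin q → ℝ) : ℝ :=
  Real.exp (u ⬝ᵥ Wv z e - (u ⬝ᵥ M.mulVec u) / 2) * psi β₀

def JU {Ω : Type*} [MeasurableSpace Ω] (Q : Measure Ω) {n q : ℕ} (M : Matrix (Fin q) (Fin q) ℝ)
    (g : Ω → Fin n → ℝ)
    (z : Fin n → Fin q → ℝ) (e : Fin n → ℝ) (β₀ : Fin q → ℝ) : ℝ≥0∞ :=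
  ∫⁻ u : Fin q → ℝ, ENNReal.ofReal |pU Q g z e β₀ u / ZU Q g e - qU M z e β₀ u|

def Dd {q : ℕ} (T a : ℝ) (u : Fin q → ℝ) : ℝ := Real.exp (T * ‖u‖ - a * ‖u‖ ^ 2)

lemma psi_pos {q : ℕ} (b : Fin q → ℝ) : 0 < psi b := Real.exp_pos _
lemma psi_le {q : ℕ} (b : Fin q → ℝ) : psi b ≤ 1 :=
  Real.exp_le_one_iff.2 (by
    have : 0 ≤ ∑ j, b j ^ 2 := Finset.sum_nonneg fun i _ => sq_nonneg _
    linarith)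

lemma LRf_eq {n q : ℕ} (hn : 1 ≤ n) (g : Fin n → ℝ) (z : Fin n → Fin q → ℝ) (e : Fin n → ℝ)
    (u : Fin q → ℝ) :
    LRf g z e ((Real.sqrt n)⁻¹ • u) =
      ell g e * (Real.exp (u ⬝ᵥ Wv z e - mnq z u / 2) * Real.exp (-uV g z u)) := by
  unfold LRf ell Wv uV mnq
  rw [← Real.exp_add, ← Real.exp_add]
  congr 1
  have hs : (Real.sqrt n)⁻¹ ^ 2 = (n : ℝ)⁻¹ := by
    rw [inv_pow, Real.sq_sqrt (by positivity)]
  rw [dotProduct_smul, dotProduct_sum, ← hs, smul_eq_mul]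
  simp only [dotProduct_smul, smul_eq_mul]
  simp only [Finset.mul_sum]
  rw [Finset.sum_div, ← Finset.sum_sub_distrib, ← sub_eq_add_neg, ← Finset.sum_sub_distrib,
    ← Finset.sum_add_distrib]
  refine Finset.sum_congr rfl fun i _ => ?_
  rw [dotProduct_comm u (z i)]
  ring

lemma quad_le (e f : ℝ) : e * f - f ^ 2 / 2 ≤ e ^ 2 / 2 := by nlinarith [sq_nonneg (e - f)]

lemma LRf_le {n q : ℕ} (g : Fin n → ℝ) (z : Fin n → Fin q → ℝ) (e : Fin n → ℝ) (b : Fin q → ℝ) :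
    LRf g z e b ≤ Real.exp (∑ i, e i ^ 2 / 2) :=
  Real.exp_le_exp.2 (Finset.sum_le_sum fun i _ => quad_le _ _)

lemma ell_le {n : ℕ} (g : Fin n → ℝ) (e : Fin n → ℝ) :
    ell g e ≤ Real.exp (∑ i, e i ^ 2 / 2) :=
  Real.exp_le_exp.2 (Finset.sum_le_sum fun i _ => quad_le _ _)

lemma LRf_pos {n q : ℕ} (g : Fin n → ℝ) (z : Fin n → Fin q → ℝ) (e : Fin n → ℝ) (b : Fin q → ℝ) :
    0 < LRf g z e b := Real.exp_pos _
lemma ell_pos {n : ℕ} (g : Fin n → ℝ) (e : Fin n → ℝ) : 0 < ell g e := Real.exp_pos _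

lemma LRf_meas {n q : ℕ} : Measurable (fun w : (Fin n → ℝ) × (Fin n → Fin q → ℝ) × (Fin n → ℝ) ×
    (Fin q → ℝ) => LRf w.1 w.2.1 w.2.2.1 w.2.2.2) := by
  unfold LRf dotProduct
  fun_prop

lemma ell_meas {n : ℕ} : Measurable (fun w : (Fin n → ℝ) × (Fin n → ℝ) => ell w.1 w.2) := by
  unfold ell
  fun_prop

lemma uV_meas {n q : ℕ} : Measurable (fun w : (Fin n → ℝ) × (Fin n → Fin q → ℝ) ×
    (Fin q → ℝ) => uV w.1 w.2.1 w.2.2) := by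
  unfold uV dotProduct
  fun_prop

lemma LRf_int {Ω : Type*} [MeasurableSpace Ω] (Q : Measure Ω) [IsFiniteMeasure Q] {n q : ℕ}
    (g : Ω → Fin n → ℝ) (hg : Measurable g)
    (z : Fin n → Fin q → ℝ) (e : Fin n → ℝ) (b : Fin q → ℝ) :
    Integrable (fun ω => LRf (g ω) z e b) Q := by
  refine Integrable.of_bound (C := Real.exp (∑ i, e i ^ 2 / 2)) ?_ ?_
  · have : Measurable (fun ω => LRf (g ω) z e b) :=
      LRf_meas.comp (hg.prodMk (measurable_const (a := (z, e, b))))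
    exact this.aestronglyMeasurable
  · refine Eventually.of_forall fun ω => ?_
    rw [Real.norm_of_nonneg (LRf_pos _ _ _ _).le]
    exact LRf_le _ _ _ _

lemma ell_int {Ω : Type*} [MeasurableSpace Ω] (Q : Measure Ω) [IsFiniteMeasure Q] {n : ℕ}
    (g : Ω → Fin n → ℝ) (hg : Measurable g) (e : Fin n → ℝ) :
    Integrable (fun ω => ell (g ω) e) Q := by
  refine Integrable.of_bound (C := Real.exp (∑ i, e i ^ 2 / 2)) ?_ ?_
  · have : Measurable (fun ω => ell (g ω) e) :=
      ell_meas.comp (hg.prodMk measurable_const)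
    exact this.aestronglyMeasurable
  · refine Eventually.of_forall fun ω => ?_
    rw [Real.norm_of_nonneg (ell_pos _ _).le]
    exact ell_le _ _

lemma exp_neg_lip {a b m : ℝ} (ha : m ≤ a) (hb : m ≤ b) :
    |Real.exp (-a) - Real.exp (-b)| ≤ |a - b| * Real.exp (-m) := by
  wlog h : a ≤ b generalizing a b
  · rw [abs_sub_comm, abs_sub_comm a b]; exact this hb ha (le_of_not_ge h)
  have h1 : Real.exp (-b) = Real.exp (-a) * Real.exp (-(b - a)) := by
    rw [← Real.exp_add]; ring_nf
  have h2 := Real.add_one_le_exp (-(b - a))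
  have h3 : Real.exp (-(b-a)) ≤ 1 := Real.exp_le_one_iff.2 (by linarith)
  have h4 : Real.exp (-a) ≤ Real.exp (-m) := Real.exp_le_exp.2 (by linarith)
  rw [h1, abs_of_nonneg (by nlinarith [Real.exp_pos (-a)]), abs_of_nonpos (by linarith)]
  calc Real.exp (-a) - Real.exp (-a) * Real.exp (-(b - a))
      = (1 - Real.exp (-(b-a))) * Real.exp (-a) := by ring
    _ ≤ -(a - b) * Real.exp (-m) := by
      apply mul_le_mul (by linarith) h4 (Real.exp_pos _).le (by linarith)

lemma psi_diff {q : ℕ} (β₀ b : Fin q → ℝ) (r : ℝ) (hr : 0 ≤ r) (hb : ∀ j, |b j| ≤ r) :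
    |(∑ j, (β₀ + b) j ^ 2) / 2 - (∑ j, β₀ j ^ 2) / 2| ≤ (∑ j, |β₀ j|) * r + q * r ^ 2 / 2 := by
  rw [← sub_div, ← Finset.sum_sub_distrib, Finset.sum_div]
  refine (Finset.abs_sum_le_sum_abs _ _).trans ?_
  have : (∑ j, |β₀ j|) * r + q * r ^ 2 / 2 = ∑ j : Fin q, (|β₀ j| * r + r ^ 2 / 2) := by
    rw [Finset.sum_add_distrib, ← Finset.sum_mul]; simp; ring
  rw [this]
  refine Finset.sum_le_sum fun j _ => ?_
  have e : ((β₀ + b) j ^ 2 - β₀ j ^ 2) / 2 = β₀ j * b j + (b j) ^ 2 / 2 := by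
    simp only [Pi.add_apply]; ring
  rw [e]
  refine (abs_add_le _ _).trans ?_
  rw [abs_mul, abs_of_nonneg (by positivity : 0 ≤ (b j) ^ 2 / 2)]
  have := hb j
  have h2 : b j ^ 2 ≤ r ^ 2 := sq_le_sq' (by linarith [neg_abs_le (b j)]) ((le_abs_self _).trans this)
  gcongr

set_option maxHeartbeats 1600000 in
lemma pw_bound {Ω : Type*} [MeasurableSpace Ω] (Q : Measure Ω) [IsProbabilityMeasure Q] {n q : ℕ}
    (hn : 1 ≤ n) (M : Matrix (Fin q) (Fin q) ℝ) (g : Ω → Fin n → ℝ) (hg : Measurable g)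
    (z : Fin n → Fin q → ℝ) (e : Fin n → ℝ) (β₀ u : Fin q → ℝ)
    (S : Set Ω) (hS : MeasurableSet S) (lam ϱ T s τ ζ : ℝ) (hlam : 0 < lam)
    (hϱ : ϱ ≤ lam / 2) (hs : 0 ≤ s) (hsτ : s + 2 * s ^ 2 / lam ≤ τ ^ 2 / 4)
    (hM : lam * ‖u‖ ^ 2 ≤ u ⬝ᵥ M.mulVec u)
    (e2 : |mnq z u - u ⬝ᵥ M.mulVec u| ≤ ϱ * ‖u‖ ^ 2)
    (e3 : |u ⬝ᵥ Wv z e| ≤ T * ‖u‖)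
    (e4 : ∀ ω ∈ S, |∑ i, e i * g ω i| ≤ s * n)
    (e4' : ∀ ω ∈ S, |∑ i, g ω i * (z i ⬝ᵥ u)| ≤ s * n * ‖u‖)
    (hζ : 0 < ζ) (hZ : ζ ≤ ZU Q g e) :
    |pU Q g z e β₀ u / ZU Q g e - qU M z e β₀ u| ≤
      (∫ ω in Sᶜ, LRf (g ω) z e ((Real.sqrt n)⁻¹ • u) ∂Q) * psi (β₀ + (Real.sqrt n)⁻¹ • u) / ζ
      + Dd T (lam / 8) u * (2 * Real.exp (-(n * τ ^ 2 / 4)) / ζ + (∫ ω in Sᶜ, ell (g ω) e ∂Q) / ζ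
        + (ϱ / 2 * ‖u‖ ^ 2 + (∑ j, |β₀ j|) * ((Real.sqrt n)⁻¹ * ‖u‖)
            + q * ((Real.sqrt n)⁻¹ * ‖u‖) ^ 2 / 2))
      + Dd T (lam / 8) u * ((∫ ω in S ∩ {ω | ∑ i, g ω i ^ 2 ≤ n * τ ^ 2},
          ell (g ω) e * |Real.exp (-uV (g ω) z u) - 1| ∂Q) / ZU Q g e) := by
  set t := ‖u‖ with ht
  have ht0 : 0 ≤ t := norm_nonneg _
  set Z := ZU Q g e with hZdef
  have hZ0 : 0 < Z := hζ.trans_le hZ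
  set G := S ∩ {ω | ∑ i, g ω i ^ 2 ≤ n * τ ^ 2} with hG
  have hGm : MeasurableSet G := hS.inter (measurableSet_le (by fun_prop) measurable_const)
  set H := S \ G with hH
  have hHm : MeasurableSet H := hS.diff hGm
  set f := fun ω => LRf (g ω) z e ((Real.sqrt n)⁻¹ • u) with hf
  set l := fun ω => ell (g ω) e with hl
  have fi : Integrable f Q := LRf_int Q g hg z e _
  have li : Integrable l Q := ell_int Q g hg e
  have split : ∀ k : Ω → ℝ, Integrable k Q →
      ∫ ω, k ω ∂Q = (∫ ω in Sᶜ, k ω ∂Q) + (∫ ω in H, k ω ∂Q) + ∫ ω in G, k ω ∂Q := by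
    intro k hk
    rw [← integral_add_compl hS hk]
    have : ∫ ω in S, k ω ∂Q = (∫ ω in H, k ω ∂Q) + ∫ ω in G, k ω ∂Q := by
      rw [← setIntegral_union (Set.disjoint_sdiff_left) hGm hk.integrableOn hk.integrableOn,
        Set.diff_union_of_subset Set.inter_subset_left]
    rw [this]; ring
  set ψn := psi (β₀ + (Real.sqrt n)⁻¹ • u) with hψn
  have hψ0 : 0 < ψn := psi_pos _
  have hψ1 : ψn ≤ 1 := psi_le _
  set w := u ⬝ᵥ Wv z e with hw
  set mn := mnq z u with hmn
  set mm := u ⬝ᵥ M.mulVec u with hmm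
  set A := Real.exp (w - mn / 2) with hA
  have e2' := abs_le.1 e2
  have e3' := abs_le.1 e3
  have ht2 : 0 ≤ t ^ 2 := sq_nonneg _
  have hmn2 : lam / 2 * t ^ 2 ≤ mn := by nlinarith
  set D := Dd T (lam / 8) u with hD
  have hD0 : 0 < D := Real.exp_pos _
  have hDA : A ≤ D := by
    apply Real.exp_le_exp.2
    nlinarith
  have hA0 : 0 < A := Real.exp_pos _
  have ff : ∀ ω, f ω = l ω * (A * Real.exp (-uV (g ω) z u)) := fun ω => LRf_eq hn _ _ _ _
  -- bounds on H
  have hn0 : (0:ℝ) < n := by exact_mod_cast hn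
  have hsum : ∀ ω, l ω = Real.exp (∑ i, e i * g ω i - (∑ i, g ω i ^ 2) / 2) := by
    intro ω; simp only [hl, ell]; rw [Finset.sum_sub_distrib, Finset.sum_div]
  have hq0 : 0 ≤ 2 * s ^ 2 / lam := by positivity
  have lH : ∀ ω ∈ H, l ω ≤ Real.exp (n * s - n * τ ^ 2 / 2) := by
    intro ω hω
    have h1 : n * τ ^ 2 < ∑ i, g ω i ^ 2 := by
      by_contra h; exact hω.2 ⟨hω.1, le_of_not_gt h⟩
    have h2 := (abs_le.1 (e4 ω hω.1)).2
    rw [hsum]; apply Real.exp_le_exp.2; linarith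
  have lH' : ∀ ω ∈ H, l ω ≤ Real.exp (-(n * τ ^ 2 / 4)) := by
    intro ω hω
    refine (lH ω hω).trans (Real.exp_le_exp.2 ?_)
    nlinarith
  have fH : ∀ ω ∈ H, f ω ≤ Real.exp (-(n * τ ^ 2 / 4)) * D := by
    intro ω hω
    have h2 : -uV (g ω) z u ≤ s * Real.sqrt n * t := by
      have h3 := (abs_le.1 (e4' ω hω.1)).1
      have h4 : uV (g ω) z u = (Real.sqrt n)⁻¹ * ∑ i, g ω i * (z i ⬝ᵥ u) := by
        unfold uV; rw [Finset.mul_sum]; exact Finset.sum_congr rfl fun i _ => by ring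
      have hsq : 0 < Real.sqrt n := Real.sqrt_pos.2 hn0
      rw [h4, ← mul_neg, inv_mul_le_iff₀ hsq]
      have h5 : Real.sqrt n * Real.sqrt n = n := Real.mul_self_sqrt hn0.le
      calc -∑ i, g ω i * (z i ⬝ᵥ u) ≤ s * n * t := by linarith
        _ = Real.sqrt n * (s * Real.sqrt n * t) := by linear_combination (-(s * t)) * h5
    have h6 : s * Real.sqrt n * t ≤ lam / 8 * t ^ 2 + n * (2 * s ^ 2 / lam) := by
      have h5 : Real.sqrt n ^ 2 = n := Real.sq_sqrt hn0.le
      have h7 : lam / 8 * t ^ 2 + n * (2 * s ^ 2 / lam) - s * Real.sqrt n * t =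
          (lam / 8) * (t - 4 * (s * Real.sqrt n) / lam) ^ 2 := by
        field_simp
        linear_combination (-16 * s ^ 2) * h5
      have : 0 ≤ (lam / 8) * (t - 4 * (s * Real.sqrt n) / lam) ^ 2 := by positivity
      linarith
    rw [ff]
    calc l ω * (A * Real.exp (-uV (g ω) z u))
        ≤ Real.exp (n * s - n * τ ^ 2 / 2) * (A * Real.exp (s * Real.sqrt n * t)) := by
          gcongr
          exact lH ω hω
      _ = Real.exp (n * s - n * τ ^ 2 / 2 + (w - mn / 2 + s * Real.sqrt n * t)) := by
          rw [hA, ← Real.exp_add, ← Real.exp_add]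
      _ ≤ Real.exp (-(n * τ ^ 2 / 4) + (T * t - lam / 8 * t ^ 2)) := by
          apply Real.exp_le_exp.2
          have : (n:ℝ) * (s + 2 * s ^ 2 / lam) ≤ n * (τ ^ 2 / 4) := by gcongr
          nlinarith
      _ = _ := by rw [Real.exp_add]; rfl
  set E4 := Real.exp (-(n * τ ^ 2 / 4)) with hE4
  have hE40 : 0 < E4 := Real.exp_pos _
  have hQH : Q.real H ≤ 1 := measureReal_le_one
  have IH : ∀ (k : Ω → ℝ) (c : ℝ), Integrable k Q → 0 ≤ c → (∀ ω ∈ H, k ω ≤ c) →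
      ∫ ω in H, k ω ∂Q ≤ c := by
    intro k c hk hc h
    calc ∫ ω in H, k ω ∂Q ≤ ∫ ω in H, c ∂Q :=
          setIntegral_mono_on hk.integrableOn (integrableOn_const (by simp)) hHm h
      _ = Q.real H * c := by simp
      _ ≤ c := by nlinarith
  have IfH := IH f _ fi (by positivity) fH
  have IlH := IH l _ li (by positivity) lH'
  -- lower bounds
  have nn : ∀ (R : Set Ω) (k : Ω → ℝ), (∀ ω, 0 ≤ k ω) → 0 ≤ ∫ ω in R, k ω ∂Q :=
    fun R k hk => integral_nonneg hk
  have f0 : ∀ ω, 0 ≤ f ω := fun ω => (LRf_pos _ _ _ _).le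
  have l0 : ∀ ω, 0 ≤ l ω := fun ω => (ell_pos _ _).le
  -- G part
  set v := fun ω => l ω * Real.exp (-uV (g ω) z u) with hv
  have fv : ∀ ω, f ω = A * v ω := fun ω => by rw [ff]; simp only [hv]; ring
  have vi : Integrable v Q := by
    have : v = fun ω => A⁻¹ * f ω := by
      funext ω; rw [fv]; field_simp
    rw [this]; exact fi.const_mul _
  set d := fun ω => l ω * |Real.exp (-uV (g ω) z u) - 1| with hd
  have dv : ∀ ω, d ω = |v ω - l ω| := by
    intro ω
    have : v ω - l ω = l ω * (Real.exp (-uV (g ω) z u) - 1) := by simp only [hv]; ring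
    rw [this, abs_mul, abs_of_nonneg (l0 ω)]
  have di : Integrable d Q := by
    have : d = fun ω => |v ω - l ω| := funext dv
    rw [this]; exact (vi.sub li).abs
  have GG : |(∫ ω in G, v ω ∂Q) - Z| ≤ (∫ ω in G, d ω ∂Q) + (E4 + ∫ ω in Sᶜ, l ω ∂Q) := by
    have h1 : Z = (∫ ω in Sᶜ, l ω ∂Q) + (∫ ω in H, l ω ∂Q) + ∫ ω in G, l ω ∂Q := split l li
    have h2 : |(∫ ω in G, v ω ∂Q) - ∫ ω in G, l ω ∂Q| ≤ ∫ ω in G, d ω ∂Q := by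
      rw [← integral_sub vi.integrableOn li.integrableOn]
      refine (abs_integral_le_integral_abs).trans (le_of_eq ?_)
      simp_rw [dv]
    have h3 := nn Sᶜ l l0
    have h4 := nn H l l0
    rw [abs_le] at h2 ⊢
    constructor <;> linarith
  -- t5
  have t5 : |A * ψn - qU M z e β₀ u| ≤ D * (ϱ / 2 * t ^ 2 + (∑ j, |β₀ j|) * ((Real.sqrt n)⁻¹ * t)
            + q * ((Real.sqrt n)⁻¹ * t) ^ 2 / 2) := by
    have hb : ∀ j, |((Real.sqrt n)⁻¹ • u) j| ≤ (Real.sqrt n)⁻¹ * t := by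
      intro j
      rw [Pi.smul_apply, smul_eq_mul, abs_mul, abs_of_nonneg (by positivity)]
      gcongr
      exact norm_le_pi_norm u j
    have hdiff := psi_diff β₀ ((Real.sqrt n)⁻¹ • u) _ (by positivity) hb
    set aa := (∑ j, (β₀ + (Real.sqrt n)⁻¹ • u) j ^ 2) / 2 with haa
    set bb := (∑ j, β₀ j ^ 2) / 2 with hbb
    have aa0 : 0 ≤ aa := div_nonneg (Finset.sum_nonneg fun i _ => sq_nonneg _) (by norm_num)
    have bb0 : 0 ≤ bb := div_nonneg (Finset.sum_nonneg fun i _ => sq_nonneg _) (by norm_num)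
    have h1 : A * ψn - qU M z e β₀ u =
        Real.exp w * (Real.exp (-(mn / 2 + aa)) - Real.exp (-(mm / 2 + bb))) := by
      rw [mul_sub, ← Real.exp_add, ← Real.exp_add]
      unfold qU
      rw [hA, hψn]
      unfold psi
      rw [← Real.exp_add, ← Real.exp_add, haa, hbb]
      congr 2 <;> ring
    have h2 := exp_neg_lip (a := mn / 2 + aa) (b := mm / 2 + bb) (m := lam / 8 * t ^ 2)
      (by nlinarith) (by nlinarith)
    rw [h1, abs_mul, abs_of_nonneg (Real.exp_pos _).le]
    have h3 : |mn / 2 + aa - (mm / 2 + bb)| ≤ ϱ / 2 * t ^ 2 + ((∑ j, |β₀ j|) * ((Real.sqrt n)⁻¹ * t)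
            + q * ((Real.sqrt n)⁻¹ * t) ^ 2 / 2) := by
      rw [abs_le] at hdiff ⊢
      constructor <;> linarith
    calc Real.exp w * |Real.exp (-(mn / 2 + aa)) - Real.exp (-(mm / 2 + bb))|
        ≤ Real.exp (T * t) * ((ϱ / 2 * t ^ 2 + ((∑ j, |β₀ j|) * ((Real.sqrt n)⁻¹ * t)
            + q * ((Real.sqrt n)⁻¹ * t) ^ 2 / 2)) * Real.exp (-(lam / 8 * t ^ 2))) := by
          gcongr
          · linarith
          · exact h2.trans (by gcongr)
      _ = _ := by
          have : D = Real.exp (T * t) * Real.exp (-(lam / 8 * t ^ 2)) := by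
            rw [← Real.exp_add]; rfl
          rw [this]; ring
  -- assemble
  have hp : pU Q g z e β₀ u = ((∫ ω in Sᶜ, f ω ∂Q) + (∫ ω in H, f ω ∂Q) + A * ∫ ω in G, v ω ∂Q) * ψn := by
    have : ∫ ω in G, f ω ∂Q = A * ∫ ω in G, v ω ∂Q := by
      rw [← integral_const_mul]; simp_rw [fv]
    rw [← this, ← split f fi]; rfl
  have hdec : pU Q g z e β₀ u / Z - qU M z e β₀ u =
      (∫ ω in Sᶜ, f ω ∂Q) * ψn / Z + (∫ ω in H, f ω ∂Q) * ψn / Z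
        + A * ψn * (((∫ ω in G, v ω ∂Q) - Z) / Z) + (A * ψn - qU M z e β₀ u) := by
    rw [hp]; field_simp; ring
  rw [hdec]
  have b1 : |(∫ ω in Sᶜ, f ω ∂Q) * ψn / Z| ≤ (∫ ω in Sᶜ, f ω ∂Q) * ψn / ζ := by
    have := nn Sᶜ f f0
    rw [abs_of_nonneg (by positivity)]
    gcongr
  have b2 : |(∫ ω in H, f ω ∂Q) * ψn / Z| ≤ D * (E4 / ζ) := by
    have := nn H f f0
    rw [abs_of_nonneg (by positivity)]
    calc (∫ ω in H, f ω ∂Q) * ψn / Z ≤ (E4 * D) * 1 / ζ := by gcongr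
      _ = _ := by ring
  have b3 : |A * ψn * (((∫ ω in G, v ω ∂Q) - Z) / Z)| ≤
      D * ((∫ ω in G, d ω ∂Q) / Z + (E4 / ζ + (∫ ω in Sᶜ, l ω ∂Q) / ζ)) := by
    rw [abs_mul, abs_div, abs_of_pos hZ0, abs_of_pos (by positivity)]
    have h3 := nn Sᶜ l l0
    calc A * ψn * (|(∫ ω in G, v ω ∂Q) - Z| / Z)
        ≤ D * 1 * (((∫ ω in G, d ω ∂Q) + (E4 + ∫ ω in Sᶜ, l ω ∂Q)) / Z) := by gcongr
      _ = D * ((∫ ω in G, d ω ∂Q) / Z + (E4 + ∫ ω in Sᶜ, l ω ∂Q) / Z) := by ring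
      _ ≤ D * ((∫ ω in G, d ω ∂Q) / Z + (E4 + ∫ ω in Sᶜ, l ω ∂Q) / ζ) := by gcongr
      _ = _ := by ring
  refine (abs_add_le _ _).trans ?_
  refine (add_le_add (abs_add_le _ _) le_rfl).trans ?_
  refine (add_le_add (add_le_add (abs_add_le _ _) le_rfl) le_rfl).trans ?_
  refine (add_le_add (add_le_add (add_le_add b1 b2) b3) t5).trans (le_of_eq ?_)
  ring

open ProbabilityTheory in
lemma subG_z {q : ℕ} (Pz : Measure (Fin q → ℝ)) [IsProbabilityMeasure Pz] (Bz : ℝ)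
    (hb : ∀ᵐ z ∂Pz, ∑ j, |z j| ≤ Bz) (hmean : ∀ j, ∫ z, z j ∂Pz = 0) (u : Fin q → ℝ) :
    HasSubgaussianMGF (fun z => z ⬝ᵥ u) (((Bz * ‖u‖) ^ 2).toNNReal) Pz := by
  have hz : ∀ᵐ z ∂Pz, z ⬝ᵥ u ∈ Set.Icc (-(Bz * ‖u‖)) (Bz * ‖u‖) := by
    filter_upwards [hb] with z h
    rw [Set.mem_Icc, ← abs_le]
    unfold dotProduct
    refine (Finset.abs_sum_le_sum_abs _ _).trans ?_
    calc ∑ j, |z j * u j| ≤ ∑ j, |z j| * ‖u‖ := by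
          refine Finset.sum_le_sum fun j _ => ?_
          rw [abs_mul]; gcongr; exact norm_le_pi_norm u j
      _ = (∑ j, |z j|) * ‖u‖ := by rw [Finset.sum_mul]
      _ ≤ _ := by gcongr
  have hint : ∀ j, Integrable (fun z : Fin q → ℝ => z j) Pz := by
    intro j
    refine Integrable.of_bound (C := Bz) (by exact (measurable_pi_apply j).aestronglyMeasurable) ?_
    filter_upwards [hb] with z h
    exact (Finset.single_le_sum (f := fun j => |z j|) (fun i _ => abs_nonneg _) (Finset.mem_univ j)).trans h
  have h0 : ∫ z, z ⬝ᵥ u ∂Pz = 0 := by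
    unfold dotProduct
    rw [integral_finsetSum _ fun j _ => (hint j).mul_const _]
    simp [integral_mul_const, hmean]
  have hm : AEMeasurable (fun z : Fin q → ℝ => z ⬝ᵥ u) Pz := by
    have : Measurable (fun z : Fin q → ℝ => z ⬝ᵥ u) := by unfold dotProduct; fun_prop
    exact this.aemeasurable
  refine subG_mono (hasSubgaussianMGF_of_mem_Icc_of_integral_eq_zero hm hz h0) ?_
  rw [← NNReal.coe_le_coe, Real.coe_toNNReal _ (sq_nonneg _)]
  push_cast
  rw [Real.norm_eq_abs, div_pow, sq_abs]
  apply le_of_eq; ring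

open ProbabilityTheory in
lemma subG_zz {q : ℕ} (Pz : Measure (Fin q → ℝ)) [IsProbabilityMeasure Pz] (Bz : ℝ) (hBz : 0 ≤ Bz)
    (hb : ∀ᵐ z ∂Pz, ∑ j, |z j| ≤ Bz) (j k : Fin q) :
    HasSubgaussianMGF (fun z : Fin q → ℝ => z j * z k - ∫ z, z j * z k ∂Pz) ((Bz ^ 4).toNNReal) Pz := by
  have hz : ∀ᵐ z ∂Pz, z j * z k ∈ Set.Icc (-(Bz ^ 2)) (Bz ^ 2) := by
    filter_upwards [hb] with z h
    rw [Set.mem_Icc, ← abs_le, abs_mul, sq]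
    have hj : ∀ j, |z j| ≤ Bz := fun j =>
      (Finset.single_le_sum (f := fun j => |z j|) (fun i _ => abs_nonneg _) (Finset.mem_univ j)).trans h
    exact mul_le_mul (hj j) (hj k) (abs_nonneg _) hBz
  have hm : AEMeasurable (fun z : Fin q → ℝ => z j * z k) Pz := by fun_prop
  refine subG_mono (hasSubgaussianMGF_of_mem_Icc hm hz) ?_
  rw [← NNReal.coe_le_coe, Real.coe_toNNReal _ (by positivity)]
  push_cast
  rw [Real.norm_eq_abs, div_pow, sq_abs]
  apply le_of_eq; ring

lemma sect_le {X Y : Type*} [MeasurableSpace X] [MeasurableSpace Y] (μ : Measure X) (ν : Measure Y)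
    [IsProbabilityMeasure μ] [IsProbabilityMeasure ν] (E : Set (X × Y)) (hE : MeasurableSet E)
    (γ : ℝ≥0∞) (h : ∀ᵐ x ∂μ, ν {y | (x, y) ∈ E} ≤ γ) : (μ.prod ν) E ≤ γ := by
  rw [Measure.prod_apply hE]
  calc ∫⁻ x, ν (Prod.mk x ⁻¹' E) ∂μ ≤ ∫⁻ _, γ ∂μ := lintegral_mono_ae h
    _ = γ := by simp

lemma sect_le' {X Y : Type*} [MeasurableSpace X] [MeasurableSpace Y] (μ : Measure X) (ν : Measure Y)
    [IsProbabilityMeasure μ] [IsProbabilityMeasure ν] (E : Set (X × Y)) (hE : MeasurableSet E)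
    (γ : ℝ≥0∞) (h : ∀ᵐ y ∂ν, μ {x | (x, y) ∈ E} ≤ γ) : (μ.prod ν) E ≤ γ := by
  rw [Measure.prod_apply_symm hE]
  calc ∫⁻ y, μ ((fun x => (x, y)) ⁻¹' E) ∂ν ≤ ∫⁻ _, γ ∂ν := lintegral_mono_ae h
    _ = γ := by simp

lemma ae_pi_of {E : Type*} [MeasurableSpace E] (ν : Measure E) [IsProbabilityMeasure ν] {n : ℕ}
    (P : E → Prop) (h : ∀ᵐ z ∂ν, P z) :
    ∀ᵐ z ∂(Measure.pi fun _ : Fin n => ν), ∀ i, P (z i) := by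
  rw [ae_all_iff]
  intro i
  exact (Measure.quasiMeasurePreserving_eval (μ := fun _ : Fin n => ν) i).ae h

section events
variable {n q : ℕ} (Pz : Measure (Fin q → ℝ)) [IsProbabilityMeasure Pz] (Bz : ℝ)

abbrev Pdat (n : ℕ) {q : ℕ} (Pz : Measure (Fin q → ℝ)) : Measure ((Fin n → Fin q → ℝ) × (Fin n → ℝ)) :=
  (Measure.pi fun _ : Fin n => Pz).prod (Measure.pi fun _ : Fin n => gam)

/-- good z -/
lemma ev0 (hb : ∀ᵐ z ∂Pz, ∑ j, |z j| ≤ Bz) :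
    Pdat n Pz {w | ¬ ∀ i, ∑ j, |w.1 i j| ≤ Bz} = 0 := by
  have := ae_pi_of (n := n) Pz _ hb
  have h2 : ∀ᵐ w ∂(Pdat n Pz), ∀ i, ∑ j, |w.1 i j| ≤ Bz :=
    (Measure.quasiMeasurePreserving_fst).ae this
  exact h2

lemma ev1 (Λ : ℝ) (hΛ : 0 < Λ) (hn : 1 ≤ n) :
    Pdat n Pz {w | Λ * n < ∑ i, w.2 i ^ 2} ≤ ENNReal.ofReal (1 / Λ) := by
  have hn0 : (0:ℝ) < n := by exact_mod_cast hn
  refine sect_le _ _ _ (measurableSet_lt (by fun_prop) (by fun_prop)) _ (Eventually.of_forall fun z => ?_)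
  have h1 := meas_ge_le_lintegral_div (μ := Measure.pi fun _ : Fin n => gam)
    (f := fun e => ENNReal.ofReal (∑ i, e i ^ 2)) (ε := ENNReal.ofReal (Λ * n))
    (Measurable.aemeasurable (by fun_prop))
    (by simp; positivity) (by simp)
  refine (measure_mono ?_).trans (h1.trans ?_)
  · intro e he
    exact ENNReal.ofReal_le_ofReal (le_of_lt he)
  · rw [lint_sq, ← ENNReal.ofReal_natCast, ← ENNReal.ofReal_div_of_pos (by positivity)]
    apply ENNReal.ofReal_le_ofReal
    apply le_of_eq; field_simp

lemma ev2 (hBz : 0 ≤ Bz) (hb : ∀ᵐ z ∂Pz, ∑ j, |z j| ≤ Bz) (ϱ : ℝ) (hϱ : 0 ≤ ϱ) (hn : 1 ≤ n) (j k : Fin q) :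
    Pdat n Pz {w | ϱ < |∑ i, (n:ℝ)⁻¹ * (w.1 i j * w.1 i k - ∫ z, z j * z k ∂Pz)|} ≤
      ENNReal.ofReal (2 * Real.exp (-ϱ ^ 2 * n / (2 * Bz ^ 4))) := by
  have hn0 : (0:ℝ) < n := by exact_mod_cast hn
  refine sect_le' _ _ _ (measurableSet_lt (by fun_prop) (by fun_prop)) _ (Eventually.of_forall fun z => ?_)
  have h := subG_pi (n := n) Pz (subG_zz Pz Bz hBz hb j k) (fun _ => (n:ℝ)⁻¹) (Bz ^ 4 / n).toNNReal (by
    rw [Real.coe_toNNReal _ (by positivity), Real.coe_toNNReal _ (by positivity)]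
    simp; apply le_of_eq; field_simp)
  refine (subG_tail h hϱ).trans (le_of_eq ?_)
  rw [Real.coe_toNNReal _ (by positivity)]
  congr 3
  field_simp

lemma ev3 (hBz : 0 ≤ Bz) (hb : ∀ᵐ z ∂Pz, ∑ j, |z j| ≤ Bz) (T : ℝ) (hT : 0 ≤ T) (hn : 1 ≤ n) (j : Fin q) :
    Pdat n Pz {w | T < |Wv w.1 w.2 j|} ≤
      ENNReal.ofReal (2 * Real.exp (-T ^ 2 / (2 * Bz ^ 2))) := by
  have hn0 : (0:ℝ) < n := by exact_mod_cast hn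
  have hm : Measurable fun w : (Fin n → Fin q → ℝ) × (Fin n → ℝ) => Wv w.1 w.2 j := by
    unfold Wv; simp only [Pi.smul_apply, Finset.sum_apply, smul_eq_mul]; fun_prop
  refine sect_le _ _ _ (measurableSet_lt (by fun_prop) hm.abs) _ ?_
  filter_upwards [ae_pi_of (n := n) Pz _ hb] with z hz
  have hj : ∀ i, |z i j| ≤ Bz := fun i =>
      (Finset.single_le_sum (f := fun j => |z i j|) (fun i _ => abs_nonneg _) (Finset.mem_univ j)).trans (hz i)
  have h := subG_pi (n := n) gam subG_gauss (fun i => (Real.sqrt n)⁻¹ * z i j) (Bz ^ 2).toNNReal (by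
    rw [Real.coe_toNNReal _ (by positivity)]
    simp only [mul_pow, inv_pow, Real.sq_sqrt hn0.le, NNReal.coe_one, one_mul]
    calc ∑ i, (n:ℝ)⁻¹ * z i j ^ 2 ≤ ∑ i : Fin n, (n:ℝ)⁻¹ * Bz ^ 2 := by
          refine Finset.sum_le_sum fun i _ => ?_
          exact mul_le_mul_of_nonneg_left (sq_le_sq.2 ((hj i).trans (le_abs_self _))) (by positivity)
      _ = Bz ^ 2 := by simp; field_simp)
  have h2 := subG_tail h hT
  rw [Real.coe_toNNReal _ (by positivity)] at h2
  refine le_trans (le_of_eq ?_) h2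
  congr 1
  ext e
  simp only [Set.mem_setOf_eq, Wv, Pi.smul_apply, Finset.sum_apply, smul_eq_mul, Finset.mul_sum]
  refine iff_of_eq ?_
  congr 3
  ext i; ring

lemma ev4e (a : Fin n → ℝ) (G : ℝ) (hG : 0 < G) (ha : ∀ i, |a i| ≤ G) (s : ℝ) (hs : 0 ≤ s) (hn : 1 ≤ n) :
    Pdat n Pz {w | s * n < |∑ i, a i * w.2 i|} ≤ ENNReal.ofReal (2 * Real.exp (-(s ^ 2 / (2 * G ^ 2)) * n)) := by
  have hn0 : (0:ℝ) < n := by exact_mod_cast hn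
  refine sect_le _ _ _ (measurableSet_lt (by fun_prop) (by fun_prop)) _ (Eventually.of_forall fun z => ?_)
  have h := subG_pi (n := n) gam subG_gauss a (n * G ^ 2).toNNReal (by
    rw [Real.coe_toNNReal _ (by positivity)]
    simp only [NNReal.coe_one, one_mul]
    calc ∑ i, a i ^ 2 ≤ ∑ i : Fin n, G ^ 2 := by
          refine Finset.sum_le_sum fun i _ => ?_
          exact sq_le_sq.2 ((ha i).trans (le_abs_self _))
      _ = _ := by simp)
  refine (subG_tail h (by positivity : 0 ≤ s * n)).trans (le_of_eq ?_)
  rw [Real.coe_toNNReal _ (by positivity)]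
  congr 3
  field_simp

lemma ev4z (hBz : 0 < Bz) (hb : ∀ᵐ z ∂Pz, ∑ j, |z j| ≤ Bz) (hmean : ∀ j, ∫ z, z j ∂Pz = 0)
    (a : Fin n → ℝ) (G : ℝ) (hG : 0 < G) (ha : ∀ i, |a i| ≤ G) (s : ℝ) (hs : 0 ≤ s) (hn : 1 ≤ n) (j : Fin q) :
    Pdat n Pz {w | s * n < |∑ i, a i * w.1 i j|} ≤
      ENNReal.ofReal (2 * Real.exp (-(s ^ 2 / (2 * (Bz * G) ^ 2)) * n)) := by
  have hn0 : (0:ℝ) < n := by exact_mod_cast hn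
  refine sect_le' _ _ _ (measurableSet_lt (by fun_prop) (by fun_prop)) _ (Eventually.of_forall fun z => ?_)
  have h0 := subG_z Pz Bz hb hmean (Pi.single j 1)
  have hnorm : ‖(Pi.single j 1 : Fin q → ℝ)‖ = 1 := by rw [Pi.norm_single]; simp
  rw [hnorm] at h0
  have h := subG_pi (n := n) Pz h0 a (n * (Bz * G) ^ 2).toNNReal (by
    rw [Real.coe_toNNReal _ (by positivity), Real.coe_toNNReal _ (by positivity)]
    calc (Bz * 1) ^ 2 * ∑ i, a i ^ 2 ≤ (Bz * 1) ^ 2 * ∑ i : Fin n, G ^ 2 := by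
          refine mul_le_mul_of_nonneg_left (Finset.sum_le_sum fun i _ => ?_) (sq_nonneg _)
          exact sq_le_sq.2 ((ha i).trans (le_abs_self _))
      _ = _ := by simp; ring)
  have h2 := (subG_tail h (by positivity : 0 ≤ s * n))
  simp only [dotProduct_single, mul_one] at h2
  refine h2.trans (le_of_eq ?_)
  rw [Real.coe_toNNReal _ (by positivity)]
  congr 3
  field_simp

end events

lemma psi_prod {q : ℕ} (b : Fin q → ℝ) : psi b = ∏ j, Real.exp (-(1/2) * b j ^ 2) := by
  unfold psi
  rw [← Real.exp_sum, ← Finset.mul_sum]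
  congr 1; ring

lemma psi_integrable (q : ℕ) : Integrable (psi (q := q)) := by
  have : Integrable (fun b : Fin q → ℝ => ∏ j, Real.exp (-(1/2) * b j ^ 2)) :=
    Integrable.fintype_prod (f := fun _ t => Real.exp (-(1/2) * t ^ 2))
      (fun _ => integrable_exp_neg_mul_sq (by norm_num))
  refine this.congr (Eventually.of_forall fun b => (psi_prod b).symm)

lemma psi_meas {q : ℕ} : Measurable (psi (q := q)) := by
  unfold psi; fun_prop

lemma psi_shift {q n : ℕ} (hn : 1 ≤ n) (β₀ : Fin q → ℝ) :
    ∫⁻ u : Fin q → ℝ, ENNReal.ofReal (psi (β₀ + (Real.sqrt n)⁻¹ • u)) =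
      ENNReal.ofReal (Real.sqrt n ^ q * ∫ b : Fin q → ℝ, psi b) := by
  have hn0 : (0:ℝ) < n := by exact_mod_cast hn
  have hs : 0 < Real.sqrt n := Real.sqrt_pos.2 hn0
  have h1 : Integrable (fun b : Fin q → ℝ => psi (β₀ + b)) := (psi_integrable q).comp_add_left β₀
  have h2 := h1.comp_smul (R := (Real.sqrt n)⁻¹) (by positivity)
  rw [← ofReal_integral_eq_lintegral_ofReal h2 (Eventually.of_forall fun u => (psi_pos _).le)]
  congr 1
  rw [Measure.integral_comp_smul volume (fun b : Fin q → ℝ => psi (β₀ + b)), integral_add_left_eq_self (fun b => psi b) β₀]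
  simp [abs_of_pos (pow_pos hs q), Module.finrank_fin_fun]

section evA
variable {Ω : Type*} [MeasurableSpace Ω] (Q : Measure Ω) [IsProbabilityMeasure Q]
  {n q : ℕ} (Pz : Measure (Fin q → ℝ)) [IsProbabilityMeasure Pz] (g : Ω → Fin n → ℝ) (hg : Measurable g)

def X1 {Ω : Type*} [MeasurableSpace Ω] (Q : Measure Ω) {n q : ℕ} (g : Ω → Fin n → ℝ) (R : Set Ω) (β₀ : Fin q → ℝ)
    (z : Fin n → Fin q → ℝ) (e : Fin n → ℝ) : ℝ≥0∞ :=
  ∫⁻ u : Fin q → ℝ, (∫⁻ ω in R, ENNReal.ofReal (LRf (g ω) z e ((Real.sqrt n)⁻¹ • u)) ∂Q) *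
    ENNReal.ofReal (psi (β₀ + (Real.sqrt n)⁻¹ • u))

def X3 {Ω : Type*} [MeasurableSpace Ω] (Q : Measure Ω) {n q : ℕ} (g : Ω → Fin n → ℝ) (G : Set Ω) (T a : ℝ)
    (z : Fin n → Fin q → ℝ) (e : Fin n → ℝ) : ℝ≥0∞ :=
  ∫⁻ u : Fin q → ℝ, ENNReal.ofReal (Dd T a u) *
    ((∫⁻ ω in G, ENNReal.ofReal (ell (g ω) e) * ENNReal.ofReal |Real.exp (-uV (g ω) z u) - 1| ∂Q) /
      ∫⁻ ω, ENNReal.ofReal (ell (g ω) e) ∂Q)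

include hg in
lemma X1_meas1 (R : Set Ω) :
    Measurable fun w : ((Fin n → Fin q → ℝ) × (Fin n → ℝ)) × (Fin q → ℝ) =>
      ∫⁻ ω in R, ENNReal.ofReal (LRf (g ω) w.1.1 w.1.2 ((Real.sqrt n)⁻¹ • w.2)) ∂Q := by
  apply Measurable.lintegral_prod_right' (f := fun v : (((Fin n → Fin q → ℝ) × (Fin n → ℝ)) × (Fin q → ℝ)) × Ω =>
    ENNReal.ofReal (LRf (g v.2) v.1.1.1 v.1.1.2 ((Real.sqrt n)⁻¹ • v.1.2)))
  apply ENNReal.measurable_ofReal.comp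
  exact LRf_meas.comp (f := fun v : (((Fin n → Fin q → ℝ) × (Fin n → ℝ)) × (Fin q → ℝ)) × Ω =>
    (g v.2, v.1.1.1, v.1.1.2, (Real.sqrt n)⁻¹ • v.1.2)) (by fun_prop)

include hg in
lemma X1_meas (R : Set Ω) (β₀ : Fin q → ℝ) :
    Measurable fun w : (Fin n → Fin q → ℝ) × (Fin n → ℝ) => X1 Q g R β₀ w.1 w.2 := by
  unfold X1
  apply Measurable.lintegral_prod_right' (f := fun v : ((Fin n → Fin q → ℝ) × (Fin n → ℝ)) × (Fin q → ℝ) =>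
    (∫⁻ ω in R, ENNReal.ofReal (LRf (g ω) v.1.1 v.1.2 ((Real.sqrt n)⁻¹ • v.2)) ∂Q) *
    ENNReal.ofReal (psi (β₀ + (Real.sqrt n)⁻¹ • v.2)))
  refine (X1_meas1 Q g hg R).mul (ENNReal.measurable_ofReal.comp (psi_meas.comp (by fun_prop)))

include hg in
lemma evA1 (hn : 1 ≤ n) (R : Set Ω) (β₀ : Fin q → ℝ) (t : ℝ≥0∞) (ht : t ≠ 0) (ht' : t ≠ ⊤) :
    Pdat n Pz {w | t ≤ X1 Q g R β₀ w.1 w.2} ≤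
      Q R * ENNReal.ofReal (Real.sqrt n ^ q * ∫ b : Fin q → ℝ, psi b) / t := by
  refine sect_le _ _ _ (measurableSet_le measurable_const (X1_meas Q g hg R β₀)) _ (Eventually.of_forall fun z => ?_)
  have hm := (X1_meas Q g hg R β₀).comp (measurable_prodMk_left (x := z))
  refine (meas_ge_le_lintegral_div hm.aemeasurable ht ht').trans ?_
  gcongr
  simp only [Function.comp_def]
  unfold X1
  have hm2 : Measurable fun v : (Fin n → ℝ) × (Fin q → ℝ) =>
      (∫⁻ ω in R, ENNReal.ofReal (LRf (g ω) z v.1 ((Real.sqrt n)⁻¹ • v.2)) ∂Q) :=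
    (X1_meas1 Q g hg R).comp (g := fun w : ((Fin n → Fin q → ℝ) × (Fin n → ℝ)) × (Fin q → ℝ) =>
      ∫⁻ ω in R, ENNReal.ofReal (LRf (g ω) w.1.1 w.1.2 ((Real.sqrt n)⁻¹ • w.2)) ∂Q)
      (f := fun v : (Fin n → ℝ) × (Fin q → ℝ) => ((z, v.1), v.2)) (by fun_prop)
  rw [lintegral_lintegral_swap]
  swap
  · exact (hm2.mul (ENNReal.measurable_ofReal.comp (psi_meas.comp (by fun_prop)))).aemeasurable
  rw [← psi_shift hn β₀, ← lintegral_const_mul]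
  swap
  · exact (ENNReal.measurable_ofReal.comp (psi_meas.comp (by fun_prop)))
  apply le_of_eq
  refine lintegral_congr fun u => ?_
  rw [lintegral_mul_const]
  swap
  · exact Measurable.comp (g := fun v : (Fin n → ℝ) × (Fin q → ℝ) =>
      (∫⁻ ω in R, ENNReal.ofReal (LRf (g ω) z v.1 ((Real.sqrt n)⁻¹ • v.2)) ∂Q))
      (f := fun e => (e, u)) hm2 (by fun_prop)
  congr 1
  rw [lintegral_lintegral_swap]
  swap
  · apply Measurable.aemeasurable
    apply ENNReal.measurable_ofReal.comp
    exact LRf_meas.comp (f := fun v : (Fin n → ℝ) × Ω => (g v.2, z, v.1, (Real.sqrt n)⁻¹ • u)) (by fun_prop)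
  unfold LRf
  simp_rw [lint_lr (fun i => z i ⬝ᵥ ((Real.sqrt n)⁻¹ • u) + g _ i)]
  simp

include hg in
lemma evA2 (R : Set Ω) (t : ℝ≥0∞) (ht : t ≠ 0) (ht' : t ≠ ⊤) :
    Pdat n Pz {w | t ≤ ∫⁻ ω in R, ENNReal.ofReal (ell (g ω) w.2) ∂Q} ≤ Q R / t := by
  have hm3 : Measurable fun v : (Fin n → ℝ) × Ω => ENNReal.ofReal (ell (g v.2) v.1) :=
    ENNReal.measurable_ofReal.comp (ell_meas.comp (f := fun v : (Fin n → ℝ) × Ω => (g v.2, v.1)) (by fun_prop))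
  have hm : Measurable fun e : Fin n → ℝ => ∫⁻ ω in R, ENNReal.ofReal (ell (g ω) e) ∂Q :=
    Measurable.lintegral_prod_right' hm3
  refine sect_le _ _ _ (measurableSet_le measurable_const (hm.comp measurable_snd)) _ (Eventually.of_forall fun z => ?_)
  refine (meas_ge_le_lintegral_div hm.aemeasurable ht ht').trans ?_
  gcongr
  rw [lintegral_lintegral_swap hm3.aemeasurable]
  unfold ell
  simp_rw [lint_lr (fun i => g _ i)]
  simp

include hg in
lemma X3_meas1 :
    Measurable fun v : (((Fin n → Fin q → ℝ) × (Fin n → ℝ)) × (Fin q → ℝ)) × Ω =>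
      ENNReal.ofReal (ell (g v.2) v.1.1.2) * ENNReal.ofReal |Real.exp (-uV (g v.2) v.1.1.1 v.1.2) - 1| := by
  have h1 : Measurable fun v : (((Fin n → Fin q → ℝ) × (Fin n → ℝ)) × (Fin q → ℝ)) × Ω => ell (g v.2) v.1.1.2 :=
    ell_meas.comp (f := fun v : (((Fin n → Fin q → ℝ) × (Fin n → ℝ)) × (Fin q → ℝ)) × Ω => (g v.2, v.1.1.2)) (by fun_prop)
  have h2 : Measurable fun v : (((Fin n → Fin q → ℝ) × (Fin n → ℝ)) × (Fin q → ℝ)) × Ω => uV (g v.2) v.1.1.1 v.1.2 :=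
    uV_meas.comp (f := fun v : (((Fin n → Fin q → ℝ) × (Fin n → ℝ)) × (Fin q → ℝ)) × Ω => (g v.2, v.1.1.1, v.1.2)) (by fun_prop)
  refine (ENNReal.measurable_ofReal.comp h1).mul (ENNReal.measurable_ofReal.comp ?_)
  exact ((Real.measurable_exp.comp h2.neg).sub_const 1).abs

lemma Dd_meas (T a : ℝ) : Measurable (Dd (q := q) T a) := by unfold Dd; fun_prop

include hg in
lemma X3_meas2 (G : Set Ω) (T a : ℝ) :
    Measurable fun v : ((Fin n → Fin q → ℝ) × (Fin n → ℝ)) × (Fin q → ℝ) =>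
    ENNReal.ofReal (Dd T a v.2) *
    ((∫⁻ ω in G, ENNReal.ofReal (ell (g ω) v.1.2) * ENNReal.ofReal |Real.exp (-uV (g ω) v.1.1 v.2) - 1| ∂Q) /
      ∫⁻ ω, ENNReal.ofReal (ell (g ω) v.1.2) ∂Q) := by
  have hm3 : Measurable fun v : (Fin n → ℝ) × Ω => ENNReal.ofReal (ell (g v.2) v.1) :=
    ENNReal.measurable_ofReal.comp (ell_meas.comp (f := fun v : (Fin n → ℝ) × Ω => (g v.2, v.1)) (by fun_prop))
  have hm : Measurable fun e : Fin n → ℝ => ∫⁻ ω, ENNReal.ofReal (ell (g ω) e) ∂Q :=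
    Measurable.lintegral_prod_right' hm3
  refine (ENNReal.measurable_ofReal.comp ((Dd_meas T a).comp measurable_snd)).mul ?_
  exact (Measurable.lintegral_prod_right' (X3_meas1 g hg)).div (hm.comp (by fun_prop))

include hg in
lemma X3_meas (G : Set Ω) (T a : ℝ) :
    Measurable fun w : (Fin n → Fin q → ℝ) × (Fin n → ℝ) => X3 Q g G T a w.1 w.2 :=
  Measurable.lintegral_prod_right' (X3_meas2 Q g hg G T a)

include hg in
lemma evA3 (hn : 1 ≤ n) (Bz : ℝ) (hb : ∀ᵐ z ∂Pz, ∑ j, |z j| ≤ Bz) (hmean : ∀ j, ∫ z, z j ∂Pz = 0)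
    (G : Set Ω) (hGm : MeasurableSet G) (τ : ℝ) (hτ : 0 < τ) (hG : ∀ ω ∈ G, ∑ i, g ω i ^ 2 ≤ n * τ ^ 2) (T a : ℝ)
    (t : ℝ≥0∞) (ht : t ≠ 0) (ht' : t ≠ ⊤) :
    Pdat n Pz {w | t ≤ X3 Q g G T a w.1 w.2} ≤
      (∫⁻ u : Fin q → ℝ, ENNReal.ofReal (Dd T a u) *
        ENNReal.ofReal (τ / 2 + (Real.exp (2 * (Bz * ‖u‖ * τ) ^ 2) - 1) / τ)) / t := by
  have hn0 : (0:ℝ) < n := by exact_mod_cast hn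
  refine sect_le' _ _ _ (measurableSet_le measurable_const (X3_meas Q g hg G T a)) _ (Eventually.of_forall fun e => ?_)
  have hm := (X3_meas Q g hg (q := q) G T a).comp (measurable_prodMk_right (y := e))
  refine (meas_ge_le_lintegral_div hm.aemeasurable ht ht').trans ?_
  gcongr
  simp only [Function.comp_def]
  unfold X3
  rw [lintegral_lintegral_swap]
  swap
  · exact ((X3_meas2 Q g hg G T a).comp (f := fun v : (Fin n → Fin q → ℝ) × (Fin q → ℝ) => ((v.1, e), v.2))
      (by fun_prop)).aemeasurable
  refine lintegral_mono fun u => ?_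
  have hmu : Measurable fun v : (Fin n → Fin q → ℝ) × Ω =>
      ENNReal.ofReal (ell (g v.2) e) * ENNReal.ofReal |Real.exp (-uV (g v.2) v.1 u) - 1| :=
    (X3_meas1 g hg).comp (f := fun v : (Fin n → Fin q → ℝ) × Ω => (((v.1, e), u), v.2)) (by fun_prop)
  have hmi := Measurable.lintegral_prod_right' (ν := Q.restrict G) hmu
  rw [lintegral_const_mul _ (hmi.div_const _)]
  gcongr
  simp_rw [ENNReal.div_eq_inv_mul]
  rw [lintegral_const_mul _ hmi]
  rw [lintegral_lintegral_swap hmu.aemeasurable]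
  set bd := ENNReal.ofReal (τ / 2 + (Real.exp (2 * (Bz * ‖u‖ * τ) ^ 2) - 1) / τ) with hbd
  have hel : Measurable fun ω => ENNReal.ofReal (ell (g ω) e) :=
    ENNReal.measurable_ofReal.comp (ell_meas.comp (f := fun v : Ω => (g v, e)) (by fun_prop))
  have key : ∫⁻ ω in G, ∫⁻ z, ENNReal.ofReal (ell (g ω) e) * ENNReal.ofReal |Real.exp (-uV (g ω) z u) - 1|
      ∂(Measure.pi fun _ : Fin n => Pz) ∂Q ≤ bd * ∫⁻ ω, ENNReal.ofReal (ell (g ω) e) ∂Q := by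
    calc _ ≤ ∫⁻ ω in G, bd * ENNReal.ofReal (ell (g ω) e) ∂Q := by
          refine setLIntegral_mono' hGm fun ω hω => ?_
          rw [lintegral_const_mul, mul_comm]
          swap
          · apply ENNReal.measurable_ofReal.comp
            exact ((Real.measurable_exp.comp (uV_meas.comp (f := fun z => (g ω, z, u))
              (by fun_prop)).neg).sub_const 1).abs
          gcongr
          have h := subG_pi (n := n) Pz (subG_z Pz Bz hb hmean u) (fun i => (Real.sqrt n)⁻¹ * g ω i)
            ((Bz * ‖u‖ * τ) ^ 2).toNNReal (by
              rw [Real.coe_toNNReal _ (by positivity), Real.coe_toNNReal _ (by positivity)]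
              simp only [mul_pow _ (g ω _), inv_pow, Real.sq_sqrt hn0.le, ← Finset.mul_sum]
              calc (Bz * ‖u‖) ^ 2 * ((n:ℝ)⁻¹ * ∑ i, g ω i ^ 2) ≤ (Bz * ‖u‖) ^ 2 * ((n:ℝ)⁻¹ * (n * τ ^ 2)) := by
                    gcongr; exact hG ω hω
                _ = _ := by field_simp)
          have h2 := subG_exp_sub_one h hτ
          rw [Real.coe_toNNReal _ (by positivity)] at h2
          exact h2
      _ ≤ ∫⁻ ω, bd * ENNReal.ofReal (ell (g ω) e) ∂Q := setLIntegral_le_lintegral _ _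
      _ = _ := lintegral_const_mul _ hel
  set ZL := ∫⁻ ω, ENNReal.ofReal (ell (g ω) e) ∂Q
  calc ZL⁻¹ * _ ≤ ZL⁻¹ * (bd * ZL) := by gcongr
    _ = bd * (ZL⁻¹ * ZL) := by ring
    _ ≤ bd * 1 := by gcongr; exact ENNReal.inv_mul_le_one _
    _ = bd := mul_one _

end evA

lemma Dd_fin {q : ℕ} (T a : ℝ) (hT : 0 ≤ T) (ha : 0 < a) :
    ∫⁻ u : Fin q → ℝ, ENNReal.ofReal (Dd T a u * (1 + ‖u‖ + ‖u‖ ^ 2)) < ⊤ := by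
  set c := a / (2 * (q + 1)) with hc
  have hc0 : 0 < c := by positivity
  have hI : Integrable (fun b : Fin q → ℝ => ∏ j, Real.exp (-c * b j ^ 2)) :=
    Integrable.fintype_prod (f := fun _ t => Real.exp (-c * t ^ 2))
      (fun _ => integrable_exp_neg_mul_sq hc0)
  have hI2 := hI.const_mul (2 * Real.exp ((T + 1) ^ 2 / (2 * a)))
  refine lt_of_le_of_lt (lintegral_mono fun u => ENNReal.ofReal_le_ofReal ?_) hI2.lintegral_lt_top
  set t := ‖u‖ with ht
  have ht0 : 0 ≤ t := norm_nonneg _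
  have h1 : 1 + t + t ^ 2 ≤ 2 * Real.exp t := by
    have := Real.quadratic_le_exp_of_nonneg ht0
    linarith
  rw [← Real.exp_sum, ← Finset.mul_sum]
  have h2 : ∑ j, u j ^ 2 ≤ (q + 1) * t ^ 2 := by
    calc ∑ j, u j ^ 2 ≤ ∑ j : Fin q, t ^ 2 := by
          refine Finset.sum_le_sum fun j _ => ?_
          exact sq_le_sq.2 ((norm_le_pi_norm u j).trans (le_abs_self _))
      _ = q * t ^ 2 := by simp
      _ ≤ _ := by nlinarith [sq_nonneg t]
  have h3 : c * ∑ j, u j ^ 2 ≤ a / 2 * t ^ 2 := by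
    calc c * ∑ j, u j ^ 2 ≤ c * ((q + 1) * t ^ 2) := by gcongr
      _ = _ := by rw [hc]; field_simp
  have h4 : (T + 1) * t ≤ (T + 1) ^ 2 / (2 * a) + a / 2 * t ^ 2 := by
    have : (T + 1) ^ 2 / (2 * a) + a / 2 * t ^ 2 - (T + 1) * t = (T + 1 - a * t) ^ 2 / (2 * a) := by
      field_simp; ring
    have h5 : 0 ≤ (T + 1 - a * t) ^ 2 / (2 * a) := by positivity
    linarith
  calc Dd T a u * (1 + t + t ^ 2) ≤ Real.exp (T * t - a * t ^ 2) * (2 * Real.exp t) := by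
        unfold Dd; gcongr
    _ = 2 * Real.exp ((T + 1) * t - a * t ^ 2) := by
        rw [mul_left_comm, ← Real.exp_add]; ring_nf
    _ ≤ 2 * Real.exp ((T + 1) ^ 2 / (2 * a) + -c * ∑ j, u j ^ 2) := by
        gcongr; linarith
    _ = _ := by rw [Real.exp_add]; ring

lemma ofReal_int_le {Ω : Type*} [MeasurableSpace Ω] (μ : Measure Ω) (f : Ω → ℝ) (hf : ∀ ω, 0 ≤ f ω) :
    ENNReal.ofReal (∫ ω, f ω ∂μ) ≤ ∫⁻ ω, ENNReal.ofReal (f ω) ∂μ := by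
  by_cases h : Integrable f μ
  · rw [ofReal_integral_eq_lintegral_ofReal h (Eventually.of_forall hf)]
  · rw [integral_undef h]; simp

lemma lint_add3 {E : Type*} [MeasurableSpace E] (μ : Measure E) (f h k : E → ℝ≥0∞) (hf : Measurable f)
    (hh : Measurable h) : ∫⁻ x, f x ∂μ + ∫⁻ x, h x ∂μ + ∫⁻ x, k x ∂μ = ∫⁻ x, f x + h x + k x ∂μ := by
  rw [lintegral_add_left (f := fun x => f x + h x) (hf.add hh), lintegral_add_left hf]

lemma JU_bound {Ω : Type*} [MeasurableSpace Ω] (Q : Measure Ω) [IsProbabilityMeasure Q] {n q : ℕ}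
    (hn : 1 ≤ n) (M : Matrix (Fin q) (Fin q) ℝ) (g : Ω → Fin n → ℝ) (hg : Measurable g)
    (z : Fin n → Fin q → ℝ) (e : Fin n → ℝ) (β₀ : Fin q → ℝ)
    (S : Set Ω) (hS : MeasurableSet S) (lam ϱ T s τ ζ r : ℝ) (hlam : 0 < lam) (hϱ0 : 0 ≤ ϱ)
    (hϱ : ϱ ≤ lam / 2) (hs : 0 ≤ s) (hsτ : s + 2 * s ^ 2 / lam ≤ τ ^ 2 / 4)
    (hM : ∀ u, lam * ‖u‖ ^ 2 ≤ u ⬝ᵥ M.mulVec u)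
    (e2 : ∀ u, |mnq z u - u ⬝ᵥ M.mulVec u| ≤ ϱ * ‖u‖ ^ 2)
    (e3 : ∀ u, |u ⬝ᵥ Wv z e| ≤ T * ‖u‖)
    (e4 : ∀ ω ∈ S, |∑ i, e i * g ω i| ≤ s * n)
    (e4' : ∀ u, ∀ ω ∈ S, |∑ i, g ω i * (z i ⬝ᵥ u)| ≤ s * n * ‖u‖)
    (hζ : 0 < ζ) (hZ : ζ ≤ ZU Q g e)
    (hr : 2 * Real.exp (-(n * τ ^ 2 / 4)) / ζ + (∫ ω in Sᶜ, ell (g ω) e ∂Q) / ζ + ϱ / 2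
      + (∑ j, |β₀ j|) * (Real.sqrt n)⁻¹ + q * (Real.sqrt n)⁻¹ ^ 2 / 2 ≤ r) :
    JU Q M g z e β₀ ≤ ENNReal.ofReal ζ⁻¹ * X1 Q g Sᶜ β₀ z e
      + ENNReal.ofReal r * (∫⁻ u : Fin q → ℝ, ENNReal.ofReal (Dd T (lam / 8) u * (1 + ‖u‖ + ‖u‖ ^ 2)))
      + X3 Q g (S ∩ {ω | ∑ i, g ω i ^ 2 ≤ n * τ ^ 2}) T (lam / 8) z e := by
  set G := S ∩ {ω | ∑ i, g ω i ^ 2 ≤ n * τ ^ 2} with hG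
  unfold JU X1 X3
  have hm1 : Measurable fun u : Fin q → ℝ =>
      (∫⁻ ω in Sᶜ, ENNReal.ofReal (LRf (g ω) z e ((Real.sqrt n)⁻¹ • u)) ∂Q) *
        ENNReal.ofReal (psi (β₀ + (Real.sqrt n)⁻¹ • u)) := by
    refine Measurable.mul ?_ (ENNReal.measurable_ofReal.comp (psi_meas.comp (by fun_prop)))
    exact (X1_meas1 Q g hg Sᶜ).comp (f := fun u : Fin q → ℝ => ((z, e), u)) (by fun_prop)
  have hm2 : Measurable fun u : Fin q → ℝ => ENNReal.ofReal (Dd T (lam / 8) u * (1 + ‖u‖ + ‖u‖ ^ 2)) := by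
    have := Dd_meas (q := q) T (lam / 8)
    fun_prop
  rw [← lintegral_const_mul _ hm1, ← lintegral_const_mul _ hm2,
    lint_add3 _ _ _ _ (hm1.const_mul _) (hm2.const_mul _)]
  refine lintegral_mono fun u => ?_
  have hD : 0 < Dd T (lam / 8) u := Real.exp_pos _
  have hpsi := psi_pos (β₀ + (Real.sqrt n)⁻¹ • u)
  have hZ0 : 0 < ZU Q g e := hζ.trans_le hZ
  have hi1 : 0 ≤ ∫ ω in Sᶜ, LRf (g ω) z e ((Real.sqrt n)⁻¹ • u) ∂Q :=
    integral_nonneg fun ω => (LRf_pos _ _ _ _).le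
  have hi2 : 0 ≤ ∫ ω in Sᶜ, ell (g ω) e ∂Q := integral_nonneg fun ω => (ell_pos _ _).le
  have hi3 : 0 ≤ ∫ ω in G, ell (g ω) e * |Real.exp (-uV (g ω) z u) - 1| ∂Q :=
    integral_nonneg fun ω => mul_nonneg (ell_pos _ _).le (abs_nonneg _)
  have hb0 : 0 ≤ ∑ j, |β₀ j| := Finset.sum_nonneg fun i _ => abs_nonneg _
  refine (ENNReal.ofReal_le_ofReal (pw_bound Q hn M g hg z e β₀ u S hS lam ϱ T s τ ζ hlam hϱ hs hsτ
    (hM u) (e2 u) (e3 u) e4 (e4' u) hζ hZ)).trans ?_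
  rw [← hG]
  set t := ‖u‖ with ht
  have ht0 : 0 ≤ t := norm_nonneg _
  rw [ENNReal.ofReal_add (by positivity) (by positivity), ENNReal.ofReal_add (by positivity) (by positivity)]
  refine add_le_add (add_le_add ?_ ?_) ?_
  · rw [div_eq_inv_mul, ENNReal.ofReal_mul (by positivity), ENNReal.ofReal_mul hi1]
    gcongr
    exact ofReal_int_le _ _ fun ω => (LRf_pos _ _ _ _).le
  · rw [← ENNReal.ofReal_mul' (by positivity)]
    apply ENNReal.ofReal_le_ofReal
    set x := (Real.sqrt n)⁻¹ with hx
    have hx0 : 0 ≤ x := by positivity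
    set k := 2 * Real.exp (-(n * τ ^ 2 / 4)) / ζ with hk
    have hk0 : 0 ≤ k := by positivity
    set l := (∫ ω in Sᶜ, ell (g ω) e ∂Q) / ζ with hl
    have hl0 : 0 ≤ l := by positivity
    have key : k + l + (ϱ / 2 * t ^ 2 + (∑ j, |β₀ j|) * (x * t) + q * (x * t) ^ 2 / 2) ≤
        r * (1 + t + t ^ 2) := by
      have h1 : k + l + ϱ / 2 + (∑ j, |β₀ j|) * x + q * x ^ 2 / 2 ≤ r := hr
      calc _ ≤ (k + l + ϱ / 2 + (∑ j, |β₀ j|) * x + q * x ^ 2 / 2) * (1 + t + t ^ 2) := by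
            have p1 : 0 ≤ (k + l) * (t + t ^ 2) := by positivity
            have p2 : 0 ≤ ϱ / 2 * (1 + t) := by positivity
            have p3 : 0 ≤ (∑ j, |β₀ j|) * x * (1 + t ^ 2) := by positivity
            have p4 : 0 ≤ q * x ^ 2 / 2 * (1 + t) := by positivity
            nlinarith
        _ ≤ _ := by gcongr
    calc _ ≤ Dd T (lam / 8) u * (r * (1 + t + t ^ 2)) := by gcongr
      _ = _ := by ring
  · rw [ENNReal.ofReal_mul hD.le, ENNReal.ofReal_div_of_pos hZ0]
    gcongr
    · refine (ofReal_int_le _ _ fun ω => mul_nonneg (ell_pos _ _).le (abs_nonneg _)).trans (le_of_eq ?_)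
      refine lintegral_congr fun ω => ?_
      rw [ENNReal.ofReal_mul (ell_pos _ _).le]
    · rw [ZU, ofReal_integral_eq_lintegral_ofReal (ell_int Q g hg e) (Eventually.of_forall fun ω => (ell_pos _ _).le)]

lemma det_e2 {n q : ℕ} (z : Fin n → Fin q → ℝ) (M : Matrix (Fin q) (Fin q) ℝ) (hn : 1 ≤ n) (ϱ : ℝ)
    (h2 : ∀ j k, |∑ i, (n:ℝ)⁻¹ * (z i j * z i k - M j k)| ≤ ϱ) (u : Fin q → ℝ) :
    |mnq z u - u ⬝ᵥ M.mulVec u| ≤ (q ^ 2 * ϱ) * ‖u‖ ^ 2 := by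
  have hn0 : (n:ℝ) ≠ 0 := by positivity
  have : mnq z u - u ⬝ᵥ M.mulVec u =
      ∑ j, ∑ k, (u j * u k) * ∑ i, (n:ℝ)⁻¹ * (z i j * z i k - M j k) := by
    unfold mnq dotProduct Matrix.mulVec dotProduct
    have a1 : ∀ j k, ∑ i, (n:ℝ)⁻¹ * (z i j * z i k - M j k) = (n:ℝ)⁻¹ * (∑ i, z i j * z i k) - M j k := by
      intro j k
      rw [← Finset.mul_sum, Finset.sum_sub_distrib, mul_sub]
      simp [hn0]
    simp_rw [a1, mul_sub, Finset.sum_sub_distrib]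
    congr 1
    · simp_rw [sq, Finset.sum_mul_sum, Finset.mul_sum]
      rw [Finset.sum_comm]
      refine Finset.sum_congr rfl fun j _ => ?_
      rw [Finset.sum_comm]
      refine Finset.sum_congr rfl fun k _ => ?_
      refine Finset.sum_congr rfl fun i _ => ?_
      ring
    · refine Finset.sum_congr rfl fun j _ => ?_
      rw [Finset.mul_sum]
      refine Finset.sum_congr rfl fun k _ => ?_
      ring
  rw [this]
  have hu : ∀ j, |u j| ≤ ‖u‖ := fun j => norm_le_pi_norm u j
  calc _ ≤ ∑ j : Fin q, ∑ k : Fin q, (‖u‖ * ‖u‖) * ϱ := by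
        refine (Finset.abs_sum_le_sum_abs _ _).trans (Finset.sum_le_sum fun j _ => ?_)
        refine (Finset.abs_sum_le_sum_abs _ _).trans (Finset.sum_le_sum fun k _ => ?_)
        rw [abs_mul, abs_mul]
        exact mul_le_mul (mul_le_mul (hu j) (hu k) (abs_nonneg _) (norm_nonneg _)) (h2 j k) (abs_nonneg _)
          (by positivity)
    _ = _ := by simp; ring

lemma det_dot {q : ℕ} (w u : Fin q → ℝ) (T : ℝ) (h : ∀ j, |w j| ≤ T) : |u ⬝ᵥ w| ≤ (q * T) * ‖u‖ := by
  unfold dotProduct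
  calc _ ≤ ∑ j : Fin q, ‖u‖ * T := by
        refine (Finset.abs_sum_le_sum_abs _ _).trans (Finset.sum_le_sum fun j _ => ?_)
        rw [abs_mul]
        exact mul_le_mul (norm_le_pi_norm u j) (h j) (abs_nonneg _) (norm_nonneg _)
    _ = _ := by simp; ring

lemma det_e4 {n : ℕ} (a g F : Fin n → ℝ) (s δ L : ℝ) (hδ : 0 ≤ δ) (hL : ∑ i, |F i| ≤ L * n)
    (hg : ∀ i, |g i - a i| ≤ δ) (ha : |∑ i, a i * F i| ≤ s * n) :
    |∑ i, g i * F i| ≤ (s + δ * L) * n := by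
  have : ∑ i, g i * F i = ∑ i, a i * F i + ∑ i, (g i - a i) * F i := by
    rw [← Finset.sum_add_distrib]; exact Finset.sum_congr rfl fun i _ => by ring
  rw [this]
  refine (abs_add_le _ _).trans ?_
  have h2 : |∑ i, (g i - a i) * F i| ≤ δ * (L * n) := by
    calc _ ≤ ∑ i, δ * |F i| := by
          refine (Finset.abs_sum_le_sum_abs _ _).trans (Finset.sum_le_sum fun j _ => ?_)
          rw [abs_mul]
          exact mul_le_mul_of_nonneg_right (hg j) (abs_nonneg _)
      _ = δ * ∑ i, |F i| := by rw [Finset.mul_sum]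
      _ ≤ _ := by gcongr
  linarith

lemma sum_abs_le {n : ℕ} (e : Fin n → ℝ) (Λ : ℝ) (hΛ : 1 ≤ Λ) (h : ∑ i, e i ^ 2 ≤ Λ * n) :
    ∑ i, |e i| ≤ Λ * n := by
  have h1 : ∑ i, |e i| ≤ ∑ i, (1 + e i ^ 2) / 2 := by
    refine Finset.sum_le_sum fun i _ => ?_
    nlinarith [sq_nonneg (1 - |e i|), sq_abs (e i)]
  have h2 : ∑ i, (1 + e i ^ 2) / 2 = (n + ∑ i, e i ^ 2) / 2 := by
    rw [← Finset.sum_div, Finset.sum_add_distrib]; simp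
  have : (n:ℝ) ≤ Λ * n := by nlinarith [Nat.cast_nonneg (α := ℝ) n]
  rw [h2] at h1
  linarith

lemma det_Z {Ω : Type*} [MeasurableSpace Ω] (Q : Measure Ω) [IsProbabilityMeasure Q] {n : ℕ}
    (g : Ω → Fin n → ℝ) (hg : Measurable g) (e : Fin n → ℝ) (Λ τ : ℝ) (hΛ : 1 ≤ Λ) (hτ : 0 ≤ τ) (hτ1 : τ ≤ 1)
    (h : ∑ i, e i ^ 2 ≤ Λ * n) (v : ℝ) (hv : v ≤ Q.real {ω | ∀ i, |g ω i| ≤ τ}) :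
    v * Real.exp (-(τ * (Λ + 1)) * n) ≤ ZU Q g e := by
  have hm : MeasurableSet {ω | ∀ i, |g ω i| ≤ τ} := by
    rw [Set.setOf_forall]
    exact MeasurableSet.iInter fun i => measurableSet_le (by fun_prop) measurable_const
  have hsum := sum_abs_le e Λ hΛ h
  unfold ZU
  calc v * Real.exp (-(τ * (Λ + 1)) * n) ≤ Q.real {ω | ∀ i, |g ω i| ≤ τ} * Real.exp (-(τ * (Λ + 1)) * n) := by gcongr
    _ = ∫ ω in {ω | ∀ i, |g ω i| ≤ τ}, Real.exp (-(τ * (Λ + 1)) * n) ∂Q := by simp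
    _ ≤ ∫ ω in {ω | ∀ i, |g ω i| ≤ τ}, ell (g ω) e ∂Q := by
        refine setIntegral_mono_on (integrableOn_const (by simp)) (ell_int Q g hg e).integrableOn hm fun ω hω => ?_
        unfold ell
        apply Real.exp_le_exp.2
        have h1 : ∑ i, -(τ * |e i| + τ ^ 2 / 2) ≤ ∑ i, (e i * g ω i - g ω i ^ 2 / 2) := by
          refine Finset.sum_le_sum fun i _ => ?_
          have h2 : |e i * g ω i| ≤ τ * |e i| := by
            rw [abs_mul, mul_comm]; exact mul_le_mul_of_nonneg_right (hω i) (abs_nonneg _)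
          have h3 : g ω i ^ 2 ≤ τ ^ 2 := sq_le_sq.2 ((hω i).trans (le_abs_self _))
          have := (abs_le.1 h2).1
          linarith
        refine le_trans ?_ h1
        rw [Finset.sum_neg_distrib, Finset.sum_add_distrib, ← Finset.mul_sum]
        simp only [Finset.sum_const, Finset.card_univ, Fintype.card_fin, nsmul_eq_mul]
        have h4 : τ * ∑ i, |e i| ≤ τ * (Λ * n) := by gcongr
        have h5 : τ ^ 2 / 2 ≤ τ := by nlinarith
        have h6 : n * (τ ^ 2 / 2) ≤ n * τ := by gcongr
        linarith
    _ ≤ ∫ ω, ell (g ω) e ∂Q := setIntegral_le_integral (ell_int Q g hg e)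
        (Eventually.of_forall fun ω => (ell_pos _ _).le)

lemma ev_exp (k C ε : ℝ) (hk : 0 < k) (hε : 0 < ε) : ∀ᶠ n : ℕ in atTop, C * Real.exp (-k * n) ≤ ε := by
  have h : Tendsto (fun n : ℕ => C * Real.exp (-k * n)) atTop (nhds (C * 0)) := by
    refine Tendsto.const_mul _ (Real.tendsto_exp_atBot.comp ?_)
    exact (tendsto_natCast_atTop_atTop).const_mul_atTop_of_neg (by linarith)
  rw [mul_zero] at h
  filter_upwards [h.eventually (gt_mem_nhds hε)] with n hn using hn.le

lemma ev_pow_exp (q : ℕ) (k C ε : ℝ) (hk : 0 < k) (hε : 0 < ε) :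
    ∀ᶠ n : ℕ in atTop, C * ((n:ℝ) ^ q * Real.exp (-k * n)) ≤ ε := by
  have h : Tendsto (fun n : ℕ => C * ((n:ℝ) ^ q * Real.exp (-k * n))) atTop (nhds (C * 0)) := by
    refine Tendsto.const_mul _ ?_
    have := tendsto_pow_const_mul_const_pow_of_abs_lt_one q (r := Real.exp (-k)) (by
      rw [abs_of_pos (Real.exp_pos _)]; rw [← Real.exp_zero]; exact Real.exp_lt_exp.2 (by linarith))
    refine this.congr fun n => ?_
    rw [← Real.exp_nat_mul]; ring_nf
  rw [mul_zero] at h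
  filter_upwards [h.eventually (gt_mem_nhds hε)] with n hn using hn.le

lemma ev_sqrt (b c ε : ℝ) (hε : 0 < ε) :
    ∀ᶠ n : ℕ in atTop, b * (Real.sqrt n)⁻¹ + c * (Real.sqrt n)⁻¹ ^ 2 / 2 ≤ ε := by
  have h0 : Tendsto (fun n : ℕ => (Real.sqrt n)⁻¹) atTop (nhds 0) :=
    tendsto_inv_atTop_zero.comp (Real.tendsto_sqrt_atTop.comp tendsto_natCast_atTop_atTop)
  have h : Tendsto (fun n : ℕ => b * (Real.sqrt n)⁻¹ + c * (Real.sqrt n)⁻¹ ^ 2 / 2) atTop (nhds (b * 0 + c * 0 ^ 2 / 2)) :=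
    (h0.const_mul b).add (((h0.pow 2).const_mul c).div_const 2)
  simp only [mul_zero, ne_eq, OfNat.ofNat_ne_zero, not_false_eq_true, zero_pow, zero_div, add_zero] at h
  filter_upwards [h.eventually (gt_mem_nhds hε)] with n hn using hn.le

lemma ex_small (A₁ A₂ y₁ y₂ : ℝ) (h₁ : 0 < y₁) (h₂ : 0 < y₂) :
    ∃ τ : ℝ, 0 < τ ∧ τ ≤ 1 ∧ τ * A₁ ≤ y₁ ∧ τ * A₂ ≤ y₂ := by
  have h : ∀ A y : ℝ, 0 < y → ∀ᶠ τ in nhdsWithin (0:ℝ) (Set.Ioi 0), τ * A ≤ y := by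
    intro A y hy
    have : Tendsto (fun τ : ℝ => τ * A) (nhdsWithin 0 (Set.Ioi 0)) (nhds (0 * A)) :=
      ((continuous_id.mul continuous_const).tendsto 0).mono_left nhdsWithin_le_nhds
    rw [zero_mul] at this
    filter_upwards [this.eventually (gt_mem_nhds hy)] with n hn using hn.le
  obtain ⟨τ, ⟨⟨h1, h2⟩, h3⟩, h4⟩ := (((h A₁ y₁ h₁).and (h A₂ y₂ h₂)).and (h 1 1 one_pos)).and
    (self_mem_nhdsWithin) |>.exists
  exact ⟨τ, h4, by simpa using h3, h1, h2⟩

lemma bd_int {q : ℕ} (T a Bz τ : ℝ) (hτ : 0 < τ) (h : 2 * Bz ^ 2 * τ ^ 2 ≤ a / 2) :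
    ∫⁻ u : Fin q → ℝ, ENNReal.ofReal (Dd T a u) *
        ENNReal.ofReal (τ / 2 + (Real.exp (2 * (Bz * ‖u‖ * τ) ^ 2) - 1) / τ) ≤
      ENNReal.ofReal (τ * (1 + 2 * Bz ^ 2)) *
        ∫⁻ u : Fin q → ℝ, ENNReal.ofReal (Dd T (a / 2) u * (1 + ‖u‖ + ‖u‖ ^ 2)) := by
  have hm2 : Measurable fun u : Fin q → ℝ => ENNReal.ofReal (Dd T (a / 2) u * (1 + ‖u‖ + ‖u‖ ^ 2)) := by
    have := Dd_meas (q := q) T (a / 2)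
    fun_prop
  rw [← lintegral_const_mul _ hm2]
  refine lintegral_mono fun u => ?_
  have hD : 0 < Dd T a u := Real.exp_pos _
  rw [← ENNReal.ofReal_mul hD.le, ← ENNReal.ofReal_mul (by positivity)]
  apply ENNReal.ofReal_le_ofReal
  set t := ‖u‖ with ht
  have ht0 : 0 ≤ t := norm_nonneg _
  set x := 2 * (Bz * t * τ) ^ 2 with hx
  have hx0 : 0 ≤ x := by positivity
  have hxa : x ≤ a / 2 * t ^ 2 := by
    calc x = 2 * Bz ^ 2 * τ ^ 2 * t ^ 2 := by rw [hx]; ring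
      _ ≤ _ := by gcongr
  have h1 : Real.exp x - 1 ≤ x * Real.exp x := by
    have := Real.add_one_le_exp (-x)
    have h3 : Real.exp (-x) * Real.exp x = 1 := by rw [← Real.exp_add]; simp
    nlinarith [Real.exp_pos x]
  have hE : Real.exp x ≤ Real.exp (a / 2 * t ^ 2) := Real.exp_le_exp.2 hxa
  have hE1 : 1 ≤ Real.exp (a / 2 * t ^ 2) := Real.one_le_exp (hx0.trans hxa)
  have hDD : Dd T (a / 2) u = Dd T a u * Real.exp (a / 2 * t ^ 2) := by
    unfold Dd; rw [← Real.exp_add]; congr 1; ring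
  rw [hDD]
  set E := Real.exp (a / 2 * t ^ 2)
  have h4 : (Real.exp x - 1) / τ ≤ 2 * Bz ^ 2 * τ * t ^ 2 * E := by
    rw [div_le_iff₀ hτ]
    calc Real.exp x - 1 ≤ x * E := h1.trans (by gcongr)
      _ = _ := by rw [hx]; ring
  calc Dd T a u * (τ / 2 + (Real.exp x - 1) / τ) ≤ Dd T a u * (τ * E + 2 * Bz ^ 2 * τ * t ^ 2 * E) := by
        gcongr
        nlinarith
    _ ≤ Dd T a u * ((τ * (1 + 2 * Bz ^ 2)) * (E * (1 + t + t ^ 2))) := by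
        gcongr
        have p1 : 0 ≤ τ * E * (t + t ^ 2) := by positivity
        have p2 : 0 ≤ 2 * Bz ^ 2 * τ * E * (1 + t) := by positivity
        nlinarith
    _ = _ := by ring

lemma ofReal_div_le' (x t y : ℝ) (ht : 0 < t) (h : x ≤ t * y) :
    ENNReal.ofReal x / ENNReal.ofReal t ≤ ENNReal.ofReal y := by
  rw [← ENNReal.ofReal_div_of_pos ht]
  refine ENNReal.ofReal_le_ofReal ?_
  rw [div_le_iff₀ ht]; linarith

lemma meas_iUnion_fin {W : Type*} [MeasurableSpace W] (P : Measure W) {ι : Type*} [Fintype ι] (A : ι → Set W) (b y : ℝ)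
    (hb : ∀ i, P (A i) ≤ ENNReal.ofReal b) (h : Fintype.card ι * b ≤ y) : P (⋃ i, A i) ≤ ENNReal.ofReal y := by
  refine (measure_iUnion_fintype_le P A).trans ?_
  refine (Finset.sum_le_sum fun i _ => hb i).trans ?_
  rw [Finset.sum_const, Finset.card_univ, nsmul_eq_mul]
  rw [← ENNReal.ofReal_natCast, ← ENNReal.ofReal_mul (by positivity)]
  exact ENNReal.ofReal_le_ofReal h

lemma fd_core {Ω : Type*} [MeasurableSpace Ω] (Q : Measure Ω) [IsProbabilityMeasure Q] {n q : ℕ}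
    (hn : 1 ≤ n) (M : Matrix (Fin q) (Fin q) ℝ) (g : Ω → Fin n → ℝ) (hg : Measurable g)
    (β₀ : Fin q → ℝ) (Pz : Measure (Fin q → ℝ)) [IsProbabilityMeasure Pz] (Bz : ℝ) (hBz : 0 < Bz)
    (hb : ∀ᵐ z ∂Pz, ∑ j, |z j| ≤ Bz) (hmean : ∀ j, ∫ z, z j ∂Pz = 0)
    (hMd : ∀ j k, M j k = ∫ z, z j * z k ∂Pz) (lam : ℝ) (hlam : 0 < lam)
    (hM : ∀ u, lam * ‖u‖ ^ 2 ≤ u ⬝ᵥ M.mulVec u)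
    (Λ T' τ s s' δc G' ϱ' τ' v r t δ γ CD CD2 QS : ℝ) (hΛ : 1 ≤ Λ) (hT' : 0 ≤ T') (hτ : 0 < τ)
    (hsτ : s + 2 * s ^ 2 / lam ≤ τ ^ 2 / 4) (hs : 0 ≤ s) (hs' : 0 ≤ s') (hδc : 0 ≤ δc)
    (hss : s' + δc * Λ ≤ s) (hss2 : q * (s' + δc * Bz) ≤ s) (hG' : 0 < G') (hϱ' : 0 ≤ ϱ')
    (hϱ : q ^ 2 * ϱ' ≤ lam / 2) (hτ0 : 0 ≤ τ') (hτ1 : τ' ≤ 1) (hv0 : 0 < v) (ht : 0 < t) (hδ : 0 < δ) (hγ : 0 < γ)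
    (hv : v ≤ Q.real {ω | ∀ i, |g ω i| ≤ τ'})
    (hCD : (∫⁻ u : Fin q → ℝ, ENNReal.ofReal (Dd (q * T') (lam / 8) u * (1 + ‖u‖ + ‖u‖ ^ 2))) ≤ ENNReal.ofReal CD)
    (hCD2 : (∫⁻ u : Fin q → ℝ, ENNReal.ofReal (Dd (q * T') (lam / 8 / 2) u * (1 + ‖u‖ + ‖u‖ ^ 2))) ≤ ENNReal.ofReal CD2)
    (hr0 : 0 ≤ r)
    (S : Set Ω) (hS : MeasurableSet S) (hQS : Q Sᶜ ≤ ENNReal.ofReal QS)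
    (hQS0 : 0 ≤ QS)
    (N : ℕ) (a : Fin N → Fin n → ℝ) (ha : ∀ k i, |a k i| ≤ G') (hcov : ∀ ω ∈ S, ∃ k, ∀ i, |g ω i - a k i| ≤ δc)
    (hr : 2 * Real.exp (-(n * τ ^ 2 / 4)) / (v * Real.exp (-(τ' * (Λ + 1)) * n)) + t / (v * Real.exp (-(τ' * (Λ + 1)) * n))
      + (q ^ 2 * ϱ') / 2
      + (∑ j, |β₀ j|) * (Real.sqrt n)⁻¹ + q * (Real.sqrt n)⁻¹ ^ 2 / 2 ≤ r)
    (hrC : r * CD ≤ δ / 4) (htz : (v * Real.exp (-(τ' * (Λ + 1)) * n))⁻¹ * t ≤ δ / 4)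
    (hBτ : 2 * Bz ^ 2 * τ ^ 2 ≤ lam / 8 / 2)
    (b1 : 1 / Λ ≤ γ / 8) (b2 : (q:ℝ) ^ 2 * (2 * Real.exp (-ϱ' ^ 2 * n / (2 * Bz ^ 4))) ≤ γ / 8)
    (b3 : (q:ℝ) * (2 * Real.exp (-T' ^ 2 / (2 * Bz ^ 2))) ≤ γ / 8)
    (b4 : (N:ℝ) * (2 * Real.exp (-(s' ^ 2 / (2 * G' ^ 2)) * n)) ≤ γ / 8)
    (b5 : (N:ℝ) * q * (2 * Real.exp (-(s' ^ 2 / (2 * (Bz * G') ^ 2)) * n)) ≤ γ / 8)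
    (b6 : QS * (Real.sqrt n ^ q * ∫ b : Fin q → ℝ, psi b) ≤ t * (γ / 8))
    (b7 : QS ≤ t * (γ / 8)) (b8 : τ * (1 + 2 * Bz ^ 2) * CD2 ≤ δ / 4 * (γ / 8)) :
    Pdat n Pz {w | ENNReal.ofReal δ < JU Q M g w.1 w.2 β₀} ≤ ENNReal.ofReal γ := by
  set ζ := v * Real.exp (-(τ' * (Λ + 1)) * n) with hζ
  have hζ0 : 0 < ζ := by positivity
  set G := S ∩ {ω | ∑ i, g ω i ^ 2 ≤ n * τ ^ 2} with hG
  have hGm : MeasurableSet G := hS.inter (measurableSet_le (by fun_prop) (by fun_prop))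
  set E0 := {w : (Fin n → Fin q → ℝ) × (Fin n → ℝ) | ¬ ∀ i, ∑ j, |w.1 i j| ≤ Bz} with hE0
  set E1 := {w : (Fin n → Fin q → ℝ) × (Fin n → ℝ) | Λ * n < ∑ i, w.2 i ^ 2} with hE1
  set E2 : Fin q × Fin q → Set ((Fin n → Fin q → ℝ) × (Fin n → ℝ)) := fun jk =>
    {w | ϱ' < |∑ i, (n:ℝ)⁻¹ * (w.1 i jk.1 * w.1 i jk.2 - ∫ z, z jk.1 * z jk.2 ∂Pz)|} with hE2
  set E3 : Fin q → Set ((Fin n → Fin q → ℝ) × (Fin n → ℝ)) := fun j => {w | T' < |Wv w.1 w.2 j|} with hE3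
  set E4 : Fin N → Set ((Fin n → Fin q → ℝ) × (Fin n → ℝ)) := fun k =>
    {w | s' * n < |∑ i, a k i * w.2 i|} with hE4
  set E5 : Fin N × Fin q → Set ((Fin n → Fin q → ℝ) × (Fin n → ℝ)) := fun kj =>
    {w | s' * n < |∑ i, a kj.1 i * w.1 i kj.2|} with hE5
  set E6 := {w : (Fin n → Fin q → ℝ) × (Fin n → ℝ) | ENNReal.ofReal t ≤ X1 Q g Sᶜ β₀ w.1 w.2} with hE6
  set E7 := {w : (Fin n → Fin q → ℝ) × (Fin n → ℝ) | ENNReal.ofReal t ≤ ∫⁻ ω in Sᶜ, ENNReal.ofReal (ell (g ω) w.2) ∂Q} with hE7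
  set E8 := {w : (Fin n → Fin q → ℝ) × (Fin n → ℝ) | ENNReal.ofReal (δ / 4) ≤ X3 Q g G (q * T') (lam / 8) w.1 w.2} with hE8
  have p0 : Pdat n Pz E0 = 0 := ev0 Pz Bz hb
  have p1 : Pdat n Pz E1 ≤ ENNReal.ofReal (γ / 8) :=
    (ev1 Pz Λ (by linarith) hn).trans (ENNReal.ofReal_le_ofReal b1)
  have p2 : Pdat n Pz (⋃ i, E2 i) ≤ ENNReal.ofReal (γ / 8) :=
    meas_iUnion_fin _ _ _ _ (fun jk => ev2 Pz Bz hBz.le hb ϱ' hϱ' hn jk.1 jk.2)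
      (by rw [Fintype.card_prod, Fintype.card_fin]; push_cast; rw [← sq]; exact b2)
  have p3 : Pdat n Pz (⋃ i, E3 i) ≤ ENNReal.ofReal (γ / 8) :=
    meas_iUnion_fin _ _ _ _ (fun j => ev3 Pz Bz hBz.le hb T' hT' hn j) (by rw [Fintype.card_fin]; exact b3)
  have p4 : Pdat n Pz (⋃ i, E4 i) ≤ ENNReal.ofReal (γ / 8) :=
    meas_iUnion_fin _ _ _ _ (fun k => ev4e Pz (a k) G' hG' (ha k) s' hs' hn) (by rw [Fintype.card_fin]; exact b4)
  have p5 : Pdat n Pz (⋃ i, E5 i) ≤ ENNReal.ofReal (γ / 8) :=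
    meas_iUnion_fin _ _ _ _ (fun kj => ev4z Pz Bz hBz hb hmean (a kj.1) G' hG' (ha kj.1) s' hs' hn kj.2)
      (by rw [Fintype.card_prod, Fintype.card_fin, Fintype.card_fin]; push_cast; exact b5)
  have ht' : ENNReal.ofReal t ≠ 0 := by simpa using ht
  have p6 : Pdat n Pz E6 ≤ ENNReal.ofReal (γ / 8) := by
    refine (evA1 Q Pz g hg hn Sᶜ β₀ _ ht' ENNReal.ofReal_ne_top).trans ?_
    refine le_trans ?_ (ofReal_div_le' _ _ _ ht b6)
    rw [ENNReal.ofReal_mul hQS0]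
    gcongr
  have p7 : Pdat n Pz E7 ≤ ENNReal.ofReal (γ / 8) := by
    refine (evA2 Q Pz g hg Sᶜ _ ht' ENNReal.ofReal_ne_top).trans ?_
    refine le_trans ?_ (ofReal_div_le' _ _ _ ht b7)
    gcongr
  have p8 : Pdat n Pz E8 ≤ ENNReal.ofReal (γ / 8) := by
    refine (evA3 Q Pz g hg hn Bz hb hmean G hGm τ hτ (fun ω hω => hω.2) _ _ _
      (by simpa using hδ) ENNReal.ofReal_ne_top).trans ?_
    refine le_trans ?_ (ofReal_div_le' _ _ _ (by positivity) b8)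
    refine ENNReal.div_le_div_right ?_ _
    refine (bd_int _ _ Bz τ hτ hBτ).trans ?_
    rw [ENNReal.ofReal_mul (p := τ * (1 + 2 * Bz ^ 2)) (by positivity)]
    exact mul_le_mul_right hCD2 _
  have hsub : {w : (Fin n → Fin q → ℝ) × (Fin n → ℝ) | ENNReal.ofReal δ < JU Q M g w.1 w.2 β₀} ⊆
      E0 ∪ E1 ∪ (⋃ i, E2 i) ∪ (⋃ i, E3 i) ∪ (⋃ i, E4 i) ∪ (⋃ i, E5 i) ∪ E6 ∪ E7 ∪ E8 := by
    intro w hw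
    by_contra hc
    simp only [Set.mem_union, Set.mem_iUnion, not_or, not_exists] at hc
    obtain ⟨⟨⟨⟨⟨⟨⟨⟨c0, c1⟩, c2⟩, c3⟩, c4⟩, c5⟩, c6⟩, c7⟩, c8⟩ := hc
    simp only [hE0, hE1, hE2, hE3, hE4, hE5, hE6, hE7, hE8, Set.mem_setOf_eq, not_lt, not_le, not_not] at c0 c1 c2 c3 c4 c5 c6 c7 c8
    have habs := sum_abs_le w.2 Λ hΛ c1
    have e2 := det_e2 w.1 M hn ϱ' (fun j k => by rw [hMd]; exact c2 (j, k))
    have e3 : ∀ u, |u ⬝ᵥ Wv w.1 w.2| ≤ (q * T') * ‖u‖ := fun u => det_dot _ u T' c3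
    have e4 : ∀ ω ∈ S, |∑ i, w.2 i * g ω i| ≤ s * n := by
      intro ω hω
      obtain ⟨k, hk⟩ := hcov ω hω
      have := det_e4 (a k) (g ω) w.2 s' δc Λ hδc habs hk (c4 k)
      simp only [mul_comm (w.2 _)]
      refine this.trans ?_
      gcongr
    have e4' : ∀ u, ∀ ω ∈ S, |∑ i, g ω i * (w.1 i ⬝ᵥ u)| ≤ s * n * ‖u‖ := by
      intro u ω hω
      obtain ⟨k, hk⟩ := hcov ω hω
      have h1 : ∀ j, |∑ i, g ω i * w.1 i j| ≤ (s' + δc * Bz) * n := by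
        intro j
        refine det_e4 (a k) (g ω) (fun i => w.1 i j) s' δc Bz hδc ?_ hk (c5 (k, j))
        calc ∑ i, |w.1 i j| ≤ ∑ i : Fin n, Bz := by
              refine Finset.sum_le_sum fun i _ => le_trans ?_ (c0 i)
              exact Finset.single_le_sum (f := fun j => |w.1 i j|) (fun j _ => abs_nonneg _) (Finset.mem_univ j)
          _ = Bz * n := by simp; ring
      have h2 : ∑ i, g ω i * (w.1 i ⬝ᵥ u) = u ⬝ᵥ (fun j => ∑ i, g ω i * w.1 i j) := by
        unfold dotProduct
        simp only [Finset.mul_sum]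
        rw [Finset.sum_comm]
        exact Finset.sum_congr rfl fun _ _ => Finset.sum_congr rfl fun _ _ => by ring
      rw [h2]
      refine (det_dot _ u _ h1).trans ?_
      have : (q:ℝ) * ((s' + δc * Bz) * n) ≤ s * n := by
        rw [← mul_assoc]; gcongr
      gcongr
    have hZ : ζ ≤ ZU Q g w.2 := det_Z Q g hg w.2 Λ τ' hΛ hτ0 hτ1 c1 v hv
    have c7' : ∫ ω in Sᶜ, ell (g ω) w.2 ∂Q ≤ t := by
      rw [integral_eq_lintegral_of_nonneg_ae (Eventually.of_forall fun ω => (ell_pos _ _).le)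
        ((ell_meas.comp (f := fun ω : Ω => (g ω, w.2)) (by fun_prop)).aestronglyMeasurable)]
      exact ENNReal.toReal_le_of_le_ofReal ht.le c7.le
    have hJ := JU_bound Q hn M g hg w.1 w.2 β₀ S hS lam (q ^ 2 * ϱ') (q * T') s τ ζ r hlam (by positivity) hϱ hs
      hsτ hM e2 e3 e4 e4' hζ0 hZ (by
        refine le_trans ?_ hr
        gcongr)
    have : JU Q M g w.1 w.2 β₀ ≤ ENNReal.ofReal (δ/4) + ENNReal.ofReal (δ/4) + ENNReal.ofReal (δ/4) := by
      refine hJ.trans ?_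
      refine add_le_add (add_le_add ?_ ?_) c8.le
      · refine (mul_le_mul_right c6.le _).trans ?_
        rw [← ENNReal.ofReal_mul (by positivity)]
        exact ENNReal.ofReal_le_ofReal htz
      · refine (mul_le_mul_right hCD _).trans ?_
        rw [← ENNReal.ofReal_mul hr0]
        exact ENNReal.ofReal_le_ofReal hrC
    rw [← ENNReal.ofReal_add (by positivity) (by positivity), ← ENNReal.ofReal_add (by positivity) (by positivity)] at this
    have h3 := lt_of_lt_of_le hw this
    rw [ENNReal.ofReal_lt_ofReal_iff (by positivity)] at h3
    linarith
  refine (measure_mono hsub).trans ?_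
  have hsum : Pdat n Pz (E0 ∪ E1 ∪ (⋃ i, E2 i) ∪ (⋃ i, E3 i) ∪ (⋃ i, E4 i) ∪ (⋃ i, E5 i) ∪ E6 ∪ E7 ∪ E8) ≤
      0 + ENNReal.ofReal (γ/8) + ENNReal.ofReal (γ/8) + ENNReal.ofReal (γ/8) + ENNReal.ofReal (γ/8)
       + ENNReal.ofReal (γ/8) + ENNReal.ofReal (γ/8) + ENNReal.ofReal (γ/8) + ENNReal.ofReal (γ/8) := by
    refine (measure_union_le _ _).trans (add_le_add ?_ p8)
    refine (measure_union_le _ _).trans (add_le_add ?_ p7)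
    refine (measure_union_le _ _).trans (add_le_add ?_ p6)
    refine (measure_union_le _ _).trans (add_le_add ?_ p5)
    refine (measure_union_le _ _).trans (add_le_add ?_ p4)
    refine (measure_union_le _ _).trans (add_le_add ?_ p3)
    refine (measure_union_le _ _).trans (add_le_add ?_ p2)
    exact (measure_union_le _ _).trans (add_le_add p0.le p1)
  refine hsum.trans (le_of_eq ?_)
  rw [zero_add]
  have hp : (0:ℝ) ≤ γ / 8 := by positivity
  have h8 : ENNReal.ofReal γ = 8 * ENNReal.ofReal (γ / 8) := by
    conv_lhs => rw [show γ = 8 * (γ / 8) by ring]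
    rw [ENNReal.ofReal_mul (by norm_num)]; norm_num
  rw [h8]; ring

theorem fixed_design {Ω X : Type*} [MeasurableSpace Ω] (Q : Measure Ω) [IsProbabilityMeasure Q] {q : ℕ}
    (D : Set X) (Ψ : Ω → X → ℝ) (hΨ : ∀ x, Measurable fun ω => Ψ ω x) (η₀ : X → ℝ) (B0 : ℝ)
    (hη : ∀ x ∈ D, |η₀ x| ≤ B0) (M : Matrix (Fin q) (Fin q) ℝ)
    (β₀ : Fin q → ℝ) (Pz : Measure (Fin q → ℝ)) [IsProbabilityMeasure Pz] (Bz : ℝ) (hBz : 0 < Bz)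
    (hb : ∀ᵐ z ∂Pz, ∑ j, |z j| ≤ Bz) (hmean : ∀ j, ∫ z, z j ∂Pz = 0)
    (hMd : ∀ j k, M j k = ∫ z, z j * z k ∂Pz) (lam : ℝ) (hlam : 0 < lam)
    (hM : ∀ u, lam * ‖u‖ ^ 2 ≤ u ⬝ᵥ M.mulVec u)
    (H2 : ∀ τ : ℝ, 0 < τ → ∃ A : Set Ω, 0 < Q A ∧ ∀ ω ∈ A, ∀ x ∈ D, |Ψ ω x - η₀ x| ≤ τ)
    (G0 : ℝ) (hG0 : 0 < G0)
    (H3 : ∀ δ : ℝ, 0 < δ → ∀ κ : ℝ, 0 < κ → ∃ c C : ℝ, 0 < c ∧ 0 < C ∧ ∀ᶠ n : ℕ in atTop,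
      ∃ S : Set Ω, MeasurableSet S ∧ Q Sᶜ ≤ ENNReal.ofReal (C * Real.exp (-c * n)) ∧
        ∃ (N : ℕ) (f : Fin N → X → ℝ), (N:ℝ) ≤ C * Real.exp (κ * n) ∧ (∀ k, ∀ x ∈ D, |f k x| ≤ G0) ∧
          ∀ ω ∈ S, ∃ k, ∀ x ∈ D, |Ψ ω x - f k x| ≤ δ) :
    ∀ δ : ℝ, 0 < δ → ∀ γ : ℝ, 0 < γ → ∀ᶠ n : ℕ in atTop, ∀ x : Fin n → X, (∀ i, x i ∈ D) →
      Pdat n Pz {w | ENNReal.ofReal δ < JU Q M (fun ω i => Ψ ω (x i) - η₀ (x i)) w.1 w.2 β₀} ≤ ENNReal.ofReal γ := by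
  intro δ hδ γ hγ
  obtain ⟨Λ, hΛ1, hΛ⟩ : ∃ Λ : ℝ, 1 ≤ Λ ∧ 1 / Λ ≤ γ / 8 := by
    refine ⟨max 1 (8 / γ), le_max_left _ _, ?_⟩
    rw [div_le_iff₀ (by positivity)]
    calc (1:ℝ) = γ / 8 * (8 / γ) := by field_simp
      _ ≤ _ := by gcongr; exact le_max_right _ _
  have hB2 : 0 < Bz ^ 2 := by positivity
  obtain ⟨T', hT', b3⟩ : ∃ T' : ℝ, 0 ≤ T' ∧ (q:ℝ) * (2 * Real.exp (-T' ^ 2 / (2 * Bz ^ 2))) ≤ γ / 8 := by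
    obtain ⟨n, hn⟩ := (ev_exp (1 / (2 * Bz ^ 2)) (q * 2) (γ / 8) (by positivity) (by positivity)).exists
    refine ⟨Real.sqrt n, Real.sqrt_nonneg _, ?_⟩
    rw [Real.sq_sqrt (by positivity), ← mul_assoc]
    convert hn using 3; ring
  have hD1 := Dd_fin (q := q) (q * T') (lam / 8) (by positivity) (by positivity)
  have hD2 := Dd_fin (q := q) (q * T') (lam / 8 / 2) (by positivity) (by positivity)
  set CD := (∫⁻ u : Fin q → ℝ, ENNReal.ofReal (Dd (q * T') (lam / 8) u * (1 + ‖u‖ + ‖u‖ ^ 2))).toReal with hCD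
  set CD2 := (∫⁻ u : Fin q → ℝ, ENNReal.ofReal (Dd (q * T') (lam / 8 / 2) u * (1 + ‖u‖ + ‖u‖ ^ 2))).toReal with hCD2
  have hCD0 : 0 ≤ CD := ENNReal.toReal_nonneg
  have hCDe := (ENNReal.ofReal_toReal hD1.ne).ge
  have hCD2e := (ENNReal.ofReal_toReal hD2.ne).ge
  obtain ⟨τ, hτ, hτ1, b8, hBτ0⟩ := ex_small ((1 + 2 * Bz ^ 2) * CD2) (2 * Bz ^ 2) (δ / 4 * (γ / 8)) (lam / 8 / 2) (by positivity) (by positivity)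
  have hBτ : 2 * Bz ^ 2 * τ ^ 2 ≤ lam / 8 / 2 := by nlinarith [mul_pos hτ hB2]
  obtain ⟨s, hs, hs1, hs2, -⟩ := ex_small (1 + 2 / lam) 0 (τ ^ 2 / 4) 1 (by positivity) one_pos
  have hsτ : s + 2 * s ^ 2 / lam ≤ τ ^ 2 / 4 := by
    refine le_trans ?_ hs2
    have : 2 * s ^ 2 / lam ≤ s * (2 / lam) := by
      rw [mul_div_assoc', mul_comm]
      gcongr; nlinarith
    linarith
  obtain ⟨s', hs', -, hsa, hsb⟩ := ex_small (1 + Λ) (q * (1 + Bz)) s s hs hs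
  have hss : s' + s' * Λ ≤ s := by linarith
  have hss2 : q * (s' + s' * Bz) ≤ s := by linarith
  set G' := G0 + |B0| with hG'
  have hG'0 : 0 < G' := by positivity
  obtain ⟨κ, hκ, hκ4, hκ5⟩ : ∃ κ : ℝ, 0 < κ ∧ κ < s' ^ 2 / (2 * G' ^ 2) ∧ κ < s' ^ 2 / (2 * (Bz * G') ^ 2) := by
    have h1 : 0 < s' ^ 2 / (2 * G' ^ 2) := by positivity
    have h2 : 0 < s' ^ 2 / (2 * (Bz * G') ^ 2) := by positivity
    obtain ⟨κ, h3, h4⟩ := exists_between (lt_min h1 h2)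
    exact ⟨κ, h3, h4.trans_le (min_le_left _ _), h4.trans_le (min_le_right _ _)⟩
  obtain ⟨c, C, hc, hC, hev⟩ := H3 s' hs' κ hκ
  obtain ⟨τ', hτ', hτ'1, hτa, hτb⟩ := ex_small (Λ + 1) (Λ + 1) (τ ^ 2 / 8) (c / 4) (by positivity) (by positivity)
  obtain ⟨A, hA0, hA⟩ := H2 τ' hτ'
  set v := Q.real A with hv
  have hv0 : 0 < v := ENNReal.toReal_pos hA0.ne' (measure_ne_top _ _)
  obtain ⟨r0, hr0, -, hrC, -⟩ := ex_small CD 0 (δ / 4) 1 (by positivity) one_pos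
  obtain ⟨ϱ', hϱ', -, hϱ1, hϱ2⟩ := ex_small (q ^ 2) (q ^ 2 / 2) (lam / 2) (r0 / 2) (by positivity) (by positivity)
  set I := ∫ b : Fin q → ℝ, psi b with hI
  have hI0 : 0 ≤ I := integral_nonneg fun b => (psi_pos b).le
  have hτ2 : 0 < τ ^ 2 := by positivity
  filter_upwards [hev, eventually_ge_atTop 1,
    ev_exp (ϱ' ^ 2 / (2 * Bz ^ 4)) (q ^ 2 * 2) (γ / 8) (by positivity) (by positivity),
    ev_exp (s' ^ 2 / (2 * G' ^ 2) - κ) (C * 2) (γ / 8) (by linarith) (by positivity),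
    ev_exp (s' ^ 2 / (2 * (Bz * G') ^ 2) - κ) (C * q * 2) (γ / 8) (by linarith) (by positivity),
    ev_pow_exp q (c / 2) (C * I) (γ / 8) (by positivity) (by positivity),
    ev_exp (c / 2) C (γ / 8) (by positivity) (by positivity),
    ev_exp (τ ^ 2 / 4 - τ' * (Λ + 1)) (2 / v) (r0 / 8) (by linarith) (by positivity),
    ev_exp (c / 2 - τ' * (Λ + 1)) v⁻¹ (r0 / 8) (by linarith) (by positivity),
    ev_exp (c / 2 - τ' * (Λ + 1)) v⁻¹ (δ / 4) (by linarith) (by positivity),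
    ev_sqrt (∑ j, |β₀ j|) q (r0 / 4) (by positivity)]
    with n hSn hn a2 a4 a5 a6 a7 a8 a9 a10 a11 x hx
  obtain ⟨S, hS, hQS, N, f, hN, hf, hcov⟩ := hSn
  have hexp : ∀ k : ℝ, Real.exp (κ * n) * Real.exp (-k * n) = Real.exp (-(k - κ) * n) := by
    intro k; rw [← Real.exp_add]; ring_nf
  have ht9 : ∀ w : ℝ, v⁻¹ * Real.exp (-(w - τ' * (Λ + 1)) * n) = Real.exp (-w * n) / (v * Real.exp (-(τ' * (Λ + 1)) * n)) := by
    intro w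
    rw [show -(w - τ' * (Λ + 1)) * (n:ℝ) = -w * n - (-(τ' * (Λ + 1)) * n) by ring, Real.exp_sub]
    field_simp
  have hn1 : (1:ℝ) ≤ n := by exact_mod_cast hn
  refine fd_core Q hn M _ (measurable_pi_lambda _ fun i => (hΨ (x i)).sub_const _) β₀ Pz Bz hBz hb hmean hMd lam hlam hM
    Λ T' τ s s' s' G' ϱ' τ' v r0 (Real.exp (-(c / 2) * n)) δ γ CD CD2 (C * Real.exp (-c * n)) hΛ1 hT' hτ hsτ hs.le hs'.le
    hs'.le hss hss2 hG'0 hϱ'.le (by linarith) hτ'.le hτ'1 hv0 (Real.exp_pos _) hδ hγ ?_ hCDe hCD2e hr0.le S hS hQS (by positivity)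
    N (fun k i => f k (x i) - η₀ (x i)) ?_ ?_ ?_ hrC ?_ hBτ hΛ ?_ b3 ?_ ?_ ?_ ?_ ?_
  · exact measureReal_mono fun ω hω i => hA ω hω _ (hx i)
  · intro k i
    refine (abs_sub _ _).trans (add_le_add (hf k _ (hx i)) ((hη _ (hx i)).trans (le_abs_self _)))
  · intro ω hω
    obtain ⟨k, hk⟩ := hcov ω hω
    refine ⟨k, fun i => ?_⟩
    have := hk _ (hx i)
    simpa using this
  · rw [← ht9]
    have : 2 * Real.exp (-(n * τ ^ 2 / 4)) / (v * Real.exp (-(τ' * (Λ + 1)) * n)) ≤ r0 / 8 := by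
      refine le_trans (le_of_eq ?_) a8
      rw [div_eq_mul_inv 2 v, mul_assoc, ht9, mul_div_assoc]
      congr 3; ring
    linarith
  · rw [inv_mul_eq_div, ← ht9]; exact a10
  · rw [← mul_assoc]; refine le_trans (le_of_eq ?_) a2
    congr 2; ring
  · calc _ ≤ (C * Real.exp (κ * n)) * (2 * Real.exp (-(s' ^ 2 / (2 * G' ^ 2)) * n)) := by gcongr
      _ = C * 2 * (Real.exp (κ * n) * Real.exp (-(s' ^ 2 / (2 * G' ^ 2)) * n)) := by ring
      _ ≤ _ := by rw [hexp]; exact a4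
  · calc _ ≤ (C * Real.exp (κ * n)) * q * (2 * Real.exp (-(s' ^ 2 / (2 * (Bz * G') ^ 2)) * n)) := by gcongr
      _ = C * q * 2 * (Real.exp (κ * n) * Real.exp (-(s' ^ 2 / (2 * (Bz * G') ^ 2)) * n)) := by ring
      _ ≤ _ := by rw [hexp]; exact a5
  · have e1 : Real.exp (-c * n) = Real.exp (-(c / 2) * n) * Real.exp (-(c / 2) * n) := by
      rw [← Real.exp_add]; ring_nf
    have e2 : Real.sqrt n ^ q ≤ (n:ℝ) ^ q := by
      gcongr
      exact Real.sqrt_le_self_iff.2 (Or.inr hn1)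
    calc _ ≤ C * Real.exp (-c * n) * ((n:ℝ) ^ q * I) := by gcongr
      _ = Real.exp (-(c / 2) * n) * (C * I * ((n:ℝ) ^ q * Real.exp (-(c / 2) * n))) := by rw [e1]; ring
      _ ≤ _ := by gcongr
  · have e1 : Real.exp (-c * n) = Real.exp (-(c / 2) * n) * Real.exp (-(c / 2) * n) := by
      rw [← Real.exp_add]; ring_nf
    calc _ = Real.exp (-(c / 2) * n) * (C * Real.exp (-(c / 2) * n)) := by rw [e1]; ring
      _ ≤ _ := by gcongr
  · linarith

abbrev Par (p m K : ℕ) := ((Fin p → Fin K) → Fin p → ℝ) × ((Fin p → Fin K) → (Fin p → Fin (m + 1)) → ℝ) × ℝ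

def Ph {p : ℕ} (φ : (Fin p → ℝ) → ℝ) (m K : ℕ) (θ : Par p m K) : (Fin p → ℝ) → ℝ :=
  kmpFun φ K m θ.2.2 (fun k => center K k + (2 * (K : ℝ))⁻¹ • θ.1 k) θ.2.1

def arg {p m K : ℕ} (θ : Par p m K) (k : Fin p → Fin K) (x : Fin p → ℝ) : Fin p → ℝ :=
  fun j => (x j - (center K k + (2 * (K : ℝ))⁻¹ • θ.1 k) j) / θ.2.2

def Pk {p m K : ℕ} (θ : Par p m K) (k : Fin p → Fin K) (x : Fin p → ℝ) : ℝ :=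
  ∑ s ∈ mIdx p m, θ.2.1 k s * mono K m k s x

def box (p m : ℕ) (B hmin hmax : ℝ) (K : ℕ) : Set (Par p m K) :=
  {θ | (∀ k j, |θ.1 k j| ≤ 1) ∧ (∀ k s, |θ.2.1 k s| ≤ B) ∧ hmin / K ≤ θ.2.2 ∧ θ.2.2 ≤ hmax / K}

def nearS {p : ℕ} (K : ℕ) (R : ℝ) (x : Fin p → ℝ) : Finset (Fin p → Fin K) :=
  Finset.univ.filter fun k => ∀ j, |K * x j - (k j : ℕ)| ≤ R

lemma Ph_eq {p m K : ℕ} (φ : (Fin p → ℝ) → ℝ) (θ : Par p m K) (x : Fin p → ℝ) :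
    Ph φ m K θ x = (∑ k, φ (arg θ k x) * Pk θ k x) / ∑ k, φ (arg θ k x) := by
  unfold Ph kmpFun weight Pk arg
  rw [Finset.sum_div]
  refine Finset.sum_congr rfl fun k _ => ?_
  rw [Finset.mul_sum, Finset.sum_div]
  refine Finset.sum_congr rfl fun s _ => ?_
  ring

lemma Ph_meas {p m K : ℕ} (φ : (Fin p → ℝ) → ℝ) (hφ : Continuous φ) : Measurable (Ph φ m K) := by
  refine measurable_pi_lambda _ fun x => ?_
  simp only [Ph_eq]
  have h : ∀ k, Measurable fun θ : Par p m K => φ (arg θ k x) := by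
    intro k
    refine hφ.measurable.comp ?_
    unfold arg
    refine measurable_pi_lambda _ fun j => ?_
    simp only [Pi.add_apply, Pi.smul_apply, smul_eq_mul]
    fun_prop
  have h2 : ∀ k, Measurable fun θ : Par p m K => Pk θ k x := by
    intro k; unfold Pk; fun_prop
  exact (Finset.measurable_sum _ fun k _ => (h k).mul (h2 k)).div (Finset.measurable_sum _ fun k _ => h k)

lemma box_meas {p m K : ℕ} (B hmin hmax : ℝ) : MeasurableSet (box p m B hmin hmax K) := by
  simp only [box, Set.setOf_and, Set.setOf_forall]
  refine MeasurableSet.inter ?_ (MeasurableSet.inter ?_ (MeasurableSet.inter ?_ ?_))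
  · exact MeasurableSet.iInter fun k => MeasurableSet.iInter fun j => measurableSet_le (by fun_prop) (by fun_prop)
  · exact MeasurableSet.iInter fun k => MeasurableSet.iInter fun j => measurableSet_le (by fun_prop) (by fun_prop)
  · exact measurableSet_le (by fun_prop) (by fun_prop)
  · exact measurableSet_le (by fun_prop) (by fun_prop)

lemma near_card {p : ℕ} (K : ℕ) (R : ℝ) (hR : 0 ≤ R) (x : Fin p → ℝ) :
    ((nearS K R x).card : ℝ) ≤ (2 * R + 1) ^ p := by
  have h1 : ∀ j, ((Finset.univ.filter fun i : Fin K => |K * x j - (i : ℕ)| ≤ R).card : ℝ) ≤ 2 * R + 1 := by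
    intro j
    have hle : (Finset.univ.filter fun i : Fin K => |K * x j - (i : ℕ)| ≤ R).card ≤
        (Finset.Icc ⌈K * x j - R⌉ ⌊K * x j + R⌋).card := by
      refine Finset.card_le_card_of_injOn (fun i => ((i:ℕ):ℤ)) ?_ ?_
      · intro i hi
        simp only [Finset.coe_filter, Finset.mem_univ, true_and, Set.mem_setOf_eq] at hi
        rw [abs_le] at hi
        simp only [Finset.coe_Icc, Set.mem_Icc]
        rw [Int.ceil_le, Int.le_floor]
        push_cast
        constructor <;> linarith [hi.1, hi.2]
      · intro a _ b _ hab
        simp only [Nat.cast_inj] at hab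
        exact Fin.ext hab
    refine (Nat.cast_le.2 hle).trans ?_
    rw [Int.card_Icc]
    have h3 : ((⌊K * x j + R⌋ + 1 - ⌈K * x j - R⌉ : ℤ) : ℝ) ≤ 2 * R + 1 := by
      push_cast
      linarith [Int.floor_le (K * x j + R), Int.le_ceil (K * x j - R)]
    by_cases h0 : 0 ≤ ⌊K * x j + R⌋ + 1 - ⌈K * x j - R⌉
    · have : (((⌊K * x j + R⌋ + 1 - ⌈K * x j - R⌉).toNat : ℤ) : ℝ) ≤ 2 * R + 1 := by
        rw [Int.toNat_of_nonneg h0]; exact h3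
      exact_mod_cast this
    · rw [Int.toNat_of_nonpos (by omega)]
      simp; linarith
  have h2 : nearS K R x = Fintype.piFinset fun j => Finset.univ.filter fun i : Fin K => |K * x j - (i : ℕ)| ≤ R := by
    ext k; simp [nearS, Fintype.mem_piFinset]
  rw [h2, Fintype.card_piFinset]
  push_cast
  calc _ ≤ ∏ j : Fin p, (2 * R + 1) := Finset.prod_le_prod (fun _ _ => by positivity) fun j _ => h1 j
    _ = _ := by simp

lemma mono_le {p m K : ℕ} (hK : 1 ≤ K) (k : Fin p → Fin K) (s : Fin p → Fin (m + 1)) (x : Fin p → ℝ)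
    (hx : x ∈ cube p) : |mono K m k s x| ≤ 1 := by
  unfold mono
  rw [Finset.abs_prod]
  refine Finset.prod_le_one (fun _ _ => abs_nonneg _) fun j _ => ?_
  rw [abs_pow]
  refine pow_le_one₀ (abs_nonneg _) ?_
  have hK0 : (0:ℝ) < K := by exact_mod_cast hK
  have h1 : 0 ≤ center K k j := by unfold center; positivity
  have h2 : center K k j ≤ 1 := by
    unfold center
    rw [div_le_one (by positivity)]
    have : ((k j : ℕ):ℝ) + 1 ≤ K := by exact_mod_cast (k j).2
    linarith
  have := hx j
  rw [abs_le]; constructor <;> linarith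

lemma Pk_le {p m K : ℕ} (hK : 1 ≤ K) (θ : Par p m K) (B : ℝ) (k : Fin p → Fin K) (h : ∀ s, |θ.2.1 k s| ≤ B) (hB : 0 ≤ B)
    (x : Fin p → ℝ) (hx : x ∈ cube p) : |Pk θ k x| ≤ (mIdx p m).card * B := by
  unfold Pk
  calc _ ≤ ∑ s ∈ mIdx p m, B := by
        refine (Finset.abs_sum_le_sum_abs _ _).trans (Finset.sum_le_sum fun s _ => ?_)
        rw [abs_mul]
        calc _ ≤ B * 1 := mul_le_mul (h s) (mono_le hK k s x hx) (abs_nonneg _) hB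
          _ = B := mul_one _
    _ = _ := by simp

lemma arg_mul {p m K : ℕ} (hK : 1 ≤ K) (θ : Par p m K) (k : Fin p → Fin K) (x : Fin p → ℝ) (j : Fin p) :
    arg θ k x j = (K * x j - (k j : ℕ) - 1 / 2 - θ.1 k j / 2) / (K * θ.2.2) := by
  have hK0 : (0:ℝ) < K := by exact_mod_cast hK
  unfold arg center
  simp only [Pi.add_apply, Pi.smul_apply, smul_eq_mul]
  by_cases h : θ.2.2 = 0
  · simp [h]
  · field_simp
    ring

lemma box_h {p m K : ℕ} (hK : 1 ≤ K) {B hmin hmax : ℝ} {θ : Par p m K} (hθ : θ ∈ box p m B hmin hmax K) :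
    hmin ≤ K * θ.2.2 ∧ K * θ.2.2 ≤ hmax := by
  have hK0 : (0:ℝ) < K := by exact_mod_cast hK
  obtain ⟨-, -, h1, h2⟩ := hθ
  rw [div_le_iff₀ hK0] at h1
  rw [le_div_iff₀ hK0] at h2
  constructor <;> linarith

lemma phi_active {p m K : ℕ} (hK : 1 ≤ K) {B hmin hmax : ℝ} (hh1 : 1 < hmin) {φ : (Fin p → ℝ) → ℝ} (hφ : IsBoxedKernel φ)
    {θ : Par p m K} (hθ : θ ∈ box p m B hmin hmax K) (k : Fin p → Fin K) (x : Fin p → ℝ)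
    (h : k ∉ nearS K (hmax + 1) x) : φ (arg θ k x) = 0 := by
  apply hφ.2.2.1
  by_contra hc
  push Not at hc
  apply h
  simp only [nearS, Finset.mem_filter, Finset.mem_univ, true_and]
  intro j
  have h1 := (norm_le_pi_norm (arg θ k x) j).trans hc
  obtain ⟨h2, h3⟩ := box_h hK hθ
  have h4 := abs_le.1 (hθ.1 k j)
  rw [arg_mul hK, Real.norm_eq_abs, abs_div, abs_of_pos (by linarith : 0 < K * θ.2.2), div_le_one (by linarith), abs_le] at h1
  rw [abs_le]; constructor <;> linarith [h1.1, h1.2]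

lemma den_low {p m K : ℕ} (hp : 0 < p) (hK : 1 ≤ K) {B hmin hmax : ℝ} (hh1 : 1 < hmin) {φ : (Fin p → ℝ) → ℝ} (hφ : IsBoxedKernel φ)
    {θ : Par p m K} (hθ : θ ∈ box p m B hmin hmax K) (x : Fin p → ℝ) (hx : x ∈ cube p) :
    φ (fun _ => 1 / hmin) ≤ ∑ k, φ (arg θ k x) := by
  have hK0 : (0:ℝ) < K := by exact_mod_cast hK
  have hex : ∀ j, ∃ i : Fin K, |K * x j - (i : ℕ) - 1 / 2| ≤ 1 / 2 := by
    intro j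
    obtain ⟨hx0, hx1⟩ := hx j
    by_cases h1 : x j = 1
    · refine ⟨⟨K - 1, by omega⟩, ?_⟩
      rw [h1]
      simp only
      rw [Nat.cast_sub hK]
      rw [abs_le]; push_cast; constructor <;> linarith
    · have hlt : K * x j < K := by
        have : x j < 1 := lt_of_le_of_ne hx1 h1
        nlinarith
      have h0 : 0 ≤ K * x j := by positivity
      refine ⟨⟨⌊K * x j⌋₊, by rw [Nat.floor_lt h0]; exact hlt⟩, ?_⟩
      simp only
      rw [abs_le]
      constructor <;> linarith [Nat.floor_le h0, Nat.lt_floor_add_one (K * x j)]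
  choose k hk using hex
  refine le_trans ?_ (Finset.single_le_sum (f := fun k => φ (arg θ k x)) (fun k _ => (hφ.2.1 _).1) (Finset.mem_univ k))
  apply hφ.2.2.2
  have : Nonempty (Fin p) := ⟨⟨0, hp⟩⟩
  have e : ‖(fun _ => 1 / hmin : Fin p → ℝ)‖ = 1 / hmin := by
    rw [pi_norm_const, Real.norm_eq_abs, abs_of_pos (by positivity)]
  rw [e, pi_norm_le_iff_of_nonneg (by positivity)]
  intro j
  obtain ⟨h2, h3⟩ := box_h hK hθ
  rw [arg_mul hK, Real.norm_eq_abs, abs_div, abs_of_pos (by linarith : 0 < K * θ.2.2)]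
  refine div_le_div₀ zero_le_one ?_ (by linarith) h2
  have h4 := abs_le.1 (hθ.1 k j)
  have h5 := abs_le.1 (hk j)
  rw [abs_le]; constructor <;> linarith [h5.1, h5.2]

lemma ratio_bound {ι : Type*} [Fintype ι] (a a' P P' : ι → ℝ) (F : Finset ι) (A c0 ε ε' Pm : ℝ) (hc0 : 0 < c0)
    (ha0' : ∀ k, 0 ≤ a' k) (ha1' : ∀ k, a' k ≤ 1) (hD : c0 ≤ ∑ k, a k) (hD' : c0 ≤ ∑ k, a' k)
    (hP : ∀ k, |P k| ≤ Pm) (hP' : ∀ k, |P' k| ≤ Pm) (hPP : ∀ k, |P k - P' k| ≤ ε') (hε : 0 ≤ ε) (hε' : 0 ≤ ε') (hPm : 0 ≤ Pm)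
    (haa : ∀ k ∈ F, |a k - a' k| ≤ ε) (hoff : ∀ k, k ∉ F → a k = 0) (hoff' : ∀ k, k ∉ F → a' k = 0) (hF : (F.card : ℝ) ≤ A) :
    |(∑ k, a k * P k) / (∑ k, a k) - (∑ k, a' k * P' k) / ∑ k, a' k| ≤ (2 * A * ε * Pm + A * ε') / c0 := by
  set D := ∑ k, a k with hDd
  set D' := ∑ k, a' k with hDd'
  set N := ∑ k, a k * P k with hN
  set N' := ∑ k, a' k * P' k with hN'
  have hA : 0 ≤ A := le_trans (by positivity) hF
  have hD0 : 0 < D := lt_of_lt_of_le hc0 hD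
  have hD0' : 0 < D' := lt_of_lt_of_le hc0 hD'
  have sF : ∀ f : ι → ℝ, (∀ k, k ∉ F → f k = 0) → ∑ k, f k = ∑ k ∈ F, f k := by
    intro f hf
    exact (Finset.sum_subset (Finset.subset_univ F) fun k _ hk => hf k hk).symm
  have h1 : |N - N'| ≤ A * (ε * Pm + ε') := by
    have : N - N' = ∑ k ∈ F, (a k * P k - a' k * P' k) := by
      rw [hN, hN', ← Finset.sum_sub_distrib]
      exact sF _ fun k hk => by rw [hoff k hk, hoff' k hk]; ring
    rw [this]
    calc _ ≤ ∑ k ∈ F, (ε * Pm + ε') := by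
          refine (Finset.abs_sum_le_sum_abs _ _).trans (Finset.sum_le_sum fun k hk => ?_)
          have : a k * P k - a' k * P' k = (a k - a' k) * P k + a' k * (P k - P' k) := by ring
          rw [this]
          refine (abs_add_le _ _).trans (add_le_add ?_ ?_)
          · rw [abs_mul]; exact mul_le_mul (haa k hk) (hP k) (abs_nonneg _) hε
          · rw [abs_mul, abs_of_nonneg (ha0' k)]
            calc _ ≤ 1 * ε' := mul_le_mul (ha1' k) (hPP k) (abs_nonneg _) zero_le_one
              _ = _ := one_mul _
      _ = F.card * (ε * Pm + ε') := by rw [Finset.sum_const, nsmul_eq_mul]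
      _ ≤ _ := by gcongr
  have h2 : |D' - D| ≤ A * ε := by
    have : D' - D = ∑ k ∈ F, (a' k - a k) := by
      rw [hDd, hDd', ← Finset.sum_sub_distrib]
      exact sF _ fun k hk => by rw [hoff k hk, hoff' k hk]; ring
    rw [this]
    calc _ ≤ ∑ k ∈ F, ε := by
          refine (Finset.abs_sum_le_sum_abs _ _).trans (Finset.sum_le_sum fun k hk => ?_)
          rw [abs_sub_comm]; exact haa k hk
      _ = F.card * ε := by simp
      _ ≤ _ := by gcongr
  have h3 : |N' / D'| ≤ Pm := by
    rw [abs_div, abs_of_pos hD0', div_le_iff₀ hD0', hDd', Finset.mul_sum]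
    refine (Finset.abs_sum_le_sum_abs _ _).trans (Finset.sum_le_sum fun k _ => ?_)
    rw [abs_mul, abs_of_nonneg (ha0' k), mul_comm]
    exact mul_le_mul_of_nonneg_right (hP' k) (ha0' k)
  have h4 : N / D - N' / D' = ((N - N') + (N' / D') * (D' - D)) / D := by
    field_simp; ring
  rw [h4, abs_div, abs_of_pos hD0]
  have h5 : |(N - N') + (N' / D') * (D' - D)| ≤ 2 * A * ε * Pm + A * ε' := by
    refine (abs_add_le _ _).trans ?_
    rw [abs_mul]
    have := mul_le_mul h3 h2 (abs_nonneg _) hPm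
    linarith
  exact div_le_div₀ (by positivity) h5 hc0 hD

lemma ratio_le {ι : Type*} [Fintype ι] (a P : ι → ℝ) (y b : ℝ) (ha : ∀ k, 0 ≤ a k) (hD : 0 < ∑ k, a k)
    (h : ∀ k, a k ≠ 0 → |P k - y| ≤ b) : |(∑ k, a k * P k) / (∑ k, a k) - y| ≤ b := by
  have : (∑ k, a k * P k) / (∑ k, a k) - y = (∑ k, a k * (P k - y)) / ∑ k, a k := by
    rw [div_sub' hD.ne']
    congr 1
    simp only [mul_sub, Finset.sum_sub_distrib, Finset.sum_mul]
  rw [this, abs_div, abs_of_pos hD, div_le_iff₀ hD, Finset.mul_sum]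
  refine (Finset.abs_sum_le_sum_abs _ _).trans (Finset.sum_le_sum fun k _ => ?_)
  rw [abs_mul, abs_of_nonneg (ha k)]
  by_cases h0 : a k = 0
  · simp [h0]
  · rw [mul_comm]; exact mul_le_mul_of_nonneg_right (h k h0) (ha k)

lemma Ph_le {p m K : ℕ} (hp : 0 < p) (hK : 1 ≤ K) {B hmin hmax : ℝ} (hB : 0 ≤ B) (hh1 : 1 < hmin) {φ : (Fin p → ℝ) → ℝ} (hφ : IsBoxedKernel φ)
    (hφpos : ∀ u : Fin p → ℝ, ‖u‖ < 1 → 0 < φ u)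
    {θ : Par p m K} (hθ : θ ∈ box p m B hmin hmax K) (x : Fin p → ℝ) (hx : x ∈ cube p) (hc : 0 < φ (fun _ => 1 / hmin)) :
    |Ph φ m K θ x| ≤ (mIdx p m).card * B := by
  rw [Ph_eq]
  have := ratio_le (fun k => φ (arg θ k x)) (fun k => Pk θ k x) 0 ((mIdx p m).card * B) (fun k => (hφ.2.1 _).1)
    (lt_of_lt_of_le hc (den_low hp hK hh1 hφ hθ x hx)) (fun k _ => by
      rw [sub_zero]; exact Pk_le hK θ B k (hθ.2.1 k) hB x hx)
  simpa using this

lemma c0_pos {p : ℕ} (hp : 0 < p) {hmin : ℝ} (hh1 : 1 < hmin) {φ : (Fin p → ℝ) → ℝ}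
    (hφpos : ∀ u : Fin p → ℝ, ‖u‖ < 1 → 0 < φ u) : 0 < φ (fun _ => 1 / hmin) := by
  apply hφpos
  have : Nonempty (Fin p) := ⟨⟨0, hp⟩⟩
  rw [pi_norm_const, Real.norm_eq_abs, abs_of_pos (by positivity), div_lt_one (by linarith)]
  exact hh1

lemma phi_unif {p : ℕ} {φ : (Fin p → ℝ) → ℝ} (hφ : IsBoxedKernel φ) (ε : ℝ) (hε : 0 < ε) :
    ∃ ρ : ℝ, 0 < ρ ∧ ∀ u v : Fin p → ℝ, (∀ j, |u j - v j| ≤ ρ) → |φ u - φ v| ≤ ε := by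
  have hcs : HasCompactSupport φ := by
    refine HasCompactSupport.intro (isCompact_closedBall (0 : Fin p → ℝ) 1) fun u hu => hφ.2.2.1 u ?_
    simpa using hu
  obtain ⟨ρ, hρ, h⟩ := Metric.uniformContinuous_iff.1 (hcs.uniformContinuous_of_continuous hφ.1) ε hε
  refine ⟨ρ / 2, by positivity, fun u v huv => ?_⟩
  have : dist u v < ρ := lt_of_le_of_lt ((dist_pi_le_iff (r := ρ / 2) (by positivity)).2 (fun j => by rw [Real.dist_eq]; exact huv j)) (by linarith)
  have := h this
  rw [Real.dist_eq] at this
  exact this.le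

lemma Ph_close {p m K : ℕ} (hp : 0 < p) (hK : 1 ≤ K) {B hmin hmax : ℝ} (hB : 0 ≤ B) (hh1 : 1 < hmin) (hh2 : hmin < hmax)
    {φ : (Fin p → ℝ) → ℝ} (hφ : IsBoxedKernel φ)
    (hc : 0 < φ (fun _ => 1 / hmin)) (ε ρ ρ1 ε' : ℝ) (hε : 0 ≤ ε) (hε' : 0 ≤ ε') (hρ1 : 0 ≤ ρ1) (hρρ : ρ1 + (hmax + 2) * ρ1 ≤ ρ)
    (hun : ∀ u v : Fin p → ℝ, (∀ j, |u j - v j| ≤ ρ) → |φ u - φ v| ≤ ε)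
    {θ θ' : Par p m K} (hθ : θ ∈ box p m B hmin hmax K) (hθ' : θ' ∈ box p m B hmin hmax K)
    (h1 : ∀ k j, |θ.1 k j - θ'.1 k j| ≤ ρ1) (h2 : ∀ k s, |θ.2.1 k s - θ'.2.1 k s| ≤ ε') (h3 : |K * θ.2.2 - K * θ'.2.2| ≤ ρ1)
    (x : Fin p → ℝ) (hx : x ∈ cube p) :
    |Ph φ m K θ x - Ph φ m K θ' x| ≤
      (2 * (2 * (hmax + 1) + 1) ^ p * ε * ((mIdx p m).card * B) + (2 * (hmax + 1) + 1) ^ p * ((mIdx p m).card * ε')) /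
        φ (fun _ => 1 / hmin) := by
  rw [Ph_eq, Ph_eq]
  refine ratio_bound _ _ _ _ (nearS K (hmax + 1) x) _ _ _ _ _ hc (fun k => (hφ.2.1 _).1) (fun k => (hφ.2.1 _).2)
    (den_low hp hK hh1 hφ hθ x hx) (den_low hp hK hh1 hφ hθ' x hx) (fun k => Pk_le hK θ B k (hθ.2.1 k) hB x hx)
    (fun k => Pk_le hK θ' B k (hθ'.2.1 k) hB x hx) ?_ hε (by positivity) (by positivity) ?_
    (fun k hk => phi_active hK hh1 hφ hθ k x hk) (fun k hk => phi_active hK hh1 hφ hθ' k x hk)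
    (near_card K _ (by linarith) x)
  · intro k
    have := Pk_le (m := m) hK (θ.1, θ.2.1 - θ'.2.1, θ.2.2) ε' k (fun s => h2 k s) hε' x hx
    refine le_trans (le_of_eq ?_) this
    unfold Pk
    rw [← Finset.sum_sub_distrib]
    congr 1
    exact Finset.sum_congr rfl fun s _ => by simp only [Pi.sub_apply]; ring
  · intro k hk
    apply hun
    intro j
    rw [arg_mul hK, arg_mul hK]
    simp only [nearS, Finset.mem_filter, Finset.mem_univ, true_and] at hk
    have hkj := abs_le.1 (hk j)
    obtain ⟨a1, a2⟩ := box_h hK hθ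
    obtain ⟨a1', a2'⟩ := box_h hK hθ'
    set H := K * θ.2.2
    set H' := K * θ'.2.2
    have b1 := abs_le.1 (hθ'.1 k j)
    have b2 := h1 k j
    have hH : 1 ≤ H := by linarith
    have hH' : 1 ≤ H' := by linarith
    set n1 := K * x j - (k j : ℕ) - 1 / 2 - θ.1 k j / 2
    set n2 := K * x j - (k j : ℕ) - 1 / 2 - θ'.1 k j / 2 with hn2
    have c1 : |n2| ≤ hmax + 2 := by rw [abs_le]; constructor <;> linarith [hkj.1, hkj.2]
    have c2 : |n1 - n2| ≤ ρ1 := by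
      have : n1 - n2 = -(θ.1 k j - θ'.1 k j) / 2 := by simp only [n1, n2]; ring
      rw [this, abs_div, abs_neg]; norm_num; linarith [abs_nonneg (θ.1 k j - θ'.1 k j)]
    have : n1 / H - n2 / H' = (n1 - n2) / H + n2 * (H' - H) / (H * H') := by field_simp; ring
    rw [this]
    refine (abs_add_le _ _).trans (le_trans (add_le_add ?_ ?_) hρρ)
    · rw [abs_div, abs_of_pos (by linarith : 0 < H)]
      exact (div_le_self (abs_nonneg _) hH).trans c2
    · rw [abs_div, abs_of_pos (by positivity : 0 < H * H'), abs_mul, abs_sub_comm H' H]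
      refine (div_le_self (by positivity) (by nlinarith)).trans ?_
      exact mul_le_mul c1 h3 (abs_nonneg _) (by linarith)

lemma Ph_approx {p m K : ℕ} (hp : 0 < p) (hK : 1 ≤ K) {B hmin hmax : ℝ} (hB : 0 ≤ B) (hh1 : 1 < hmin)
    {φ : (Fin p → ℝ) → ℝ} (hφ : IsBoxedKernel φ) (hc : 0 < φ (fun _ => 1 / hmin)) (η : (Fin p → ℝ) → ℝ)
    {θ : Par p m K} (hθ : θ ∈ box p m B hmin hmax K) (ε ω : ℝ) (hε : 0 ≤ ε)
    (h2 : ∀ k s, |θ.2.1 k s - if s = 0 then η (center K k) else 0| ≤ ε)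
    (x : Fin p → ℝ) (hx : x ∈ cube p) (hω : ∀ k ∈ nearS K (hmax + 1) x, |η (center K k) - η x| ≤ ω) :
    |Ph φ m K θ x - η x| ≤ (mIdx p m).card * ε + ω := by
  rw [Ph_eq]
  refine ratio_le _ _ _ _ (fun k => (hφ.2.1 _).1) (lt_of_lt_of_le hc (den_low hp hK hh1 hφ hθ x hx)) fun k hk => ?_
  have hk' : k ∈ nearS K (hmax + 1) x := by
    by_contra hcon
    exact hk (phi_active hK hh1 hφ hθ k x hcon)
  have h0 : (0 : Fin p → Fin (m + 1)) ∈ mIdx p m := by simp [mIdx]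
  have := Pk_le (m := m) hK (θ.1, fun k s => θ.2.1 k s - if s = 0 then η (center K k) else 0, θ.2.2) ε k (fun s => h2 k s) hε x hx
  have e : Pk (m := m) (θ.1, fun k s => θ.2.1 k s - if s = 0 then η (center K k) else 0, θ.2.2) k x = Pk θ k x - η (center K k) := by
    unfold Pk
    simp only [sub_mul, Finset.sum_sub_distrib]
    congr 1
    rw [Finset.sum_eq_single 0]
    · simp [mono]
    · intro s _ hs; simp [hs]
    · intro h; exact absurd h0 h
  rw [e] at this
  have e2 : Pk θ k x - η x = (Pk θ k x - η (center K k)) + (η (center K k) - η x) := by ring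
  rw [e2]
  exact (abs_add_le _ _).trans (add_le_add this (hω k hk'))

abbrev Om (p m : ℕ) := Σ K : ℕ, Par p m K

def rho {p m : ℕ} (νμ : Measure (Fin p → ℝ)) (νξ : Measure ℝ) (νh : ℕ → Measure ℝ) (K : ℕ) : Measure (Par p m K) :=
  (Measure.pi fun _ : Fin p → Fin K => νμ).prod
      ((Measure.pi fun _ : Fin p → Fin K =>
          Measure.pi fun _ : Fin p → Fin (m + 1) => νξ).prod (νh K))

def QQ {p m : ℕ} (PK : Measure ℕ) (νμ : Measure (Fin p → ℝ)) (νξ : Measure ℝ) (νh : ℕ → Measure ℝ) : Measure (Om p m) :=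
  Measure.sum fun K => PK {K} • (rho νμ νξ νh K).map (Sigma.mk K)

def PsiO {p : ℕ} (φ : (Fin p → ℝ) → ℝ) (m : ℕ) (ω : Om p m) : (Fin p → ℝ) → ℝ := Ph φ m ω.1 ω.2

lemma mk_meas {p m : ℕ} (K : ℕ) : Measurable (Sigma.mk K : Par p m K → Om p m) :=
  fun _ hs => MeasurableSpace.measurableSet_iInf.1 hs K

lemma meas_sigma_set {p m : ℕ} (s : Set (Om p m)) (h : ∀ K, MeasurableSet ((Sigma.mk K : Par p m K → Om p m) ⁻¹' s)) :
    MeasurableSet s := MeasurableSpace.measurableSet_iInf.2 h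

lemma PsiO_meas {p m : ℕ} (φ : (Fin p → ℝ) → ℝ) (hφ : Continuous φ) : Measurable (PsiO φ m) := by
  intro s hs
  refine meas_sigma_set _ fun K => ?_
  exact Ph_meas φ hφ hs

section qq
variable {p m : ℕ} (PK : Measure ℕ) [IsProbabilityMeasure PK] (νμ : Measure (Fin p → ℝ)) [IsProbabilityMeasure νμ]
    (νξ : Measure ℝ) [IsProbabilityMeasure νξ] (νh : ℕ → Measure ℝ) [hνhP : ∀ K, IsProbabilityMeasure (νh K)]

instance rho_prob (K : ℕ) : IsProbabilityMeasure (rho (m := m) νμ νξ νh K) := by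
  unfold rho; infer_instance

lemma QQ_apply (s : Set (Om p m)) (hs : MeasurableSet s) :
    QQ PK νμ νξ νh s = ∑' K, PK {K} * rho νμ νξ νh K (Sigma.mk K ⁻¹' s) := by
  unfold QQ
  rw [Measure.sum_apply _ hs]
  congr 1 with K
  rw [Measure.smul_apply, Measure.map_apply (mk_meas K) hs, smul_eq_mul]

instance QQ_prob : IsProbabilityMeasure (QQ (m := m) PK νμ νξ νh) := by
  constructor
  rw [QQ_apply _ _ _ _ _ MeasurableSet.univ]
  simp only [Set.preimage_univ, measure_univ, mul_one]
  have := lintegral_countable' (μ := PK) (fun _ => 1)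
  simpa using this.symm

lemma bind_eq (φ : (Fin p → ℝ) → ℝ) (hφ : Continuous φ) :
    (PK.bind fun K => priorGivenK φ m K νμ νξ (νh K)) = (QQ (m := m) PK νμ νξ νh).map (PsiO φ m) := by
  ext s hs
  rw [Measure.bind_apply hs (Measurable.aemeasurable (measurable_of_countable _)), lintegral_countable',
    Measure.map_apply (PsiO_meas φ hφ) hs, QQ_apply _ _ _ _ _ (PsiO_meas φ hφ hs)]
  congr 1 with K
  have : priorGivenK φ m K νμ νξ (νh K) = (rho νμ νξ νh K).map (Ph φ m K) := rfl
  rw [this, Measure.map_apply (Ph_meas φ hφ) hs, mul_comm]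
  rfl

lemma QQ_pos (K : ℕ) (hK : PK {K} ≠ 0) (A : Set (Par p m K)) (hA : rho νμ νξ νh K A ≠ 0) :
    0 < QQ (m := m) PK νμ νξ νh (Sigma.mk K '' A) := by
  have h1 : (PK {K} • (rho νμ νξ νh K).map (Sigma.mk K)) (Sigma.mk K '' A) ≤ QQ (m := m) PK νμ νξ νh (Sigma.mk K '' A) :=
    Measure.le_sum (fun K => PK {K} • (rho νμ νξ νh K).map (Sigma.mk K)) K _
  refine lt_of_lt_of_le ?_ h1
  rw [Measure.smul_apply, smul_eq_mul]
  refine ENNReal.mul_pos hK (ne_of_gt ?_)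
  refine lt_of_lt_of_le (pos_iff_ne_zero.2 hA) ?_
  refine le_trans ?_ (Measure.le_map_apply (mk_meas K).aemeasurable _)
  exact measure_mono (Set.subset_preimage_image _ _)

end qq

lemma dens_box {E : Type*} [MeasurableSpace E] (μ : Measure E) (A : Set E) (hA : MeasurableSet A) (g : E → ℝ) (ν : Measure E)
    [IsProbabilityMeasure ν]
    (h : ν = (μ.restrict A).withDensity fun t => ENNReal.ofReal (g t)) : ν A = 1 := by
  have h0 : ν Aᶜ = 0 := by
    rw [h]
    refine withDensity_absolutelyContinuous _ _ ?_
    rw [Measure.restrict_apply hA.compl]; simp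
  exact (prob_compl_eq_zero_iff hA).1 h0

lemma dens_pos (B : ℝ) (hB : 0 < B) (g : ℝ → ℝ) (hg : ContinuousOn g (Set.Icc (-B) B)) (hpos : ∀ t ∈ Set.Icc (-B) B, 0 < g t) (ν : Measure ℝ)
    (h : ν = (volume.restrict (Set.Icc (-B) B)).withDensity fun t => ENNReal.ofReal (g t)) (a ε : ℝ) (hε : 0 < ε)
    (ha : |a| ≤ B) : ν ({t | |t - a| ≤ ε} ∩ {t | |t| ≤ B}) ≠ 0 := by
  rw [abs_le] at ha
  have hm : MeasurableSet ({t : ℝ | |t - a| ≤ ε} ∩ {t | |t| ≤ B}) :=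
    (measurableSet_le (by fun_prop) (by fun_prop)).inter (measurableSet_le (by fun_prop) (by fun_prop))
  have hsub : {t : ℝ | |t - a| ≤ ε} ∩ {t | |t| ≤ B} ⊆ Set.Icc (-B) B := fun t ht => abs_le.1 ht.2
  rw [h, withDensity_apply _ hm, Measure.restrict_restrict hm, Set.inter_eq_left.2 hsub]
  have hgm : AEMeasurable (fun t => ENNReal.ofReal (g t)) (volume.restrict ({t : ℝ | |t - a| ≤ ε} ∩ {t | |t| ≤ B})) :=
    ENNReal.measurable_ofReal.comp_aemeasurable ((hg.mono hsub).aemeasurable hm)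
  intro h0
  rw [lintegral_eq_zero_iff' hgm] at h0
  have h1 : ∀ᵐ t ∂(volume.restrict ({t : ℝ | |t - a| ≤ ε} ∩ {t | |t| ≤ B})), False := by
    filter_upwards [h0, ae_restrict_mem hm] with t ht htm
    have := hpos t (hsub htm)
    simp only [Pi.zero_apply, ENNReal.ofReal_eq_zero] at ht
    linarith
  rw [eventually_false_iff_eq_bot, ae_eq_bot, Measure.restrict_eq_zero] at h1
  have h2 : Set.Icc (max (a - ε) (-B)) (min (a + ε) B) ⊆ {t : ℝ | |t - a| ≤ ε} ∩ {t | |t| ≤ B} := by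
    intro t ht
    simp only [Set.mem_Icc, max_le_iff, le_min_iff] at ht
    obtain ⟨⟨q1, q2⟩, q3, q4⟩ := ht
    refine ⟨?_, ?_⟩ <;> simp only [Set.mem_setOf_eq] <;> rw [abs_le] <;> constructor <;> linarith
  have h3 := measure_mono_null h2 h1
  rw [Real.volume_Icc, ENNReal.ofReal_eq_zero] at h3
  have : max (a - ε) (-B) < min (a + ε) B := by
    rw [max_lt_iff, lt_min_iff, lt_min_iff]
    refine ⟨⟨?_, ?_⟩, ?_, ?_⟩ <;> linarith
  linarith

lemma cube_eq (p : ℕ) : cube p = Set.Icc 0 1 := by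
  ext x; simp only [cube, Set.mem_setOf_eq, Set.mem_Icc, Pi.le_def, Pi.zero_apply, Pi.one_apply]
  exact forall_and

lemma mderiv_zero {p : ℕ} (f : (Fin p → ℝ) → ℝ) : mderiv (fun _ => 0) f = f := by
  unfold mderiv
  induction List.finRange p with
  | nil => rfl
  | cons a l ih => simpa using ih

lemma holder_bound {p : ℕ} {α B : ℝ} {f : (Fin p → ℝ) → ℝ} (h : IsHolder p α B f) :
    Continuous f ∧ ∀ x ∈ cube p, |f x| ≤ B := by
  obtain ⟨h1, B1, B2, hB1, hB2, hs, h2, -⟩ := h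
  refine ⟨h1.continuous, fun x hx => ?_⟩
  have := h2 (fun _ => 0) (by simp [degN]) x hx
  rw [mderiv_zero] at this
  linarith

lemma center_cube {p K : ℕ} (hK : 1 ≤ K) (k : Fin p → Fin K) : center K k ∈ cube p := by
  intro j
  have hK0 : (0:ℝ) < K := by exact_mod_cast hK
  unfold center
  refine ⟨by positivity, ?_⟩
  rw [div_le_one (by positivity)]
  have : ((k j : ℕ):ℝ) + 1 ≤ K := by exact_mod_cast (k j).2
  linarith

lemma near_center {p K : ℕ} (hK : 1 ≤ K) (R : ℝ) (x : Fin p → ℝ) (k : Fin p → Fin K) (hk : k ∈ nearS K R x) (j : Fin p) :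
    |center K k j - x j| ≤ (R + 1) / K := by
  have hK0 : (0:ℝ) < K := by exact_mod_cast hK
  simp only [nearS, Finset.mem_filter, Finset.mem_univ, true_and] at hk
  have := abs_le.1 (hk j)
  rw [le_div_iff₀ hK0, show |center K k j - x j| * K = |(center K k j - x j) * K| by rw [abs_mul, abs_of_pos hK0]]
  have e : (center K k j - x j) * K = (k j : ℕ) + 1 / 2 - K * x j := by unfold center; field_simp
  rw [e, abs_le]; constructor <;> linarith [this.1, this.2]

lemma pi_prod_eq {p m K : ℕ} (a : Set (Fin p → ℝ)) (b : (Fin p → Fin K) → (Fin p → Fin (m + 1)) → Set ℝ) (c : Set ℝ)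
    (νμ : Measure (Fin p → ℝ)) [IsProbabilityMeasure νμ]
    (νξ : Measure ℝ) [IsProbabilityMeasure νξ] (νh : ℕ → Measure ℝ) [hνhP : ∀ K, IsProbabilityMeasure (νh K)] :
    rho (m := m) νμ νξ νh K ((Set.univ.pi fun _ => a) ×ˢ ((Set.univ.pi fun k => Set.univ.pi fun s => b k s) ×ˢ c)) =
      (∏ _k : Fin p → Fin K, νμ a) * ((∏ k, ∏ s, νξ (b k s)) * νh K c) := by
  unfold rho
  rw [Measure.prod_prod, Measure.prod_prod, Measure.pi_pi, Measure.pi_pi]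
  simp only [Measure.pi_pi]

lemma box_eq {p m K : ℕ} (B hmin hmax : ℝ) : box p m B hmin hmax K =
    (Set.univ.pi fun _ => {u : Fin p → ℝ | ∀ j, |u j| ≤ 1}) ×ˢ
      ((Set.univ.pi fun _ => Set.univ.pi fun _ => Set.Icc (-B) B) ×ˢ Set.Icc (hmin / K) (hmax / K)) := by
  ext θ
  simp only [box, Set.mem_setOf_eq, Set.mem_prod, Set.mem_pi, Set.mem_univ, true_imp_iff, Set.mem_Icc, abs_le]

lemma tail_exists (PK : Measure ℕ) (h : ∀ x : ℝ, 2 ≤ x → PK {K : ℕ | x ≤ (K:ℝ)} ≠ 0) (x : ℝ) :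
    ∃ K : ℕ, x ≤ K ∧ PK {K} ≠ 0 := by
  by_contra hc
  push Not at hc
  apply h (max 2 x) (le_max_left _ _)
  rw [← Set.biUnion_of_singleton {K : ℕ | max 2 x ≤ (K:ℝ)}, measure_biUnion_null_iff (Set.to_countable _)]
  intro K hK
  exact hc K ((le_max_right _ _).trans hK)

lemma prior_H2 {p m : ℕ} (hp : 0 < p) {B hmin hmax : ℝ} (hB : 0 < B) (hh1 : 1 < hmin) (hh2 : hmin < hmax)
    {φ : (Fin p → ℝ) → ℝ} (hφ : IsBoxedKernel φ) (hφpos : ∀ u : Fin p → ℝ, ‖u‖ < 1 → 0 < φ u)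
    (η₀ : (Fin p → ℝ) → ℝ) (hηc : Continuous η₀) (hηB : ∀ x ∈ cube p, |η₀ x| ≤ B)
    (PK : Measure ℕ) [IsProbabilityMeasure PK] (hPK : ∀ x : ℝ, 2 ≤ x → PK {K : ℕ | x ≤ (K:ℝ)} ≠ 0)
    (νμ : Measure (Fin p → ℝ)) [IsProbabilityMeasure νμ] (hμ1 : νμ {u : Fin p → ℝ | ∀ j, |u j| ≤ 1} = 1)
    (νξ : Measure ℝ) [IsProbabilityMeasure νξ] (hξ : ∀ a ε : ℝ, 0 < ε → |a| ≤ B → νξ ({t | |t - a| ≤ ε} ∩ {t | |t| ≤ B}) ≠ 0)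
    (νh : ℕ → Measure ℝ) [hνhP : ∀ K, IsProbabilityMeasure (νh K)]
    (hh : ∀ K : ℕ, 1 ≤ K → νh K (Set.Icc (hmin / K) (hmax / K)) = 1) (τ : ℝ) (hτ : 0 < τ) :
    ∃ A : Set (Om p m), 0 < QQ PK νμ νξ νh A ∧ ∀ ω ∈ A, ∀ x ∈ cube p, |PsiO φ m ω x - η₀ x| ≤ τ := by
  have hc0 := c0_pos hp hh1 hφpos
  have huc : UniformContinuousOn η₀ (cube p) :=
    (by rw [cube_eq]; exact isCompact_Icc : IsCompact (cube p)).uniformContinuousOn_of_continuous hηc.continuousOn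
  obtain ⟨ρ, hρ, huc⟩ := Metric.uniformContinuousOn_iff.1 huc (τ / 2) (by positivity)
  obtain ⟨K, hKx, hK0⟩ := tail_exists PK hPK (max 1 (2 * (hmax + 2) / ρ))
  have hK1 : (1:ℝ) ≤ K := (le_max_left _ _).trans hKx
  have hK : 1 ≤ K := by exact_mod_cast hK1
  have hK2 := (le_max_right _ _).trans hKx
  rw [div_le_iff₀ hρ] at hK2
  obtain ⟨ε, hε, -, hε2, -⟩ := ex_small ((mIdx p m).card) 0 (τ / 2) 1 (by positivity) one_pos
  set A : Set (Par p m K) := (Set.univ.pi fun _ => {u : Fin p → ℝ | ∀ j, |u j| ≤ 1}) ×ˢ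
      ((Set.univ.pi fun k => Set.univ.pi fun s =>
        ({t : ℝ | |t - if s = 0 then η₀ (center K k) else 0| ≤ ε} ∩ {t | |t| ≤ B})) ×ˢ Set.Icc (hmin / K) (hmax / K)) with hA
  refine ⟨Sigma.mk K '' A, QQ_pos PK νμ νξ νh K hK0 A ?_, ?_⟩
  · rw [hA, pi_prod_eq, hμ1, hh K hK]
    simp only [Finset.prod_const_one, one_mul, mul_one]
    refine Finset.prod_ne_zero_iff.2 fun k _ => Finset.prod_ne_zero_iff.2 fun s _ => hξ _ ε hε ?_
    split_ifs
    · exact hηB _ (center_cube hK k)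
    · simpa using hB.le
  · rintro _ ⟨θ, hθ, rfl⟩ x hx
    simp only [hA, Set.mem_prod, Set.mem_pi, Set.mem_univ, true_imp_iff, Set.mem_inter_iff, Set.mem_setOf_eq, Set.mem_Icc] at hθ
    obtain ⟨t1, t2, t3⟩ := hθ
    have := Ph_approx hp hK hB.le hh1 hφ hc0 η₀ (θ := θ) (hmax := hmax) ⟨t1, fun k s => (t2 k s).2, t3⟩ ε (τ / 2) hε.le
      (fun k s => (t2 k s).1) x hx (fun k hk => by
        have := huc _ (center_cube hK k) x hx (by
          refine lt_of_le_of_lt ((dist_pi_le_iff (r := ρ / 2) (by positivity)).2 fun j => ?_) (by linarith)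
          rw [Real.dist_eq]
          refine (near_center hK _ x k hk j).trans ?_
          rw [div_le_iff₀ (by linarith)]
          linarith)
        rw [Real.dist_eq] at this
        exact this.le)
    refine this.trans ?_
    linarith

lemma tail_up {p : ℕ} (hp : 0 < p) (PK : Measure ℕ) [IsProbabilityMeasure PK] (hPK0 : PK {0} = 0) (r₀ b₁ C₁ : ℝ) (hr₀ : 0 ≤ r₀)
    (hb₁ : 0 < b₁) (hC₁ : 0 < C₁)
    (ht : ∀ x : ℝ, 2 ≤ x → (PK {K : ℕ | x ≤ (K : ℝ)}).toReal ≤ C₁ * Real.exp (-b₁ * x ^ p * Real.log (x ^ p) ^ r₀))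
    (κ : ℝ) (hκ : 0 < κ) : ∀ᶠ n : ℕ in atTop, PK {K : ℕ | 1 ≤ K ∧ (K:ℝ) ^ p ≤ κ * n}ᶜ ≤ ENNReal.ofReal (C₁ * Real.exp (-(b₁ * κ) * n)) := by
  have hlim : Tendsto (fun n : ℕ => κ * (n:ℝ)) atTop atTop := tendsto_natCast_atTop_atTop.const_mul_atTop hκ
  filter_upwards [hlim.eventually_ge_atTop (2 ^ p), hlim.eventually_ge_atTop (Real.exp 1)] with n h1 h2
  set y := (κ * (n:ℝ)) ^ ((p:ℝ)⁻¹) with hy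
  have hy0 : 0 ≤ y := by positivity
  have hyp : y ^ p = κ * n := Real.rpow_inv_natCast_pow (by positivity) hp.ne'
  have hy2 : 2 ≤ y := by
    by_contra hc
    push Not at hc
    have := pow_lt_pow_left₀ hc hy0 hp.ne'
    linarith
  have hsub : {K : ℕ | 1 ≤ K ∧ (K:ℝ) ^ p ≤ κ * n}ᶜ ⊆ {0} ∪ {K : ℕ | y ≤ (K : ℝ)} := by
    intro K hK
    simp only [Set.mem_compl_iff, Set.mem_setOf_eq, not_and, not_le] at hK
    rcases Nat.eq_zero_or_pos K with h | h
    · left; exact h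
    · right
      have := hK h
      rw [← hyp] at this
      exact (lt_of_pow_lt_pow_left₀ p (Nat.cast_nonneg K) this).le
  calc PK {K : ℕ | 1 ≤ K ∧ (K:ℝ) ^ p ≤ κ * n}ᶜ ≤ PK {0} + PK {K : ℕ | y ≤ (K : ℝ)} := (measure_mono hsub).trans (measure_union_le _ _)
    _ = PK {K : ℕ | y ≤ (K : ℝ)} := by rw [hPK0, zero_add]
    _ = ENNReal.ofReal (PK {K : ℕ | y ≤ (K : ℝ)}).toReal := (ENNReal.ofReal_toReal (measure_ne_top _ _)).symm
    _ ≤ _ := by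
      apply ENNReal.ofReal_le_ofReal
      refine (ht y hy2).trans ?_
      rw [hyp]
      have hl : 1 ≤ Real.log (κ * n) := by
        rw [Real.le_log_iff_exp_le (lt_of_lt_of_le (Real.exp_pos 1) h2)]; exact h2
      have := Real.one_le_rpow hl hr₀
      refine mul_le_mul_of_nonneg_left (Real.exp_le_exp.2 ?_) hC₁.le
      have h3 : 0 ≤ b₁ * (κ * n) := by positivity
      nlinarith

lemma net_exists (a b ρ : ℝ) (hρ : 0 < ρ) : ∃ F : Finset ℝ, (∀ t ∈ F, a ≤ t ∧ t ≤ b) ∧ ∀ t, a ≤ t → t ≤ b → ∃ s ∈ F, |t - s| ≤ ρ := by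
  obtain ⟨T, hT, hTf, hcov⟩ := (isCompact_Icc (a := a) (b := b)).finite_cover_balls hρ
  refine ⟨hTf.toFinset, fun t ht => hT (hTf.mem_toFinset.1 ht), fun t h1 h2 => ?_⟩
  have := hcov (show t ∈ Set.Icc a b from ⟨h1, h2⟩)
  simp only [Set.mem_iUnion, Metric.mem_ball, Real.dist_eq] at this
  obtain ⟨s, hs, h⟩ := this
  exact ⟨s, hTf.mem_toFinset.2 hs, h.le⟩

/-- index set of the net for fixed K -/
abbrev NI (p m : ℕ) (F1 F2 F3 : Finset ℝ) (K : ℕ) :=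
  ((Fin p → Fin K) → Fin p → F1) × ((Fin p → Fin K) → (Fin p → Fin (m + 1)) → F2) × F3

def toPar {p m : ℕ} {F1 F2 F3 : Finset ℝ} {K : ℕ} (i : NI p m F1 F2 F3 K) : Par p m K :=
  (fun k j => (i.1 k j : ℝ), fun k s => (i.2.1 k s : ℝ), (i.2.2 : ℝ) / K)

lemma NI_card (p m : ℕ) (F1 F2 F3 : Finset ℝ) (K : ℕ) (y : ℝ) (hy : (K:ℝ) ^ p ≤ y) :
    (Fintype.card (NI p m F1 F2 F3 K) : ℝ) ≤
      Real.exp (y * Real.log (((F1.card:ℝ) + 1) ^ p * ((F2.card:ℝ) + 1) ^ ((m + 1) ^ p))) * F3.card := by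
  have hW : (1:ℝ) ≤ ((F1.card:ℝ) + 1) ^ p * ((F2.card:ℝ) + 1) ^ ((m + 1) ^ p) := by
    have h1 : (1:ℝ) ≤ ((F1.card:ℝ) + 1) ^ p := one_le_pow₀ (by linarith [(Nat.cast_nonneg F1.card : (0:ℝ) ≤ _)])
    have h2 : (1:ℝ) ≤ ((F2.card:ℝ) + 1) ^ ((m + 1) ^ p) := one_le_pow₀ (by linarith [(Nat.cast_nonneg F2.card : (0:ℝ) ≤ _)])
    nlinarith
  have e : (Fintype.card (NI p m F1 F2 F3 K) : ℝ) = ((F1.card:ℝ) ^ p * (F2.card:ℝ) ^ ((m + 1) ^ p)) ^ (K ^ p) * F3.card := by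
    simp only [NI, Fintype.card_prod, Fintype.card_fun, Fintype.card_fin, Fintype.card_coe]
    push_cast
    rw [mul_pow, ← mul_assoc]
  rw [e]
  gcongr
  calc ((F1.card:ℝ) ^ p * (F2.card:ℝ) ^ ((m + 1) ^ p)) ^ (K ^ p)
      ≤ (((F1.card:ℝ) + 1) ^ p * ((F2.card:ℝ) + 1) ^ ((m + 1) ^ p)) ^ (K ^ p) := by gcongr <;> linarith
    _ = Real.exp ((K:ℝ) ^ p * Real.log (((F1.card:ℝ) + 1) ^ p * ((F2.card:ℝ) + 1) ^ ((m + 1) ^ p))) := by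
      rw [mul_comm ((K:ℝ) ^ p), Real.exp_mul, Real.exp_log (by linarith), ← Nat.cast_pow, Real.rpow_natCast]
    _ ≤ _ := by
      apply Real.exp_le_exp.2
      exact mul_le_mul_of_nonneg_right hy (Real.log_nonneg hW)

lemma toPar_box {p m : ℕ} {F1 F2 F3 : Finset ℝ} {B hmin hmax : ℝ} (h1 : ∀ t ∈ F1, (-1:ℝ) ≤ t ∧ t ≤ 1)
    (h2 : ∀ t ∈ F2, -B ≤ t ∧ t ≤ B) (h3 : ∀ t ∈ F3, hmin ≤ t ∧ t ≤ hmax) {K : ℕ} (i : NI p m F1 F2 F3 K) :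
    toPar i ∈ box p m B hmin hmax K := by
  refine ⟨fun k j => abs_le.2 (h1 _ (i.1 k j).2), fun k s => abs_le.2 (h2 _ (i.2.1 k s).2), ?_, ?_⟩
  · simp only [toPar]; have := (h3 _ i.2.2.2).1; gcongr
  · simp only [toPar]; have := (h3 _ i.2.2.2).2; gcongr

lemma rho_box {p m K : ℕ} (hK : 1 ≤ K) {B hmin hmax : ℝ}
    (νμ : Measure (Fin p → ℝ)) [IsProbabilityMeasure νμ] (hμ1 : νμ {u : Fin p → ℝ | ∀ j, |u j| ≤ 1} = 1)
    (νξ : Measure ℝ) [IsProbabilityMeasure νξ] (hξ1 : νξ (Set.Icc (-B) B) = 1)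
    (νh : ℕ → Measure ℝ) [hνhP : ∀ K, IsProbabilityMeasure (νh K)]
    (hh : ∀ K : ℕ, 1 ≤ K → νh K (Set.Icc (hmin / K) (hmax / K)) = 1) :
    rho νμ νξ νh K (box p m B hmin hmax K) = 1 := by
  rw [box_eq, pi_prod_eq _ (fun _ _ => Set.Icc (-B) B), hμ1, hξ1, hh K hK]
  simp

lemma prior_H3 {p m : ℕ} (hp : 0 < p) {B hmin hmax : ℝ} (hB : 0 < B) (hh1 : 1 < hmin) (hh2 : hmin < hmax)
    {φ : (Fin p → ℝ) → ℝ} (hφ : IsBoxedKernel φ) (hφpos : ∀ u : Fin p → ℝ, ‖u‖ < 1 → 0 < φ u)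
    (PK : Measure ℕ) [IsProbabilityMeasure PK] (hPK0 : PK {0} = 0) (r₀ b₁ C₁ : ℝ) (hr₀ : 0 ≤ r₀)
    (hb₁ : 0 < b₁) (hC₁ : 0 < C₁)
    (ht : ∀ x : ℝ, 2 ≤ x → (PK {K : ℕ | x ≤ (K : ℝ)}).toReal ≤ C₁ * Real.exp (-b₁ * x ^ p * Real.log (x ^ p) ^ r₀))
    (νμ : Measure (Fin p → ℝ)) [IsProbabilityMeasure νμ] (hμ1 : νμ {u : Fin p → ℝ | ∀ j, |u j| ≤ 1} = 1)
    (νξ : Measure ℝ) [IsProbabilityMeasure νξ] (hξ1 : νξ (Set.Icc (-B) B) = 1)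
    (νh : ℕ → Measure ℝ) [hνhP : ∀ K, IsProbabilityMeasure (νh K)]
    (hh : ∀ K : ℕ, 1 ≤ K → νh K (Set.Icc (hmin / K) (hmax / K)) = 1) (δ : ℝ) (hδ : 0 < δ) (κ : ℝ) (hκ : 0 < κ) :
    ∃ c C : ℝ, 0 < c ∧ 0 < C ∧ ∀ᶠ n : ℕ in atTop,
      ∃ S : Set (Om p m), MeasurableSet S ∧ QQ PK νμ νξ νh Sᶜ ≤ ENNReal.ofReal (C * Real.exp (-c * n)) ∧
        ∃ (N : ℕ) (f : Fin N → (Fin p → ℝ) → ℝ), (N:ℝ) ≤ C * Real.exp (κ * n) ∧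
          (∀ k, ∀ x ∈ cube p, |f k x| ≤ (mIdx p m).card * B + 1) ∧
          ∀ ω ∈ S, ∃ k, ∀ x ∈ cube p, |PsiO φ m ω x - f k x| ≤ δ := by
  have hc0 := c0_pos hp hh1 hφpos
  set R : ℝ := (2 * (hmax + 1) + 1) ^ p with hR
  obtain ⟨ε, hε, -, hε2, -⟩ := ex_small (2 * R * ((mIdx p m).card * B) + R * (mIdx p m).card) 0 (δ * φ (fun _ => 1 / hmin)) 1
    (by positivity) one_pos
  obtain ⟨ρ, hρ, hun⟩ := phi_unif hφ ε hε
  have hhm : 0 < hmax + 3 := by linarith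
  set ρ1 := ρ / (hmax + 3) with hρ1d
  have hρ1 : 0 < ρ1 := by positivity
  have hρρ : ρ1 + (hmax + 2) * ρ1 ≤ ρ := by
    have : ρ1 * (hmax + 3) = ρ := by rw [hρ1d]; field_simp
    linarith
  obtain ⟨F1, hF1, hF1n⟩ := net_exists (-1) 1 ρ1 hρ1
  obtain ⟨F2, hF2, hF2n⟩ := net_exists (-B) B ε hε
  obtain ⟨F3, hF3, hF3n⟩ := net_exists hmin hmax ρ1 hρ1
  set L := Real.log (((F1.card:ℝ) + 1) ^ p * ((F2.card:ℝ) + 1) ^ ((m + 1) ^ p)) with hL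
  have hL0 : 0 ≤ L := by
    apply Real.log_nonneg
    have h1 : (1:ℝ) ≤ ((F1.card:ℝ) + 1) ^ p := one_le_pow₀ (by linarith [(Nat.cast_nonneg F1.card : (0:ℝ) ≤ _)])
    have h2 : (1:ℝ) ≤ ((F2.card:ℝ) + 1) ^ ((m + 1) ^ p) := one_le_pow₀ (by linarith [(Nat.cast_nonneg F2.card : (0:ℝ) ≤ _)])
    nlinarith
  set κ₀ := κ / (1 + L) with hκ₀
  have hκ₀p : 0 < κ₀ := by positivity
  have hκe : κ₀ * (1 + L) = κ := by rw [hκ₀]; field_simp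
  refine ⟨b₁ * κ₀, max C₁ F3.card, by positivity, lt_of_lt_of_le hC₁ (le_max_left _ _), ?_⟩
  filter_upwards [tail_up hp PK hPK0 r₀ b₁ C₁ hr₀ hb₁ hC₁ ht κ₀ hκ₀p] with n hn
  set S : Set (Om p m) := {ω | (1 ≤ ω.1 ∧ (ω.1:ℝ) ^ p ≤ κ₀ * n) ∧ ω.2 ∈ box p m B hmin hmax ω.1} with hS
  have hSK : ∀ K, (Sigma.mk K : Par p m K → Om p m) ⁻¹' S =
      if 1 ≤ K ∧ (K:ℝ) ^ p ≤ κ₀ * n then box p m B hmin hmax K else ∅ := by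
    intro K
    ext θ
    simp only [hS, Set.mem_preimage, Set.mem_setOf_eq]
    split_ifs with h <;> simp [h]
  have hSm : MeasurableSet S := by
    refine meas_sigma_set _ fun K => ?_
    rw [hSK]
    split_ifs
    · exact box_meas B hmin hmax
    · exact MeasurableSet.empty
  refine ⟨S, hSm, ?_, ?_⟩
  · have e : QQ PK νμ νξ νh Sᶜ = PK {K : ℕ | 1 ≤ K ∧ (K:ℝ) ^ p ≤ κ₀ * n}ᶜ := by
      rw [QQ_apply _ _ _ _ _ hSm.compl]
      rw [← lintegral_indicator_one (MeasurableSet.of_discrete), lintegral_countable']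
      congr 1 with K
      rw [Set.preimage_compl, hSK, mul_comm]
      by_cases h : 1 ≤ K ∧ (K:ℝ) ^ p ≤ κ₀ * n
      · rw [if_pos h, prob_compl_eq_zero_iff (box_meas B hmin hmax) |>.2 (rho_box h.1 νμ hμ1 νξ hξ1 νh hh)]
        rw [Set.indicator_of_notMem (by simpa using h)]
      · rw [if_neg h, Set.compl_empty, measure_univ, Set.indicator_of_mem h]; rfl
    rw [e]
    refine hn.trans (ENNReal.ofReal_le_ofReal ?_)
    gcongr
    exact le_max_left _ _
  · set Kset := {K : Fin (⌊κ₀ * n⌋₊ + 1) // 1 ≤ (K:ℕ) ∧ ((K:ℕ):ℝ) ^ p ≤ κ₀ * n} with hKset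
    set I := Σ K : Kset, NI p m F1 F2 F3 (K.1 : ℕ) with hI
    let g : I → (Fin p → ℝ) → ℝ := fun i => Ph φ m _ (toPar i.2)
    refine ⟨Fintype.card I, fun i => g ((Fintype.equivFin I).symm i), ?_, ?_, ?_⟩
    · have hcard : Fintype.card I = ∑ K : Kset, Fintype.card (NI p m F1 F2 F3 (K.1:ℕ)) := Fintype.card_sigma
      rw [hcard]
      push_cast
      calc ∑ K : Kset, (Fintype.card (NI p m F1 F2 F3 (K.1:ℕ)) : ℝ) ≤ ∑ K : Kset, Real.exp (κ₀ * n * L) * F3.card := by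
            refine Finset.sum_le_sum fun K _ => ?_
            exact NI_card p m F1 F2 F3 _ _ K.2.2
        _ = Fintype.card Kset * (Real.exp (κ₀ * n * L) * F3.card) := by simp
        _ ≤ Real.exp (κ₀ * n) * (Real.exp (κ₀ * n * L) * F3.card) := by
            gcongr
            calc (Fintype.card Kset : ℝ) ≤ (⌊κ₀ * n⌋₊ + 1 : ℕ) := by
                  have := Fintype.card_subtype_le (fun K : Fin (⌊κ₀ * n⌋₊ + 1) => 1 ≤ (K:ℕ) ∧ ((K:ℕ):ℝ) ^ p ≤ κ₀ * n)
                  rw [Fintype.card_fin] at this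
                  exact Nat.cast_le.2 this
              _ ≤ κ₀ * n + 1 := by push_cast; gcongr; exact Nat.floor_le (by positivity)
              _ ≤ _ := Real.add_one_le_exp _
        _ = F3.card * Real.exp (κ * n) := by
            rw [← mul_assoc, ← Real.exp_add, mul_comm]
            congr 2
            rw [← hκe]; ring
        _ ≤ _ := by gcongr; exact le_max_right _ _
    · intro i x hx
      simp only [g]
      have := Ph_le hp ((Fintype.equivFin I).symm i).1.2.1 hB.le hh1 hφ hφpos
        (toPar_box hF1 hF2 hF3 ((Fintype.equivFin I).symm i).2) x hx hc0
      linarith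
    · rintro ⟨K, θ⟩ ⟨⟨hK1, hK2⟩, hθ⟩
      simp only at hK1 hK2 hθ
      have hKle : K < ⌊κ₀ * n⌋₊ + 1 := by
        rw [Nat.lt_succ_iff]
        apply Nat.le_floor
        refine le_trans ?_ hK2
        exact_mod_cast Nat.le_self_pow hp.ne' K
      have hb := box_h hK1 hθ
      have hK0 : (0:ℝ) < K := by exact_mod_cast hK1
      choose a1 ha1 ha1' using fun k j => hF1n (θ.1 k j) (abs_le.1 (hθ.1 k j)).1 (abs_le.1 (hθ.1 k j)).2
      choose a2 ha2 ha2' using fun k s => hF2n (θ.2.1 k s) (abs_le.1 (hθ.2.1 k s)).1 (abs_le.1 (hθ.2.1 k s)).2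
      obtain ⟨a3, ha3, ha3'⟩ := hF3n _ hb.1 hb.2
      let i0 : NI p m F1 F2 F3 K := (fun k j => ⟨a1 k j, ha1 k j⟩, fun k s => ⟨a2 k s, ha2 k s⟩, ⟨a3, ha3⟩)
      let ii : I := ⟨⟨⟨K, hKle⟩, hK1, hK2⟩, i0⟩
      refine ⟨Fintype.equivFin I ii, fun x hx => ?_⟩
      simp only
      rw [Equiv.symm_apply_apply]
      have := Ph_close hp hK1 hB.le hh1 hh2 hφ hc0 ε ρ ρ1 ε hε.le hε.le hρ1.le hρρ hun hθ (toPar_box hF1 hF2 hF3 i0)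
        ha1' ha2' (by
          simp only [toPar, i0]
          rw [mul_div_cancel₀ _ hK0.ne']; exact ha3') x hx
      refine this.trans ?_
      rw [div_le_iff₀ hc0]
      refine le_trans (le_of_eq ?_) hε2
      ring

lemma pi_gauss (q : ℕ) : Measure.pi (fun _ : Fin q => ProbabilityTheory.gaussianReal 0 1) =
    (volume : Measure (Fin q → ℝ)).withDensity fun b => ENNReal.ofReal (((Real.sqrt (2 * π))⁻¹) ^ q * psi b) := by
  have hf : ∀ b : Fin q → ℝ, ((Real.sqrt (2 * π))⁻¹) ^ q * psi b = ∏ i, ProbabilityTheory.gaussianPDFReal 0 1 (b i) := by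
    intro b
    simp only [ProbabilityTheory.gaussianPDFReal, Finset.prod_mul_distrib, ← Real.exp_sum, psi]
    simp [Finset.sum_div, neg_div]
  refine Measure.pi_eq fun s hs => ?_
  simp only [hf]
  rw [withDensity_apply _ (MeasurableSet.univ_pi hs), volume_pi, Measure.restrict_pi_pi]
  rw [← ofReal_integral_eq_lintegral_ofReal]
  · rw [integral_fintype_prod_eq_prod, ENNReal.ofReal_prod_of_nonneg]
    · refine Finset.prod_congr rfl fun i _ => ?_
      rw [ProbabilityTheory.gaussianReal_apply_eq_integral 0 (one_ne_zero)]
    · exact fun i _ => integral_nonneg fun x => ProbabilityTheory.gaussianPDFReal_nonneg _ _ _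
  · exact Integrable.fintype_prod fun i => (ProbabilityTheory.integrable_gaussianPDFReal 0 1).integrableOn
  · exact Filter.Eventually.of_forall fun x => Finset.prod_nonneg fun i _ => ProbabilityTheory.gaussianPDFReal_nonneg _ _ _

lemma psi_integral (q : ℕ) : ∫ b : Fin q → ℝ, psi b = (Real.sqrt (2 * π)) ^ q := by
  have h1 : ∀ b : Fin q → ℝ, psi b = ∏ i, Real.exp (-(1/2) * (b i) ^ 2) := by
    intro b
    simp only [psi, ← Real.exp_sum]
    congr 1
    rw [← Finset.mul_sum]; ring
  simp only [h1]
  rw [integral_fintype_prod_volume_eq_prod (f := fun _ (v:ℝ) => Real.exp (-(1/2) * v ^ 2))]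
  simp only [integral_gaussian]
  simp
  rw [mul_comm]

lemma lin_emb {q : ℕ} (R : Matrix (Fin q) (Fin q) ℝ) (hR : R.det ≠ 0) : MeasurableEmbedding (Matrix.toLin' R) :=
  (LinearMap.continuous_of_finiteDimensional _).measurableEmbedding
    (Matrix.mulVec_injective_of_isUnit ((Matrix.isUnit_iff_isUnit_det _).2 hR.isUnit))

lemma lin_cov {q : ℕ} (R : Matrix (Fin q) (Fin q) ℝ) (hR : R.det ≠ 0) (f : (Fin q → ℝ) → ℝ) :
    ∫ v, f (R.mulVec v) = |R.det|⁻¹ * ∫ v, f v := by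
  have h := Real.map_matrix_volume_pi_eq_smul_volume_pi hR
  have := (lin_emb R hR).integral_map (μ := volume) f
  rw [h] at this
  simp only [Matrix.toLin'_apply] at this
  rw [← this, integral_smul_measure, abs_inv, ENNReal.toReal_ofReal (by positivity), smul_eq_mul]

lemma lin_int {q : ℕ} (R : Matrix (Fin q) (Fin q) ℝ) (hR : R.det ≠ 0) (f : (Fin q → ℝ) → ℝ) (hf : Integrable f) :
    Integrable (fun v => f (R.mulVec v)) := by
  have h := Real.map_matrix_volume_pi_eq_smul_volume_pi hR
  have := (lin_emb R hR).integrable_map_iff (μ := volume) (g := f)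
  rw [h] at this
  exact this.1 (hf.smul_measure ENNReal.ofReal_ne_top)

lemma psd_factor {q : ℕ} (M : Matrix (Fin q) (Fin q) ℝ) (hM : M.PosSemidef) : ∃ R : Matrix (Fin q) (Fin q) ℝ, M = Rᵀ * R := by
  open scoped MatrixOrder in
  obtain ⟨X, hX⟩ := CStarAlgebra.nonneg_iff_eq_star_mul_self.1 hM.nonneg
  exact ⟨X, by simpa [Matrix.star_eq_conjTranspose] using hX⟩

lemma psi_mulVec {q : ℕ} (R : Matrix (Fin q) (Fin q) ℝ) (v : Fin q → ℝ) :
    psi (R.mulVec v) = Real.exp (-(1 / 2) * (v ⬝ᵥ (Rᵀ * R).mulVec v)) := by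
  unfold psi
  congr 1
  have : v ⬝ᵥ (Rᵀ * R).mulVec v = ∑ j, (R.mulVec v) j ^ 2 := by
    rw [← Matrix.mulVec_mulVec, Matrix.dotProduct_mulVec, Matrix.vecMul_transpose, dotProduct]
    simp only [sq]
  rw [this]; ring

lemma normal_one {q : ℕ} (M : Matrix (Fin q) (Fin q) ℝ) (hM : M.PosSemidef) (hdet : M.det ≠ 0) :
    Integrable (fun v : Fin q → ℝ => Real.exp (-(1 / 2) * (v ⬝ᵥ M.mulVec v))) ∧
    (Real.sqrt M.det * (2 * π) ^ (-(q : ℝ) / 2)) * ∫ v : Fin q → ℝ, Real.exp (-(1 / 2) * (v ⬝ᵥ M.mulVec v)) = 1 := by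
  obtain ⟨R, rfl⟩ := psd_factor M hM
  have hd : (Rᵀ * R).det = R.det ^ 2 := by rw [Matrix.det_mul, Matrix.det_transpose]; ring
  have hR : R.det ≠ 0 := by
    intro h; rw [hd, h] at hdet; simp at hdet
  simp only [← psi_mulVec]
  refine ⟨lin_int R hR psi (psi_integrable q), ?_⟩
  rw [lin_cov R hR psi, psi_integral, hd, Real.sqrt_sq_eq_abs]
  have h2 : (2 * π) ^ (-(q : ℝ) / 2) * Real.sqrt (2 * π) ^ q = 1 := by
    rw [Real.sqrt_eq_rpow, ← Real.rpow_natCast, ← Real.rpow_mul (by positivity), ← Real.rpow_add (by positivity)]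
    rw [show -(q:ℝ) / 2 + 1 / 2 * q = 0 by ring, Real.rpow_zero]
  have h3 : |R.det| ≠ 0 := abs_ne_zero.2 hR
  calc _ = (|R.det| * |R.det|⁻¹) * ((2 * π) ^ (-(q : ℝ) / 2) * Real.sqrt (2 * π) ^ q) := by ring
    _ = 1 := by rw [h2, mul_inv_cancel₀ h3, one_mul]

lemma tv_abs {q : ℕ} (a b : (Fin q → ℝ) → ℝ) (ha0 : ∀ u, 0 ≤ a u) (ha : Integrable a) (hb : Integrable b)
    (b0 δ : ℝ) (hb0 : 0 < b0) (hδ : 0 ≤ δ) (hB : b0 ≤ ∫ u, b u) (hJ : ∫⁻ u, ENNReal.ofReal |a u - b u| ≤ ENNReal.ofReal δ)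
    (F : Set (Fin q → ℝ)) :
    |(∫ u in F, a u) / (∫ u, a u) - (∫ u in F, b u) / ∫ u, b u| ≤ 2 * δ / b0 := by
  have hd : ∫ u, |a u - b u| ≤ δ := by
    have hi : Integrable fun u => |a u - b u| := (ha.sub hb).abs
    rw [integral_eq_lintegral_of_nonneg_ae (Filter.Eventually.of_forall fun u => abs_nonneg _) hi.aestronglyMeasurable]
    exact ENNReal.toReal_le_of_le_ofReal hδ hJ
  have hdF : |(∫ u in F, a u) - ∫ u in F, b u| ≤ δ := by
    rw [← integral_sub ha.integrableOn hb.integrableOn]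
    refine (abs_integral_le_integral_abs).trans (le_trans ?_ hd)
    exact setIntegral_le_integral (ha.sub hb).abs (Filter.Eventually.of_forall fun u => abs_nonneg _)
  have hdU : |(∫ u, b u) - ∫ u, a u| ≤ δ := by
    rw [abs_sub_comm, ← integral_sub ha hb]
    exact (abs_integral_le_integral_abs).trans hd
  have hF0 : 0 ≤ ∫ u in F, a u := integral_nonneg ha0
  have hF1 : ∫ u in F, a u ≤ ∫ u, a u := setIntegral_le_integral ha (Filter.Eventually.of_forall ha0)
  set x := ∫ u in F, a u
  set y := ∫ u in F, b u
  set A := ∫ u, a u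
  set C := ∫ u, b u
  have hC : 0 < C := lt_of_lt_of_le hb0 hB
  have hx : 0 ≤ x / A := div_nonneg hF0 (hF0.trans hF1)
  have hx1 : x / A ≤ 1 := div_le_one_of_le₀ hF1 (hF0.trans hF1)
  have e : x / A - y / C = (x / A) * (C - A) / C + (x - y) / C := by
    rcases eq_or_ne A 0 with h | h
    · have : x = 0 := by linarith
      rw [h, this]; ring
    · field_simp; ring
  rw [e]
  calc |(x / A) * (C - A) / C + (x - y) / C| ≤ |(x / A) * (C - A) / C| + |(x - y) / C| := abs_add_le _ _
    _ = (x / A) * |C - A| / C + |x - y| / C := by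
      rw [abs_div, abs_div, abs_mul, abs_of_pos hC, abs_of_nonneg hx]
    _ ≤ 1 * δ / b0 + δ / b0 := by gcongr
    _ = _ := by ring

lemma quad_sub {q : ℕ} (M : Matrix (Fin q) (Fin q) ℝ) (hs : Mᵀ = M) (hdet : M.det ≠ 0) (W u : Fin q → ℝ) :
    (u - M⁻¹.mulVec W) ⬝ᵥ M.mulVec (u - M⁻¹.mulVec W) = u ⬝ᵥ M.mulVec u - 2 * (u ⬝ᵥ W) + W ⬝ᵥ M⁻¹.mulVec W := by
  have h1 : M.mulVec (M⁻¹.mulVec W) = W := by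
    rw [Matrix.mulVec_mulVec, Matrix.mul_nonsing_inv _ hdet.isUnit, Matrix.one_mulVec]
  have h2 : M⁻¹.mulVec W ⬝ᵥ M.mulVec u = u ⬝ᵥ W := by
    rw [Matrix.dotProduct_mulVec, ← Matrix.mulVec_transpose, hs, h1, dotProduct_comm]
  rw [Matrix.mulVec_sub, h1, sub_dotProduct, dotProduct_sub, dotProduct_sub, h2, dotProduct_comm (M⁻¹.mulVec W) W]
  ring

lemma quad_inv_nonneg {q : ℕ} (M : Matrix (Fin q) (Fin q) ℝ) (hM : M.PosSemidef) (hdet : M.det ≠ 0) (W : Fin q → ℝ) :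
    0 ≤ W ⬝ᵥ M⁻¹.mulVec W := by
  have := hM.inv.dotProduct_mulVec_nonneg W
  simpa using this

lemma qU_eq {n q : ℕ} (M : Matrix (Fin q) (Fin q) ℝ) (hs : Mᵀ = M) (hdet : M.det ≠ 0) (z : Fin n → Fin q → ℝ) (e : Fin n → ℝ)
    (β₀ u : Fin q → ℝ) : qU M z e β₀ u = (psi β₀ * Real.exp ((Wv z e ⬝ᵥ M⁻¹.mulVec (Wv z e)) / 2)) *
      Real.exp (-(1 / 2) * ((u - M⁻¹.mulVec (Wv z e)) ⬝ᵥ M.mulVec (u - M⁻¹.mulVec (Wv z e)))) := by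
  rw [quad_sub M hs hdet, qU, mul_comm _ (psi β₀), mul_assoc, ← Real.exp_add]
  congr 2; ring

lemma normal_facts {n q : ℕ} (M : Matrix (Fin q) (Fin q) ℝ) (hM : M.PosSemidef) (hdet : M.det ≠ 0)
    (z : Fin n → Fin q → ℝ) (e : Fin n → ℝ) (β₀ : Fin q → ℝ) :
    Integrable (qU M z e β₀) ∧ psi β₀ / (Real.sqrt M.det * (2 * π) ^ (-(q : ℝ) / 2)) ≤ (∫ u, qU M z e β₀ u) ∧
    ∀ F, normalProb q (M⁻¹.mulVec (Wv z e)) M F = (∫ u in F, qU M z e β₀ u) / ∫ u, qU M z e β₀ u := by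
  have hs : Mᵀ = M := by
    have := hM.isHermitian
    rwa [Matrix.IsHermitian, Matrix.conjTranspose_eq_transpose_of_trivial] at this
  obtain ⟨h1, h2⟩ := normal_one M hM hdet
  set Δ := M⁻¹.mulVec (Wv z e) with hΔ
  set k := Real.sqrt M.det * (2 * π) ^ (-(q : ℝ) / 2) with hk
  have hk0 : 0 < k := by
    have : 0 < M.det := lt_of_le_of_ne hM.det_nonneg hdet.symm
    positivity
  set f := fun v : Fin q → ℝ => Real.exp (-(1 / 2) * (v ⬝ᵥ M.mulVec v)) with hf
  set s := psi β₀ * Real.exp ((Wv z e ⬝ᵥ M⁻¹.mulVec (Wv z e)) / 2) with hsd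
  have hpp := psi_pos β₀
  have hs0 : 0 < s := by positivity
  have hq : qU M z e β₀ = fun u => s * f (u - Δ) := funext fun u => qU_eq M hs hdet z e β₀ u
  have hfi : Integrable fun u => f (u - Δ) := h1.comp_sub_right Δ
  have hint : ∫ u, f (u - Δ) = ∫ u, f u := integral_sub_right_eq_self f Δ
  have hk2 : ∫ u, f u = 1 / k := by field_simp; linarith
  rw [hq]
  refine ⟨hfi.const_mul s, ?_, fun F => ?_⟩
  · simp only
    rw [integral_const_mul, hint, hk2, mul_one_div]
    gcongr
    rw [hsd]
    have := quad_inv_nonneg M hM hdet (Wv z e)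
    have : 1 ≤ Real.exp ((Wv z e ⬝ᵥ M⁻¹.mulVec (Wv z e)) / 2) := Real.one_le_exp (by positivity)
    nlinarith
  · simp only
    rw [integral_const_mul, integral_const_mul, hint, hk2]
    unfold normalProb
    simp only [← hk]
    rw [integral_const_mul]
    change k * (∫ v in F, f (v - Δ)) = _
    generalize ∫ v in F, f (v - Δ) = t
    field_simp

def mkd {p q n : ℕ} (β₀ : Fin q → ℝ) (η₀ : (Fin p → ℝ) → ℝ) (x : Fin n → Fin p → ℝ) (z : Fin n → Fin q → ℝ) (e : Fin n → ℝ) :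
    Fin n → (Fin p → ℝ) × (Fin q → ℝ) × ℝ := fun i => (x i, z i, e i + (∑ j, z i j * β₀ j) + η₀ (x i))

lemma gaussD_sub (e t : ℝ) : gaussD 1 (e - t) = gaussD 1 e * Real.exp (e * t - t ^ 2 / 2) := by
  unfold gaussD
  rw [mul_assoc, ← Real.exp_add]
  congr 2; ring

lemma gaussD_pos (e : ℝ) : 0 < gaussD 1 e := by unfold gaussD; positivity

lemma likPL_eq {p q n : ℕ} (β₀ : Fin q → ℝ) (η₀ : (Fin p → ℝ) → ℝ) (x : Fin n → Fin p → ℝ) (z : Fin n → Fin q → ℝ) (e : Fin n → ℝ)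
    (η : (Fin p → ℝ) → ℝ) (β : Fin q → ℝ) : likPL η β (mkd β₀ η₀ x z e) =
      (∏ i, gaussD 1 (e i)) * LRf (fun i => η (x i) - η₀ (x i)) z e (β - β₀) := by
  unfold likPL LRf mkd
  rw [Real.exp_sum, ← Finset.prod_mul_distrib]
  refine Finset.prod_congr rfl fun i _ => ?_
  rw [← gaussD_sub]
  congr 1
  rw [dotProduct_sub]
  simp only [dotProduct]
  ring

section post
variable {Ω : Type*} [MeasurableSpace Ω] (Q : Measure Ω) [IsProbabilityMeasure Q]

lemma cov_F {q n : ℕ} (hn : 1 ≤ n) (β₀ : Fin q → ℝ) (H : (Fin q → ℝ) → ℝ) (F : Set (Fin q → ℝ)) (hF : MeasurableSet F) :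
    ∫ β in {β : Fin q → ℝ | Real.sqrt n • (β - β₀) ∈ F}, H β =
      (Real.sqrt n ^ q)⁻¹ * ∫ u in F, H (β₀ + (Real.sqrt n)⁻¹ • u) := by
  have hn0 : (0:ℝ) < n := by exact_mod_cast hn
  have hs : 0 < Real.sqrt n := Real.sqrt_pos.2 hn0
  have hG : MeasurableSet {β : Fin q → ℝ | Real.sqrt n • (β - β₀) ∈ F} := by
    have : Measurable fun β : Fin q → ℝ => Real.sqrt n • (β - β₀) := by fun_prop
    exact this hF
  set f : (Fin q → ℝ) → ℝ := F.indicator fun u => H (β₀ + (Real.sqrt n)⁻¹ • u) with hf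
  have e1 : ∀ β, ({β : Fin q → ℝ | Real.sqrt n • (β - β₀) ∈ F}).indicator H β = f (Real.sqrt n • (β - β₀)) := by
    intro β
    by_cases h : Real.sqrt n • (β - β₀) ∈ F
    · rw [Set.indicator_of_mem (show β ∈ {β : Fin q → ℝ | Real.sqrt n • (β - β₀) ∈ F} from h), hf, Set.indicator_of_mem h]
      rw [smul_smul, inv_mul_cancel₀ hs.ne', one_smul, add_sub_cancel]
    · rw [Set.indicator_of_notMem (show β ∉ {β : Fin q → ℝ | Real.sqrt n • (β - β₀) ∈ F} from h), hf, Set.indicator_of_notMem h]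
  rw [← integral_indicator hG]
  simp only [e1]
  rw [integral_sub_right_eq_self (fun β => f (Real.sqrt n • β)) β₀, Measure.integral_comp_smul, hf, integral_indicator hF]
  rw [abs_of_pos (by positivity), Module.finrank_fin_fun, smul_eq_mul]

lemma pU_meas {n q : ℕ} (g : Ω → Fin n → ℝ) (hg : Measurable g) (z : Fin n → Fin q → ℝ) (e : Fin n → ℝ) (β₀ : Fin q → ℝ) :
    Measurable (pU Q g z e β₀) := by
  unfold pU
  refine Measurable.mul ?_ (psi_meas.comp (by fun_prop))
  have h : Measurable (fun w : (Fin q → ℝ) × Ω => LRf (g w.2) z e ((Real.sqrt n)⁻¹ • w.1)) :=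
    LRf_meas.comp ((hg.comp measurable_snd).prodMk (measurable_const.prodMk (measurable_const.prodMk (by fun_prop))))
  exact (h.stronglyMeasurable.integral_prod_right (ν := Q)).measurable

lemma pU_nonneg {n q : ℕ} (g : Ω → Fin n → ℝ) (z : Fin n → Fin q → ℝ) (e : Fin n → ℝ) (β₀ u : Fin q → ℝ) :
    0 ≤ pU Q g z e β₀ u := mul_nonneg (integral_nonneg fun ω => (LRf_pos _ _ _ _).le) (psi_pos _).le

lemma pU_int {n q : ℕ} (hn : 1 ≤ n) (g : Ω → Fin n → ℝ) (hg : Measurable g) (z : Fin n → Fin q → ℝ) (e : Fin n → ℝ) (β₀ : Fin q → ℝ) :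
    Integrable (pU Q g z e β₀) := by
  have hn0 : (0:ℝ) < n := by exact_mod_cast hn
  have hs : 0 < Real.sqrt n := Real.sqrt_pos.2 hn0
  have h1 : Integrable fun u : Fin q → ℝ => psi (β₀ + (Real.sqrt n)⁻¹ • u) :=
    ((psi_integrable q).comp_add_left β₀).comp_smul (inv_ne_zero hs.ne')
  refine (h1.const_mul (Real.exp (∑ i, e i ^ 2 / 2))).mono' (pU_meas Q g hg z e β₀).aestronglyMeasurable ?_
  refine Filter.Eventually.of_forall fun u => ?_
  rw [Real.norm_of_nonneg (pU_nonneg Q g z e β₀ u)]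
  unfold pU
  refine mul_le_mul_of_nonneg_right ?_ (psi_pos _).le
  calc _ ≤ ∫ _ω, Real.exp (∑ i, e i ^ 2 / 2) ∂Q :=
        integral_mono (LRf_int Q g hg z e _) (integrable_const _) fun ω => LRf_le _ _ _ _
    _ = _ := by simp

lemma ZU_pos {n : ℕ} (g : Ω → Fin n → ℝ) (hg : Measurable g) (e : Fin n → ℝ) : 0 < ZU Q g e := by
  unfold ZU
  rw [integral_pos_iff_support_of_nonneg (fun ω => (ell_pos _ _).le) (ell_int Q g hg e)]
  have : Function.support (fun ω => ell (g ω) e) = Set.univ := by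
    ext ω; simpa using (ell_pos _ _).ne'
  rw [this, measure_univ]; exact one_pos

lemma post_int {p q n : ℕ} (hn : 1 ≤ n) (Ψ : Ω → (Fin p → ℝ) → ℝ) (hΨ : Measurable Ψ) (β₀ : Fin q → ℝ) (η₀ : (Fin p → ℝ) → ℝ)
    (x : Fin n → Fin p → ℝ) (z : Fin n → Fin q → ℝ) (e : Fin n → ℝ) (F : Set (Fin q → ℝ)) (hF : MeasurableSet F) :
    ∫ θ in {θ : ((Fin p → ℝ) → ℝ) × (Fin q → ℝ) | Real.sqrt n • (θ.2 - β₀) ∈ F}, likPL θ.1 θ.2 (mkd β₀ η₀ x z e)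
        ∂((Q.map Ψ).prod (Measure.pi fun _ : Fin q => ProbabilityTheory.gaussianReal 0 1)) =
      ((∏ i, gaussD 1 (e i)) * ((Real.sqrt (2 * π))⁻¹) ^ q * (Real.sqrt n ^ q)⁻¹) *
        ∫ u in F, pU Q (fun ω i => Ψ ω (x i) - η₀ (x i)) z e β₀ u := by
  have hg : Measurable fun ω => (fun i => Ψ ω (x i) - η₀ (x i)) :=
    measurable_pi_lambda _ fun i => ((measurable_pi_apply (x i)).comp hΨ).sub measurable_const
  haveI : IsProbabilityMeasure (Q.map Ψ) := Measure.isProbabilityMeasure_map hΨ.aemeasurable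
  set G := {β : Fin q → ℝ | Real.sqrt n • (β - β₀) ∈ F} with hG
  have hGm : MeasurableSet G := by
    have : Measurable fun β : Fin q → ℝ => Real.sqrt n • (β - β₀) := by fun_prop
    exact this hF
  have hset : {θ : ((Fin p → ℝ) → ℝ) × (Fin q → ℝ) | Real.sqrt n • (θ.2 - β₀) ∈ F} = Set.univ ×ˢ G := by
    ext θ; simp [hG]
  simp only [likPL_eq]
  rw [integral_const_mul, hset, ← Measure.prod_restrict, Measure.restrict_univ]
  have hL : Measurable fun θ : ((Fin p → ℝ) → ℝ) × (Fin q → ℝ) => LRf (fun i => θ.1 (x i) - η₀ (x i)) z e (θ.2 - β₀) := by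
    refine LRf_meas.comp (Measurable.prodMk ?_ (measurable_const.prodMk (measurable_const.prodMk (by fun_prop))))
    exact measurable_pi_lambda _ fun i => ((measurable_pi_apply (x i)).comp measurable_fst).sub measurable_const
  rw [integral_prod_symm _ (Integrable.of_bound hL.aestronglyMeasurable (Real.exp (∑ i, e i ^ 2 / 2))
    (Filter.Eventually.of_forall fun θ => by
      rw [Real.norm_of_nonneg (LRf_pos _ _ _ _).le]; exact LRf_le _ _ _ _))]
  have hin : ∀ β : Fin q → ℝ, ∫ η, LRf (fun i => η (x i) - η₀ (x i)) z e (β - β₀) ∂(Q.map Ψ) =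
      ∫ ω, LRf (fun i => Ψ ω (x i) - η₀ (x i)) z e (β - β₀) ∂Q := by
    intro β
    rw [integral_map hΨ.aemeasurable]
    exact (hL.comp (measurable_id.prodMk measurable_const)).aestronglyMeasurable
  simp only [hin]
  rw [pi_gauss, restrict_withDensity hGm, integral_withDensity_eq_integral_toReal_smul
    (by have := psi_meas (q := q); fun_prop) (Filter.Eventually.of_forall fun _ => ENNReal.ofReal_lt_top)]
  have hpp : ∀ β : Fin q → ℝ, 0 ≤ ((Real.sqrt (2 * π))⁻¹) ^ q * psi β := fun β => mul_nonneg (by positivity) (psi_pos β).le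
  simp only [ENNReal.toReal_ofReal (hpp _), smul_eq_mul]
  rw [cov_F hn β₀ _ F hF]
  simp only [add_sub_cancel_left, pU]
  simp only [mul_assoc, integral_const_mul]
  simp only [mul_comm (psi _)]
  ring

end post

lemma center_eq {p q n : ℕ} (M : Matrix (Fin q) (Fin q) ℝ) (β₀ : Fin q → ℝ) (η₀ : (Fin p → ℝ) → ℝ)
    (x : Fin n → Fin p → ℝ) (z : Fin n → Fin q → ℝ) (e : Fin n → ℝ) :
    bvmCenter n M β₀ η₀ (mkd β₀ η₀ x z e) = M⁻¹.mulVec (Wv z e) := by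
  unfold bvmCenter mkd Wv
  rw [Matrix.mulVec_smul, Matrix.mulVec_sum]
  congr 1
  refine Finset.sum_congr rfl fun i _ => ?_
  rw [Matrix.mulVec_smul]
  congr 1
  ring

lemma det_bound {Ω : Type*} [MeasurableSpace Ω] (Q : Measure Ω) [IsProbabilityMeasure Q]
    {p q n : ℕ} (hn : 1 ≤ n) (Ψ : Ω → (Fin p → ℝ) → ℝ) (hΨ : Measurable Ψ) (β₀ : Fin q → ℝ) (η₀ : (Fin p → ℝ) → ℝ)
    (M : Matrix (Fin q) (Fin q) ℝ) (hM : M.PosSemidef) (hdet : M.det ≠ 0) (δ : ℝ) (hδ : 0 < δ)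
    (x : Fin n → Fin p → ℝ) (z : Fin n → Fin q → ℝ) (e : Fin n → ℝ)
    (hbad : δ < ⨆ F : {F : Set (Fin q → ℝ) // MeasurableSet F},
                |postGen ((Q.map Ψ).prod (Measure.pi fun _ : Fin q => ProbabilityTheory.gaussianReal 0 1))
                  (fun θ => likPL θ.1 θ.2 (mkd β₀ η₀ x z e))
                    {θ : ((Fin p → ℝ) → ℝ) × (Fin q → ℝ) |
                      Real.sqrt n • (θ.2 - β₀) ∈ F.1} -
                  normalProb q (bvmCenter n M β₀ η₀ (mkd β₀ η₀ x z e)) M F.1|) :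
    ENNReal.ofReal (δ * (psi β₀ / (Real.sqrt M.det * (2 * π) ^ (-(q : ℝ) / 2))) / 2) <
      JU Q M (fun ω i => Ψ ω (x i) - η₀ (x i)) z e β₀ := by
  by_contra hJ
  rw [not_lt] at hJ
  refine absurd hbad (not_lt.2 ?_)
  haveI : Nonempty {F : Set (Fin q → ℝ) // MeasurableSet F} := ⟨⟨∅, MeasurableSet.empty⟩⟩
  refine ciSup_le fun F => ?_
  obtain ⟨h1, h2, h3⟩ := normal_facts M hM hdet z e β₀
  set b0 := psi β₀ / (Real.sqrt M.det * (2 * π) ^ (-(q : ℝ) / 2)) with hb0d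
  have hdp : 0 < M.det := lt_of_le_of_ne hM.det_nonneg hdet.symm
  have hb0 : 0 < b0 := div_pos (psi_pos _) (mul_pos (Real.sqrt_pos.2 hdp) (by positivity))
  rw [center_eq, h3]
  have hg : Measurable fun ω => (fun i => Ψ ω (x i) - η₀ (x i)) :=
    measurable_pi_lambda _ fun i => ((measurable_pi_apply (x i)).comp hΨ).sub measurable_const
  set g : Ω → Fin n → ℝ := fun ω i => Ψ ω (x i) - η₀ (x i) with hgd
  have hZ := ZU_pos Q g hg e
  have hpost : postGen ((Q.map Ψ).prod (Measure.pi fun _ : Fin q => ProbabilityTheory.gaussianReal 0 1))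
                  (fun θ => likPL θ.1 θ.2 (mkd β₀ η₀ x z e))
                    {θ : ((Fin p → ℝ) → ℝ) × (Fin q → ℝ) |
                      Real.sqrt n • (θ.2 - β₀) ∈ F.1} =
      (∫ u in F.1, pU Q g z e β₀ u / ZU Q g e) / ∫ u, pU Q g z e β₀ u / ZU Q g e := by
    unfold postGen
    have hu := post_int Q hn Ψ hΨ β₀ η₀ x z e Set.univ MeasurableSet.univ
    simp only [Set.mem_univ, Set.setOf_true, Measure.restrict_univ] at hu
    rw [post_int Q hn Ψ hΨ β₀ η₀ x z e F.1 F.2, hu, integral_div, integral_div,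
      div_div_div_cancel_right₀ hZ.ne']
    refine mul_div_mul_left _ _ ?_
    have hn0 : (0:ℝ) < n := by exact_mod_cast hn
    have := Finset.prod_pos (fun i (_ : i ∈ (Finset.univ : Finset (Fin n))) => gaussD_pos (e i))
    have hs : 0 < Real.sqrt n := Real.sqrt_pos.2 hn0
    positivity
  rw [hpost]
  have := tv_abs (fun u => pU Q g z e β₀ u / ZU Q g e) (qU M z e β₀)
    (fun u => div_nonneg (pU_nonneg Q g z e β₀ u) hZ.le) ((pU_int Q hn g hg z e β₀).div_const _) h1 b0
    (δ * b0 / 2) hb0 (by positivity) h2 hJ F.1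
  refine this.trans (le_of_eq ?_)
  field_simp

lemma Ph_joint {p m K : ℕ} (φ : (Fin p → ℝ) → ℝ) (hφ : Continuous φ) :
    Measurable fun w : Par p m K × (Fin p → ℝ) => Ph φ m K w.1 w.2 := by
  simp only [Ph_eq, Pk, mono, arg]
  have h : ∀ k : Fin p → Fin K, Measurable fun w : Par p m K × (Fin p → ℝ) =>
      φ (fun j => (w.2 j - (center K k + (2 * (K : ℝ))⁻¹ • w.1.1 k) j) / w.1.2.2) := by
    intro k
    refine hφ.measurable.comp (measurable_pi_lambda _ fun j => ?_)
    simp only [Pi.add_apply, Pi.smul_apply]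
    fun_prop
  refine Measurable.div ?_ ?_
  · refine Finset.measurable_fun_sum _ fun k _ => (h k).mul ?_
    fun_prop
  · exact Finset.measurable_fun_sum _ fun k _ => h k

def prK {p m : ℕ} (K : ℕ) (ω : Om p m) : Par p m K := if h : ω.1 = K then h ▸ ω.2 else 0

lemma prK_meas {p m : ℕ} (K : ℕ) : Measurable (prK (p := p) (m := m) K) := by
  intro s hs
  refine meas_sigma_set _ fun L => ?_
  by_cases h : L = K
  · subst h
    have : (Sigma.mk L : Par p m L → Om p m) ⁻¹' (prK L ⁻¹' s) = s := by
      ext θ; simp [prK]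
    rw [this]; exact hs
  · have : (Sigma.mk L : Par p m L → Om p m) ⁻¹' (prK K ⁻¹' s) = {_θ | (0 : Par p m K) ∈ s} := by
      ext θ; simp [prK, h]
    rw [this]; exact MeasurableSet.const _

lemma PsiO_joint {p m : ℕ} (φ : (Fin p → ℝ) → ℝ) (hφ : Continuous φ) :
    Measurable fun w : Om p m × (Fin p → ℝ) => PsiO φ m w.1 w.2 := by
  have h1 : Measurable fun w : ℕ × (Om p m × (Fin p → ℝ)) => Ph φ m w.1 (prK w.1 w.2.1) w.2.2 := by
    refine measurable_from_prod_countable_right fun K => ?_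
    have hf : Measurable fun w : Om p m × (Fin p → ℝ) => (prK K w.1, w.2) :=
      ((prK_meas K).comp measurable_fst).prodMk measurable_snd
    have h := Measurable.comp (Ph_joint (m := m) (K := K) φ hφ) hf
    exact h
  have h2 : Measurable fun ω : Om p m => ω.1 := by
    intro s hs
    refine meas_sigma_set _ fun L => ?_
    exact MeasurableSet.const (L ∈ s)
  have h3 := h1.comp ((h2.comp measurable_fst).prodMk (measurable_id (α := Om p m × (Fin p → ℝ))))
  have h4 : (fun w : Om p m × (Fin p → ℝ) => PsiO φ m w.1 w.2) =
      fun w : Om p m × (Fin p → ℝ) => Ph φ m w.1.1 (prK w.1.1 w.1) w.2 := by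
    funext w
    simp [PsiO, prK]
  rw [h4]
  exact h3

lemma JU_joint {Ω : Type*} [MeasurableSpace Ω] (Q : Measure Ω) [IsProbabilityMeasure Q]
    {p q n : ℕ} (Ψ : Ω → (Fin p → ℝ) → ℝ) (hΨ : Measurable fun w : Ω × (Fin p → ℝ) => Ψ w.1 w.2)
    (η₀ : (Fin p → ℝ) → ℝ) (hη : Measurable η₀) (M : Matrix (Fin q) (Fin q) ℝ) (β₀ : Fin q → ℝ) :
    Measurable fun w : (Fin n → Fin p → ℝ) × (Fin n → Fin q → ℝ) × (Fin n → ℝ) =>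
      JU Q M (fun ω i => Ψ ω (w.1 i) - η₀ (w.1 i)) w.2.1 w.2.2 β₀ := by
  unfold JU
  have hG : Measurable fun t : ((((Fin n → Fin p → ℝ) × (Fin n → Fin q → ℝ) × (Fin n → ℝ)) × (Fin q → ℝ)) × Ω) =>
      (fun i => Ψ t.2 (t.1.1.1 i) - η₀ (t.1.1.1 i)) := by
    refine measurable_pi_lambda _ fun i => Measurable.sub ?_ (hη.comp (by fun_prop))
    exact hΨ.comp (f := fun t : ((((Fin n → Fin p → ℝ) × (Fin n → Fin q → ℝ) × (Fin n → ℝ)) × (Fin q → ℝ)) × Ω) => (t.2, t.1.1.1 i)) (by fun_prop)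
  refine Measurable.lintegral_prod_right' (f := fun t : (((Fin n → Fin p → ℝ) × (Fin n → Fin q → ℝ) × (Fin n → ℝ)) × (Fin q → ℝ)) =>
    ENNReal.ofReal |pU Q (fun ω i => Ψ ω (t.1.1 i) - η₀ (t.1.1 i)) t.1.2.1 t.1.2.2 β₀ t.2 / ZU Q (fun ω i => Ψ ω (t.1.1 i) - η₀ (t.1.1 i)) t.1.2.2 - qU M t.1.2.1 t.1.2.2 β₀ t.2|) ?_
  refine ENNReal.measurable_ofReal.comp (_root_.continuous_abs.measurable.comp ?_)
  refine Measurable.sub (Measurable.div ?_ ?_) ?_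
  · unfold pU
    refine Measurable.mul ?_ (psi_meas.comp (by fun_prop))
    refine (StronglyMeasurable.integral_prod_right (ν := Q) (Measurable.stronglyMeasurable ?_)).measurable
    have h2 : Measurable fun t : ((((Fin n → Fin p → ℝ) × (Fin n → Fin q → ℝ) × (Fin n → ℝ)) × (Fin q → ℝ)) × Ω) => (t.1.1.2.1, t.1.1.2.2, (Real.sqrt n)⁻¹ • t.1.2) := by fun_prop
    have h := Measurable.comp (LRf_meas (n := n) (q := q)) (hG.prodMk h2)
    exact h
  · unfold ZU
    refine (StronglyMeasurable.integral_prod_right (ν := Q) (Measurable.stronglyMeasurable ?_)).measurable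
    have h2 : Measurable fun t : ((((Fin n → Fin p → ℝ) × (Fin n → Fin q → ℝ) × (Fin n → ℝ)) × (Fin q → ℝ)) × Ω) => t.1.1.2.2 := by fun_prop
    have h := Measurable.comp (ell_meas (n := n)) (hG.prodMk h2)
    exact h
  · unfold qU Wv Matrix.mulVec dotProduct
    refine Measurable.mul ?_ measurable_const
    fun_prop

lemma gam_dens : gam = (volume : Measure ℝ).withDensity fun e => ENNReal.ofReal (gaussD 1 e) := by
  unfold gam
  rw [ProbabilityTheory.gaussianReal_of_var_ne_zero 0 one_ne_zero]
  congr 1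
  funext e
  simp [ProbabilityTheory.gaussianPDF, ProbabilityTheory.gaussianPDFReal, gaussD]

lemma T_pres {p q : ℕ} (β₀ : Fin q → ℝ) (η₀ : (Fin p → ℝ) → ℝ) (hη : Measurable η₀) :
    MeasurePreserving (fun w : (Fin p → ℝ) × (Fin q → ℝ) × ℝ => (w.1, w.2.1, w.2.2 + (∑ j, w.2.1 j * β₀ j) + η₀ w.1))
      volume volume := by
  have inner : ∀ x : Fin p → ℝ, MeasurePreserving (fun w : (Fin q → ℝ) × ℝ => (w.1, w.2 + (∑ j, w.1 j * β₀ j) + η₀ x))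
      volume volume := by
    intro x
    refine MeasurePreserving.skew_product (μa := (volume : Measure (Fin q → ℝ))) (μc := (volume : Measure ℝ))
      (f := id) (g := fun z e => e + (∑ j, z j * β₀ j) + η₀ x) (MeasurePreserving.id _) ?_ ?_
    · unfold Function.uncurry; fun_prop
    · refine Filter.Eventually.of_forall fun z => ?_
      simp only [add_assoc]
      exact (measurePreserving_add_right volume _).map_eq
  refine MeasurePreserving.skew_product (μa := (volume : Measure (Fin p → ℝ))) (μc := (volume : Measure ((Fin q → ℝ) × ℝ)))
      (f := id) (g := fun x w => (w.1, w.2 + (∑ j, w.1 j * β₀ j) + η₀ x)) (MeasurePreserving.id _) ?_ ?_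
  · unfold Function.uncurry; fun_prop
  · exact Filter.Eventually.of_forall fun x => (inner x).map_eq

def Pxm {p : ℕ} (px : (Fin p → ℝ) → ℝ) : Measure (Fin p → ℝ) :=
  volume.withDensity fun x => ENNReal.ofReal ((cube p).indicator px x)
def Pzm {q : ℕ} (pz : (Fin q → ℝ) → ℝ) : Measure (Fin q → ℝ) :=
  volume.withDensity fun z => ENNReal.ofReal (pz z)

lemma cube_meas (p : ℕ) : MeasurableSet (cube p) := by rw [cube_eq]; exact measurableSet_Icc

lemma true_map {p q : ℕ} (px : (Fin p → ℝ) → ℝ) (hpxm : Measurable px) (hpx0 : ∀ x ∈ cube p, 0 ≤ px x)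
    (pz : (Fin q → ℝ) → ℝ) (hpzm : Measurable pz) (hpz0 : ∀ z, 0 ≤ pz z)
    (β₀ : Fin q → ℝ) (η₀ : (Fin p → ℝ) → ℝ) (hη : Measurable η₀) :
    MeasurePreserving (fun w : (Fin p → ℝ) × (Fin q → ℝ) × ℝ => (w.1, w.2.1, w.2.2 + (∑ j, w.2.1 j * β₀ j) + η₀ w.1))
      ((Pxm px).prod ((Pzm pz).prod gam)) (trueMeasPL p q px pz β₀ η₀) := by
  have hT := T_pres (p := p) (q := q) β₀ η₀ hη
  have hi : Measurable ((cube p).indicator px) := hpxm.indicator (cube_meas p)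
  have hgm : Measurable (gaussD 1) := by unfold gaussD; fun_prop
  have hxm : Measurable fun x => ENNReal.ofReal ((cube p).indicator px x) := ENNReal.measurable_ofReal.comp hi
  have hzm : Measurable fun z => ENNReal.ofReal (pz z) := ENNReal.measurable_ofReal.comp hpzm
  have hem : Measurable fun e => ENNReal.ofReal (gaussD 1 e) := ENNReal.measurable_ofReal.comp hgm
  refine ⟨hT.measurable, ?_⟩
  have hD : Measurable fun w : (Fin p → ℝ) × (Fin q → ℝ) × ℝ =>
    ENNReal.ofReal ((cube p).indicator px w.1 * pz w.2.1 *
      gaussD 1 (w.2.2 - (∑ i, w.2.1 i * β₀ i) - η₀ w.1)) := by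
    refine ENNReal.measurable_ofReal.comp (((hi.comp measurable_fst).mul (hpzm.comp (by fun_prop))).mul (hgm.comp (by fun_prop)))
  rw [gam_dens, Pxm, Pzm, prod_withDensity hzm hem, prod_withDensity hxm (by fun_prop)]
  ext A hA
  rw [Measure.map_apply hT.measurable hA, withDensity_apply _ (hT.measurable hA), trueMeasPL, withDensity_apply _ hA,
    ← hT.setLIntegral_comp_preimage hA hD]
  refine lintegral_congr fun w => ?_
  simp only
  rw [← ENNReal.ofReal_mul (hpz0 _), ← ENNReal.ofReal_mul (Set.indicator_nonneg hpx0 _)]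
  congr 1
  have : w.2.2 + (∑ j, w.2.1 j * β₀ j) + η₀ w.1 - (∑ j, w.2.1 j * β₀ j) - η₀ w.1 = w.2.2 := by ring
  rw [this]; ring

lemma pi_true {p q n : ℕ} (px : (Fin p → ℝ) → ℝ) (hpxm : Measurable px) (hpx0 : ∀ x ∈ cube p, 0 ≤ px x)
    (pz : (Fin q → ℝ) → ℝ) (hpzm : Measurable pz) (hpz0 : ∀ z, 0 ≤ pz z)
    [IsProbabilityMeasure (Pxm px)] [IsProbabilityMeasure (Pzm pz)]
    (β₀ : Fin q → ℝ) (η₀ : (Fin p → ℝ) → ℝ) (hη : Measurable η₀) :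
    MeasurePreserving (fun w : (Fin n → Fin p → ℝ) × (Fin n → Fin q → ℝ) × (Fin n → ℝ) => mkd β₀ η₀ w.1 w.2.1 w.2.2)
      ((Measure.pi fun _ => Pxm px).prod (Pdat n (Pzm pz)))
      (Measure.pi fun _ : Fin n => trueMeasPL p q px pz β₀ η₀) := by
  have h1 := true_map px hpxm hpx0 pz hpzm hpz0 β₀ η₀ hη
  haveI : IsProbabilityMeasure (trueMeasPL p q px pz β₀ η₀) := h1.map_eq ▸ Measure.isProbabilityMeasure_map h1.measurable.aemeasurable
  have h2 := measurePreserving_pi (ι := Fin n) (fun _ => (Pxm px).prod ((Pzm pz).prod gam)) (fun _ => trueMeasPL p q px pz β₀ η₀) (fun _ => h1)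
  have h3 := (measurePreserving_arrowProdEquivProdArrow (Fin p → ℝ) ((Fin q → ℝ) × ℝ) (Fin n) (fun _ => Pxm px) (fun _ => (Pzm pz).prod gam)).symm
  have h4 := (measurePreserving_arrowProdEquivProdArrow (Fin q → ℝ) ℝ (Fin n) (fun _ => Pzm pz) (fun _ => gam)).symm
  have h5 := (MeasurePreserving.id (Measure.pi fun _ : Fin n => Pxm px)).prod h4
  exact h2.comp (h3.comp h5)

lemma data_bound {Ω : Type*} [MeasurableSpace Ω] (Q : Measure Ω) [IsProbabilityMeasure Q]
    {p q n : ℕ} (hn : 1 ≤ n) (Ψ : Ω → (Fin p → ℝ) → ℝ) (hΨ : Measurable Ψ)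
    (hΨj : Measurable fun w : Ω × (Fin p → ℝ) => Ψ w.1 w.2)
    (px : (Fin p → ℝ) → ℝ) (hpxm : Measurable px) (hpx0 : ∀ x ∈ cube p, 0 ≤ px x)
    (pz : (Fin q → ℝ) → ℝ) (hpzm : Measurable pz) (hpz0 : ∀ z, 0 ≤ pz z)
    [IsProbabilityMeasure (Pxm px)] [IsProbabilityMeasure (Pzm pz)]
    (β₀ : Fin q → ℝ) (η₀ : (Fin p → ℝ) → ℝ) (hη : Measurable η₀)
    (M : Matrix (Fin q) (Fin q) ℝ) (hM : M.PosSemidef) (hdet : M.det ≠ 0) (δ : ℝ) (hδ : 0 < δ) (γ : ℝ≥0∞)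
    (hfix : ∀ x : Fin n → Fin p → ℝ, (∀ i, x i ∈ cube p) →
      Pdat n (Pzm pz) {w | ENNReal.ofReal (δ * (psi β₀ / (Real.sqrt M.det * (2 * π) ^ (-(q : ℝ) / 2))) / 2) <
        JU Q M (fun ω i => Ψ ω (x i) - η₀ (x i)) w.1 w.2 β₀} ≤ γ) :
    Measure.pi (fun _ : Fin n => trueMeasPL p q px pz β₀ η₀)
            {d : Fin n → (Fin p → ℝ) × (Fin q → ℝ) × ℝ | δ <
              ⨆ F : {F : Set (Fin q → ℝ) // MeasurableSet F},
                |postGen ((Q.map Ψ).prod (Measure.pi fun _ : Fin q => ProbabilityTheory.gaussianReal 0 1)) (fun θ => likPL θ.1 θ.2 d)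
                    {θ : ((Fin p → ℝ) → ℝ) × (Fin q → ℝ) |
                      Real.sqrt n • (θ.2 - β₀) ∈ F.1} -
                  normalProb q (bvmCenter n M β₀ η₀ d) M F.1|} ≤ γ := by
  set δ' := δ * (psi β₀ / (Real.sqrt M.det * (2 * π) ^ (-(q : ℝ) / 2))) / 2 with hδ'
  have hJ := JU_joint (n := n) Q Ψ hΨj η₀ hη M β₀
  let S : (Fin n → (Fin p → ℝ) × (Fin q → ℝ) × ℝ) → (Fin n → Fin p → ℝ) × (Fin n → Fin q → ℝ) × (Fin n → ℝ) :=
    fun d => (fun i => (d i).1, fun i => (d i).2.1, fun i => (d i).2.2 - (∑ j, (d i).2.1 j * β₀ j) - η₀ (d i).1)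
  have hS : Measurable S := by
    refine Measurable.prodMk (by fun_prop) (Measurable.prodMk (by fun_prop) ?_)
    fun_prop
  have hSd : ∀ d, mkd β₀ η₀ (S d).1 (S d).2.1 (S d).2.2 = d := by
    intro d; funext i
    simp only [mkd, S]
    refine Prod.ext rfl (Prod.ext rfl ?_)
    simp only
    ring
  have hTS : ∀ w : (Fin n → Fin p → ℝ) × (Fin n → Fin q → ℝ) × (Fin n → ℝ), S (mkd β₀ η₀ w.1 w.2.1 w.2.2) = w := by
    intro w
    refine Prod.ext rfl (Prod.ext rfl ?_)
    funext i
    simp only [mkd, S]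
    ring
  set G : Set ((Fin n → Fin p → ℝ) × (Fin n → Fin q → ℝ) × (Fin n → ℝ)) :=
    {w | ENNReal.ofReal δ' < JU Q M (fun ω i => Ψ ω (w.1 i) - η₀ (w.1 i)) w.2.1 w.2.2 β₀} with hG
  have hGm : MeasurableSet G := measurableSet_lt measurable_const hJ
  refine le_trans (measure_mono (t := S ⁻¹' G) ?_) ?_
  · intro d hd
    have hd' := hd
    rw [Set.mem_setOf_eq, ← hSd d] at hd'
    exact det_bound Q hn Ψ hΨ β₀ η₀ M hM hdet δ hδ _ _ _ hd'
  · have hP := pi_true (n := n) px hpxm hpx0 pz hpzm hpz0 β₀ η₀ hη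
    rw [← hP.measure_preimage (hS hGm).nullMeasurableSet, ← Set.preimage_comp]
    have hid : (S ∘ fun w : (Fin n → Fin p → ℝ) × (Fin n → Fin q → ℝ) × (Fin n → ℝ) => mkd β₀ η₀ w.1 w.2.1 w.2.2) = id := funext hTS
    rw [hid, Set.preimage_id, Measure.prod_apply hGm]
    have hae : ∀ᵐ x ∂(Measure.pi fun _ : Fin n => Pxm px), ∀ i, x i ∈ cube p := by
      have h1 : ∀ᵐ x ∂(Pxm px), x ∈ cube p := by
        have hmm : Measurable fun x => ENNReal.ofReal ((cube p).indicator px x) := ENNReal.measurable_ofReal.comp (hpxm.indicator (cube_meas p))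
        rw [Pxm, ae_withDensity_iff hmm]
        refine Filter.Eventually.of_forall fun x hx => ?_
        by_contra hc
        exact hx (by simp [Set.indicator_of_notMem hc])
      rw [ae_all_iff]
      intro i
      exact (measurePreserving_eval (fun _ : Fin n => Pxm px) i).quasiMeasurePreserving.ae h1
    calc _ ≤ ∫⁻ _x, γ ∂(Measure.pi fun _ : Fin n => Pxm px) := by
          refine lintegral_mono_ae ?_
          filter_upwards [hae] with x hx
          exact hfix x hx
      _ = γ := by simp

lemma Pxm_prob {p : ℕ} (px : (Fin p → ℝ) → ℝ) (hpx0 : ∀ x ∈ cube p, 0 ≤ px x)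
    (h1 : (∫ x in cube p, px x) = 1) : IsProbabilityMeasure (Pxm px) := by
  rw [← integral_indicator (cube_meas p)] at h1
  refine ⟨?_⟩
  rw [Pxm, withDensity_apply _ MeasurableSet.univ, Measure.restrict_univ,
    ← ofReal_integral_eq_lintegral_ofReal, h1, ENNReal.ofReal_one]
  · exact Integrable.of_integral_ne_zero (by rw [h1]; exact one_ne_zero)
  · exact Filter.Eventually.of_forall fun x => Set.indicator_nonneg hpx0 x

lemma Pzm_prob {q : ℕ} (pz : (Fin q → ℝ) → ℝ) (hpz0 : ∀ z, 0 ≤ pz z)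
    (h1 : (∫ z, pz z) = 1) : IsProbabilityMeasure (Pzm pz) := by
  refine ⟨?_⟩
  rw [Pzm, withDensity_apply _ MeasurableSet.univ, Measure.restrict_univ,
    ← ofReal_integral_eq_lintegral_ofReal, h1, ENNReal.ofReal_one]
  · exact Integrable.of_integral_ne_zero (by rw [h1]; exact one_ne_zero)
  · exact Filter.Eventually.of_forall fun x => hpz0 x

lemma Pzm_int {q : ℕ} (pz : (Fin q → ℝ) → ℝ) (hpzm : Measurable pz) (hpz0 : ∀ z, 0 ≤ pz z) (f : (Fin q → ℝ) → ℝ) :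
    ∫ z, f z ∂(Pzm pz) = ∫ z, f z * pz z := by
  rw [Pzm, integral_withDensity_eq_integral_toReal_smul (by fun_prop) (Filter.Eventually.of_forall fun _ => ENNReal.ofReal_lt_top)]
  refine integral_congr_ae (Filter.Eventually.of_forall fun z => ?_)
  simp only [ENNReal.toReal_ofReal (hpz0 z), smul_eq_mul]
  ring

lemma M_psd {q : ℕ} (Pz : Measure (Fin q → ℝ)) [IsProbabilityMeasure Pz] (Bz : ℝ) (hb : ∀ᵐ z ∂Pz, ∑ j, |z j| ≤ Bz)
    (M : Matrix (Fin q) (Fin q) ℝ) (hMd : ∀ j k, M j k = ∫ z, z j * z k ∂Pz) : M.PosSemidef := by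
  have hint : ∀ j k, Integrable (fun z : Fin q → ℝ => z j * z k) Pz := by
    intro j k
    refine Integrable.of_bound (by fun_prop) (Bz * Bz) ?_
    filter_upwards [hb] with z hz
    have hj : ∀ j, |z j| ≤ Bz := fun j =>
      (Finset.single_le_sum (f := fun j => |z j|) (fun i _ => abs_nonneg _) (Finset.mem_univ j)).trans hz
    rw [Real.norm_eq_abs, abs_mul]
    exact mul_le_mul (hj j) (hj k) (abs_nonneg _) ((abs_nonneg _).trans (hj j))
  refine Matrix.PosSemidef.of_dotProduct_mulVec_nonneg ?_ ?_
  · ext i j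
    simp only [Matrix.conjTranspose_apply, star_trivial]
    rw [hMd, hMd]; simp only [mul_comm]
  · intro u
    have : star u ⬝ᵥ M.mulVec u = ∫ z, (∑ j, u j * z j) ^ 2 ∂Pz := by
      have h1 : ∀ z : Fin q → ℝ, (∑ j, u j * z j) ^ 2 = ∑ j, ∑ k, (u j * u k) * (z j * z k) := by
        intro z
        rw [sq, Finset.sum_mul_sum]
        refine Finset.sum_congr rfl fun j _ => Finset.sum_congr rfl fun k _ => by ring
      simp only [h1]
      rw [integral_finsetSum _ (fun j _ => integrable_finsetSum _ fun k _ => (hint j k).const_mul _)]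
      simp only [star_trivial, dotProduct, Matrix.mulVec, Finset.mul_sum]
      refine Finset.sum_congr rfl fun j _ => ?_
      rw [integral_finsetSum _ (fun k _ => (hint j k).const_mul _)]
      refine Finset.sum_congr rfl fun k _ => ?_
      rw [integral_const_mul, hMd]; ring
    rw [this]
    exact integral_nonneg fun z => sq_nonneg _

lemma M_lam {q : ℕ} (hq : 0 < q) (M : Matrix (Fin q) (Fin q) ℝ) (hM : M.PosDef) :
    ∃ lam : ℝ, 0 < lam ∧ ∀ u, lam * ‖u‖ ^ 2 ≤ u ⬝ᵥ M.mulVec u := by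
  haveI : Nonempty (Fin q) := ⟨⟨0, hq⟩⟩
  haveI : Nontrivial (Fin q → ℝ) := inferInstance
  have hne : (Metric.sphere (0 : Fin q → ℝ) 1).Nonempty := NormedSpace.sphere_nonempty.2 zero_le_one
  have hc : Continuous fun u : Fin q → ℝ => u ⬝ᵥ M.mulVec u := by
    unfold Matrix.mulVec dotProduct; fun_prop
  obtain ⟨v, hv, hmin⟩ := (isCompact_sphere (0 : Fin q → ℝ) 1).exists_isMinOn hne hc.continuousOn
  have hv0 : v ≠ 0 := by
    intro h; rw [h] at hv; simp at hv
  have hpos : 0 < v ⬝ᵥ M.mulVec v := by simpa using hM.dotProduct_mulVec_pos hv0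
  refine ⟨_, hpos, fun u => ?_⟩
  by_cases hu : u = 0
  · subst hu; simp
  have hn : 0 < ‖u‖ := norm_pos_iff.2 hu
  have hs : ‖u‖⁻¹ • u ∈ Metric.sphere (0 : Fin q → ℝ) 1 := by
    simp [norm_smul, hn.ne']
  have := hmin hs
  simp only [Set.mem_setOf_eq, Matrix.mulVec_smul, dotProduct_smul, smul_dotProduct, smul_eq_mul] at this
  calc _ ≤ (‖u‖⁻¹ * (‖u‖⁻¹ * (u ⬝ᵥ M.mulVec u))) * ‖u‖ ^ 2 := mul_le_mul_of_nonneg_right this (by positivity)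
    _ = _ := by field_simp

/-- Bernstein-von Mises limit in the partial linear model: if `α > p/2`,
the marginal posterior of `√n(β - β₀)` merges uniformly over measurable sets with the
`N(Δ_n, (E zzᵀ)⁻¹)` distribution, in `P₀`-probability. -/
theorem statement14 {p q m : ℕ} (hp : 0 < p) (hq : 0 < q) (α B : ℝ) (hα : 0 < α)
    (hαp : (p : ℝ) / 2 < α)
    (hB : 0 < B) (hm : α ≤ (m : ℝ)) (hmin hmax : ℝ) (hh1 : 1 < hmin) (hh2 : hmin < hmax)
    (Bbar : ℝ) (hBbar : 0 < Bbar)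
    (φ : (Fin p → ℝ) → ℝ) (hφ : IsBoxedKernel φ)
    (hφpos : ∀ u : Fin p → ℝ, ‖u‖ < 1 → 0 < φ u)
    (β₀ : Fin q → ℝ) (η₀ : (Fin p → ℝ) → ℝ) (hη₀ : IsHolder p α B η₀)
    (px : (Fin p → ℝ) → ℝ) (hpxm : Measurable px)
    (c C : ℝ) (hc : 0 < c) (hpxb : ∀ x ∈ cube p, c ≤ px x ∧ px x ≤ C)
    (hpx1 : (∫ x in cube p, px x) = 1)
    (pz : (Fin q → ℝ) → ℝ) (hpzm : Measurable pz) (hpz0 : ∀ z, 0 ≤ pz z)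
    (Z : Set (Fin q → ℝ)) (hZc : IsCompact Z) (hpzZ : ∀ z ∉ Z, pz z = 0)
    (hZB : ∀ z ∈ Z, (∑ i, |z i|) ≤ Bbar)
    (hpz1 : (∫ z, pz z) = 1)
    (hmean : ∀ i, (∫ z : Fin q → ℝ, z i * pz z) = 0)
    (M : Matrix (Fin q) (Fin q) ℝ)
    (hM : M = Matrix.of fun i j => ∫ z : Fin q → ℝ, z i * z j * pz z)
    (hdet : M.det ≠ 0)
    (r₀ : ℝ) (hr₀ : 0 ≤ r₀) (PK : Measure ℕ) [IsProbabilityMeasure PK]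
    (hPK0 : PK {0} = 0)
    (htail : ∃ b₀ b₁ C₀ C₁ : ℝ, 0 < b₁ ∧ b₁ ≤ b₀ ∧ 0 < C₀ ∧ 0 < C₁ ∧
      ∀ x : ℝ, 2 ≤ x →
        C₀ * Real.exp (-b₀ * x ^ p * Real.log (x ^ p) ^ r₀) ≤
            (PK {K : ℕ | x ≤ (K : ℝ)}).toReal ∧
          (PK {K : ℕ | x ≤ (K : ℝ)}).toReal ≤
            C₁ * Real.exp (-b₁ * x ^ p * Real.log (x ^ p) ^ r₀))
    (νμ : Measure (Fin p → ℝ)) [IsProbabilityMeasure νμ]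
    (hνμ : ∃ g : (Fin p → ℝ) → ℝ, ContinuousOn g {u | ∀ j, |u j| ≤ 1} ∧
      (∀ u : Fin p → ℝ, (∀ j, |u j| ≤ 1) → 0 < g u) ∧
      νμ = (volume.restrict {u : Fin p → ℝ | ∀ j, |u j| ≤ 1}).withDensity
        fun u => ENNReal.ofReal (g u))
    (νξ : Measure ℝ) [IsProbabilityMeasure νξ]
    (hνξ : ∃ g : ℝ → ℝ, ContinuousOn g (Set.Icc (-B) B) ∧
      (∀ t ∈ Set.Icc (-B) B, 0 < g t) ∧
      νξ = (volume.restrict (Set.Icc (-B) B)).withDensity fun t => ENNReal.ofReal (g t))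
    (νh : ℕ → Measure ℝ) (hνhP : ∀ K, IsProbabilityMeasure (νh K))
    (hνh : ∀ K : ℕ, 1 ≤ K → ∃ g : ℝ → ℝ, Measurable g ∧
      (∀ t ∈ Set.Icc (hmin / K) (hmax / K), 0 < g t) ∧
      νh K = (volume.restrict (Set.Icc (hmin / K) (hmax / K))).withDensity
        fun t => ENNReal.ofReal (g t)) :
    ∀ δ : ℝ, 0 < δ →
      Filter.Tendsto (fun n : ℕ =>
          Measure.pi (fun _ : Fin n => trueMeasPL p q px pz β₀ η₀)
            {d : Fin n → (Fin p → ℝ) × (Fin q → ℝ) × ℝ | δ <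
              ⨆ F : {F : Set (Fin q → ℝ) // MeasurableSet F},
                |postGen (plPrior q φ m PK νμ νξ νh) (fun θ => likPL θ.1 θ.2 d)
                    {θ : ((Fin p → ℝ) → ℝ) × (Fin q → ℝ) |
                      Real.sqrt n • (θ.2 - β₀) ∈ F.1} -
                  normalProb q (bvmCenter n M β₀ η₀ d) M F.1|})
        Filter.atTop (nhds 0) := by
  obtain ⟨b₀, b₁, C₀, C₁, hb₁, -, hC₀, hC₁, ht⟩ := htail
  obtain ⟨gμ, -, -, hgμ⟩ := hνμ
  obtain ⟨gξ, hgξc, hgξp, hgξ⟩ := hνξ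
  haveI := hνhP
  intro δ hδ
  have hpx0 : ∀ x ∈ cube p, 0 ≤ px x := fun x hx => hc.le.trans (hpxb x hx).1
  haveI := Pxm_prob px hpx0 hpx1
  haveI := Pzm_prob pz hpz0 hpz1
  obtain ⟨hηc, hηB⟩ := holder_bound hη₀
  have hb : ∀ᵐ z ∂(Pzm pz), ∑ j, |z j| ≤ Bbar := by
    have hmm : Measurable fun z => ENNReal.ofReal (pz z) := by fun_prop
    rw [Pzm, ae_withDensity_iff hmm]
    refine Filter.Eventually.of_forall fun z hz => ?_
    by_contra hcon
    exact hz (by rw [hpzZ z (fun h => hcon (hZB z h)), ENNReal.ofReal_zero])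
  have hmean' : ∀ j, ∫ z, z j ∂(Pzm pz) = 0 := fun j => by
    rw [Pzm_int pz hpzm hpz0]; exact hmean j
  have hMd : ∀ j k, M j k = ∫ z, z j * z k ∂(Pzm pz) := fun j k => by
    rw [Pzm_int pz hpzm hpz0, hM]; rfl
  have hpsd := M_psd (Pzm pz) Bbar hb M hMd
  have hpd : M.PosDef := hpsd.posDef_iff_det_ne_zero.2 hdet
  obtain ⟨lam, hlam, hlamM⟩ := M_lam hq M hpd
  have hPK : ∀ x : ℝ, 2 ≤ x → PK {K : ℕ | x ≤ (K:ℝ)} ≠ 0 := by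
    intro x hx h0
    have h := (ht x hx).1
    rw [h0, ENNReal.toReal_zero] at h
    exact absurd h (not_le.2 (mul_pos hC₀ (Real.exp_pos _)))
  have hbm : MeasurableSet {u : Fin p → ℝ | ∀ j, |u j| ≤ 1} := by
    rw [Set.setOf_forall]
    exact MeasurableSet.iInter fun j => measurableSet_le (by fun_prop) measurable_const
  have hμ1 : νμ {u : Fin p → ℝ | ∀ j, |u j| ≤ 1} = 1 := dens_box volume _ hbm gμ νμ hgμ
  have hξ1 : νξ (Set.Icc (-B) B) = 1 := dens_box volume _ measurableSet_Icc gξ νξ hgξ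
  have hh : ∀ K : ℕ, 1 ≤ K → νh K (Set.Icc (hmin / K) (hmax / K)) = 1 := by
    intro K hK
    obtain ⟨g, -, -, hg⟩ := hνh K hK
    exact dens_box volume _ measurableSet_Icc g (νh K) hg
  have key := fixed_design (QQ (m := m) PK νμ νξ νh) (cube p) (PsiO φ m)
    (fun x => (measurable_pi_apply x).comp (PsiO_meas φ hφ.1)) η₀ B hηB M β₀ (Pzm pz) Bbar hBbar hb hmean' hMd
    lam hlam hlamM
    (fun τ hτ => prior_H2 hp hB hh1 hh2 hφ hφpos η₀ hηc hηB PK hPK νμ hμ1 νξ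
      (fun a ε hε ha => dens_pos B hB gξ hgξc hgξp νξ hgξ a ε hε ha) νh hh τ hτ)
    ((mIdx p m).card * B + 1) (by positivity)
    (fun d hd κ hκ => prior_H3 hp hB hh1 hh2 hφ hφpos PK hPK0 r₀ b₁ C₁ hr₀ hb₁ hC₁ (fun x hx => (ht x hx).2)
      νμ hμ1 νξ hξ1 νh hh d hd κ hκ)
  have hdp : 0 < M.det := hpd.det_pos
  have hδ' : 0 < δ * (psi β₀ / (Real.sqrt M.det * (2 * π) ^ (-(q : ℝ) / 2))) / 2 := by
    have := psi_pos β₀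
    have := Real.sqrt_pos.2 hdp
    positivity
  have hpr : plPrior q φ m PK νμ νξ νh = ((QQ (m := m) PK νμ νξ νh).map (PsiO φ m)).prod
      (Measure.pi fun _ : Fin q => ProbabilityTheory.gaussianReal 0 1) := by
    unfold plPrior
    rw [bind_eq PK νμ νξ νh φ hφ.1]
  rw [hpr, ENNReal.tendsto_nhds_zero]
  intro ε hε
  obtain ⟨γ, hγ, hγε⟩ : ∃ γ : ℝ, 0 < γ ∧ ENNReal.ofReal γ ≤ ε := by
    obtain ⟨r, hr0, hr⟩ := ENNReal.lt_iff_exists_nnreal_btwn.1 hε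
    exact ⟨r, by exact_mod_cast hr0, by rw [ENNReal.ofReal_coe_nnreal]; exact hr.le⟩
  filter_upwards [key _ hδ' γ hγ, Filter.eventually_ge_atTop 1] with n hn hn1
  refine le_trans ?_ hγε
  exact data_bound (QQ (m := m) PK νμ νξ νh) hn1 (PsiO φ m) (PsiO_meas φ hφ.1) (PsiO_joint φ hφ.1) px hpxm hpx0 pz hpzm hpz0
    β₀ η₀ hηc.measurable M hpsd hdet δ hδ (ENNReal.ofReal γ) hn

end KMP
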